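/- arXiv:2307.01460 — 2 statements merged into one kernel-verified Lean document; each statement's English description precedes it below -/
import Mathlib

section
/- Let l ≥ 4 be an integer, let G ∈ 𝒢_l and let C be an odd hole of G. For i = 1, 2 let P_i be a short or local (u_i, v_i)-jump over C such that {u1, v1} ≠ {u2, v2} and u1, u2, v2, v1 appear on C in clockwise order; assume P1 is across C*(v1, u1), P2 is across C*(u2, v2), and whenever P_i is local it is across one vertex. If at least one of P1, P2 is a local jump, then at most two vertices of V(C(v1, u1) ∪ C(u2, v2)) are not contained in any jump hole over C. -/
open SimpleGraph

variable {V : Type*}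

/-- The set of internal vertices of a walk from `x` to `y`. -/
def wInterior {G : SimpleGraph V} {x y : V} (P : G.Walk x y) : Set V :=
  {a | a ∈ P.support ∧ a ≠ x ∧ a ≠ y}

/-- `P` is an induced path of `G`. -/
def IsInducedPath (G : SimpleGraph V) {x y : V} (P : G.Walk x y) : Prop :=
  P.IsPath ∧ ∀ a ∈ P.support, ∀ b ∈ P.support, G.Adj a b → s(a, b) ∈ P.edges

/-- A hole of `G`: an induced cycle of length at least 4. -/
def IsHole (G : SimpleGraph V) {v : V} (w : G.Walk v v) : Prop :=
  w.IsCycle ∧ 4 ≤ w.length ∧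
    ∀ a ∈ w.support, ∀ b ∈ w.support, G.Adj a b → s(a, b) ∈ w.edges

/-- An odd hole of `G`. -/
def IsOddHole (G : SimpleGraph V) {v : V} (w : G.Walk v v) : Prop :=
  IsHole G w ∧ Odd w.length

/-- `G` belongs to the family `𝒢ₗ`: it has girth `2l+1` and
no odd hole of length at least `2l+3`. -/
def MemGFam (G : SimpleGraph V) (l : ℕ) : Prop :=
  G.girth = (2 * l + 1 : ℕ) ∧
    ∀ (v : V) (w : G.Walk v v), IsOddHole G w → w.length < 2 * l + 3

/-- `G` is `k`-vertex-critical. -/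
def IsVertexCritical (G : SimpleGraph V) (k : ℕ) : Prop :=
  G.chromaticNumber = k ∧
    ∀ v : V, (G.induce {u | u ≠ v}).chromaticNumber < k

/-- `S` is a vertex cut of `G`: deleting `S` leaves a disconnected graph. -/
def IsVertexCut (G : SimpleGraph V) (S : Set V) : Prop :=
  ¬ (G.induce Sᶜ).Preconnected

/-- `G` has a `K2`-cut. -/
def HasK2Cut (G : SimpleGraph V) : Prop :=
  ∃ u v : V, G.Adj u v ∧ IsVertexCut G {u, v}

/-- `G` has a `P3`-cut. -/
def HasP3Cut (G : SimpleGraph V) : Prop :=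
  ∃ u v w : V, u ≠ w ∧ G.Adj u v ∧ G.Adj v w ∧ ¬ G.Adj u w ∧ IsVertexCut G {u, v, w}

/-- `G` has a 2-edge-cut: two edges whose removal disconnects the graph. -/
def Has2EdgeCut (G : SimpleGraph V) : Prop :=
  ∃ e f : Sym2 V, e ≠ f ∧ e ∈ G.edgeSet ∧ f ∈ G.edgeSet ∧
    ¬ (G.deleteEdges {e, f}).Preconnected

/-- `Q1`, `Q2` are the two internally disjoint `(x,y)`-paths of the cycle `w`. -/
def ArcsOf (G : SimpleGraph V) {v x y : V} (w : G.Walk v v) (Q1 Q2 : G.Walk x y) : Prop :=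
  x ∈ w.support ∧ y ∈ w.support ∧ x ≠ y ∧ Q1.IsPath ∧ Q2.IsPath ∧
    ({a | a ∈ Q1.support} ∩ {a | a ∈ Q2.support} = {x, y}) ∧
    ({e | e ∈ w.edges} = {e | e ∈ Q1.edges} ∪ {e | e ∈ Q2.edges})

/-- `P` is a chordal path of the hole `w`: `w ∪ P` is an induced theta-subgraph of `G`. -/
def IsChordalPath (G : SimpleGraph V) {v x y : V} (w : G.Walk v v) (P : G.Walk x y) : Prop :=
  IsHole G w ∧ P.IsPath ∧ 2 ≤ P.length ∧ x ∈ w.support ∧ y ∈ w.support ∧ x ≠ y ∧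
    (∀ a ∈ wInterior P, a ∉ w.support) ∧
    (∀ a, (a ∈ w.support ∨ a ∈ P.support) → ∀ b, (b ∈ w.support ∨ b ∈ P.support) →
      G.Adj a b → (s(a, b) ∈ w.edges ∨ s(a, b) ∈ P.edges))

/-- `P` is an `(s,t)`-jump over the hole `w`. -/
def IsJump (G : SimpleGraph V) {v s t : V} (w : G.Walk v v) (P : G.Walk s t) : Prop :=
  IsHole G w ∧ s ∈ w.support ∧ t ∈ w.support ∧ s ≠ t ∧ ¬ G.Adj s t ∧
    IsInducedPath G P ∧ ∀ a ∈ wInterior P, a ∉ w.support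

/-- `P` is a local jump over `w` across the interior of the arc `Q1`
(`Q1`, `Q2` being the two arcs of `w` between the ends of `P`). -/
def IsLocalJumpAcross (G : SimpleGraph V) {v s t : V} (w : G.Walk v v)
    (P Q1 Q2 : G.Walk s t) : Prop :=
  IsJump G w P ∧ ArcsOf G w Q1 Q2 ∧
    (∃ a ∈ wInterior Q1, ∃ b ∈ wInterior P, G.Adj a b) ∧
    (∀ a ∈ wInterior Q2, ∀ b ∈ wInterior P, ¬ G.Adj a b)

/-- `P` is a local jump over `w`. -/
def IsLocalJump (G : SimpleGraph V) {v s t : V} (w : G.Walk v v) (P : G.Walk s t) : Prop :=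
  ∃ Q1 Q2 : G.Walk s t, IsLocalJumpAcross G w P Q1 Q2

/-- `P` is a local jump over `w` across one vertex. -/
def IsLocalJumpAcrossOne (G : SimpleGraph V) {v s t : V} (w : G.Walk v v)
    (P : G.Walk s t) : Prop :=
  ∃ Q1 Q2 : G.Walk s t, IsLocalJumpAcross G w P Q1 Q2 ∧ Q1.length = 2

/-- `P` is a short jump over `w`: no internal vertex of either arc of `w`
has a neighbour among the internal vertices of `P`. -/
def IsShortJump (G : SimpleGraph V) {v s t : V} (w : G.Walk v v) (P : G.Walk s t) : Prop :=
  IsJump G w P ∧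
    ∀ a ∈ w.support, a ≠ s → a ≠ t → ∀ b ∈ wInterior P, ¬ G.Adj a b

/-- `P` is a short jump over `w` across the interior of `Q1`, i.e. `P ∪ Q1` is an
odd hole (a jump hole over `w`). -/
def IsShortJumpAcross (G : SimpleGraph V) {v s t : V} (w : G.Walk v v)
    (P Q1 Q2 : G.Walk s t) : Prop :=
  IsShortJump G w P ∧ ArcsOf G w Q1 Q2 ∧ IsOddHole G (P.append Q1.reverse)

/-- `x` lies in some jump hole over `w`. -/
def InJumpHoleOver (G : SimpleGraph V) {v : V} (w : G.Walk v v) (x : V) : Prop :=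
  ∃ (s t : V) (P Q1 Q2 : G.Walk s t),
    IsShortJumpAcross G w P Q1 Q2 ∧ (x ∈ P.support ∨ x ∈ Q1.support)

/-- `a`, `b`, `c`, `d` appear on the cycle `w` in this cyclic order. -/
def CyclicOrder4 (G : SimpleGraph V) {v : V} (w : G.Walk v v) (a b c d : V) : Prop :=
  ∃ n : ℕ, List.Sublist [a, b, c, d] (w.support.tail.rotate n)

/-- A `K4`-subdivision in `G`: four distinct branch vertices joined by six
internally disjoint paths (the arrises). -/
structure K4Sub (G : SimpleGraph V) where
  u1 : V
  u2 : V
  u3 : V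
  u4 : V
  P1 : G.Walk u1 u2
  P2 : G.Walk u3 u4
  Q1 : G.Walk u2 u3
  Q2 : G.Walk u1 u4
  L1 : G.Walk u1 u3
  L2 : G.Walk u2 u4
  hu : List.Nodup [u1, u2, u3, u4]
  hP1 : P1.IsPath
  hP2 : P2.IsPath
  hQ1 : Q1.IsPath
  hQ2 : Q2.IsPath
  hL1 : L1.IsPath
  hL2 : L2.IsPath
  hP : ∀ a ∈ P1.support, a ∉ P2.support
  hQ : ∀ a ∈ Q1.support, a ∉ Q2.support
  hL : ∀ a ∈ L1.support, a ∉ L2.support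

namespace K4Sub

variable {G : SimpleGraph V}

/-- The face cycle `C1 = P1 ∪ Q1 ∪ L1`. -/
def C1 (H : K4Sub G) : G.Walk H.u1 H.u1 := (H.P1.append H.Q1).append H.L1.reverse
/-- The face cycle `C2 = P1 ∪ Q2 ∪ L2`. -/
def C2 (H : K4Sub G) : G.Walk H.u1 H.u1 := (H.P1.append H.L2).append H.Q2.reverse
/-- The face cycle `C3 = P2 ∪ Q1 ∪ L2`. -/
def C3 (H : K4Sub G) : G.Walk H.u2 H.u2 := (H.Q1.append H.P2).append H.L2.reverse
/-- The face cycle `C4 = C1 △ C2 △ C3 = P2 ∪ Q2 ∪ L1`. -/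
def C4 (H : K4Sub G) : G.Walk H.u1 H.u1 := (H.L1.append H.P2).append H.Q2.reverse

/-- The vertex set of the subdivision. -/
def verts (H : K4Sub G) : Set V :=
  {a | a ∈ H.P1.support ∨ a ∈ H.P2.support ∨ a ∈ H.Q1.support ∨
       a ∈ H.Q2.support ∨ a ∈ H.L1.support ∨ a ∈ H.L2.support}

/-- The edge set of the subdivision. -/
def edges (H : K4Sub G) : Set (Sym2 V) :=
  {e | e ∈ H.P1.edges ∨ e ∈ H.P2.edges ∨ e ∈ H.Q1.edges ∨
       e ∈ H.Q2.edges ∨ e ∈ H.L1.edges ∨ e ∈ H.L2.edges}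

end K4Sub

/-- `H` is an odd `K4`-subdivision: all four face cycles are odd holes. -/
def IsOddK4 (G : SimpleGraph V) (H : K4Sub G) : Prop :=
  IsOddHole G H.C1 ∧ IsOddHole G H.C2 ∧ IsOddHole G H.C3 ∧ IsOddHole G H.C4

/-- `G` has an odd `K4`-subdivision. -/
def HasOddK4 (G : SimpleGraph V) : Prop := ∃ H : K4Sub G, IsOddK4 G H

/-- `H` is a balanced `K4`-subdivision of type `(1,2)`. -/
def IsBalancedK4 (G : SimpleGraph V) (H : K4Sub G) : Prop :=
  IsOddHole G H.C1 ∧ IsOddHole G H.C2 ∧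
    IsHole G H.C3 ∧ Even H.C3.length ∧ IsHole G H.C4 ∧ Even H.C4.length ∧
    H.Q1.length = 1 ∧ 2 ≤ H.L2.length

/-- `G` contains a balanced `K4`-subdivision of type `(1,2)`. -/
def HasBalancedK4 (G : SimpleGraph V) : Prop := ∃ H : K4Sub G, IsBalancedK4 G H

/-- `P` is a direct connection linking the (vertex sets of) two disjoint induced
subgraphs `S1` and `S2`. -/
def IsDirectConnection (G : SimpleGraph V) (S1 S2 : Set V) {v1 v2 : V}
    (P : G.Walk v1 v2) : Prop :=
  IsInducedPath G P ∧ (∀ x ∈ P.support, x ∉ S1 ∧ x ∉ S2) ∧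
    (∃ y ∈ S1, G.Adj v1 y) ∧ (∃ y ∈ S2, G.Adj v2 y) ∧
    (∀ x ∈ P.support, (∃ y ∈ S1, G.Adj x y) → x = v1) ∧
    (∀ x ∈ P.support, (∃ y ∈ S2, G.Adj x y) → x = v2)

/-- `P` is a minimal direct connection linking `S1` and `S2`. -/
def IsMinimalDirectConnection (G : SimpleGraph V) (S1 S2 : Set V) {v1 v2 : V}
    (P : G.Walk v1 v2) : Prop :=
  IsDirectConnection G S1 S2 P ∧
    ∀ (w1 w2 : V) (P' : G.Walk w1 w2), IsDirectConnection G S1 S2 P' →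
      (∀ x ∈ P'.support, x ∈ P.support) → ∀ x ∈ P.support, x ∈ P'.support

section InducedPaths

variable {G : SimpleGraph V}

lemma mem_wInterior_reverse {x y a : V} {P : G.Walk x y} :
    a ∈ wInterior P.reverse ↔ a ∈ wInterior P := by
  simp only [wInterior, Walk.support_reverse, List.mem_reverse, Set.mem_ofPred_eq]
  tauto

namespace IsInducedPath

lemma reverse {x y : V} {P : G.Walk x y} (h : IsInducedPath G P) :
    IsInducedPath G P.reverse :=
  ⟨h.1.reverse, fun a ha b hb hab => by
    simp only [Walk.support_reverse, Walk.edges_reverse, List.mem_reverse] at *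
    exact h.2 a ha b hb hab⟩

lemma of_adj {x y : V} (h : G.Adj x y) : IsInducedPath G h.toWalk := by
  refine ⟨h.isPath_toWalk, fun a ha b hb hab => ?_⟩
  simp at ha hb ⊢
  rcases ha with rfl | rfl <;> rcases hb with rfl | rfl <;> simp_all

lemma append {x y z : V} {P : G.Walk x y} {Q : G.Walk y z} (hP : IsInducedPath G P)
    (hQ : IsInducedPath G Q)
    (heq : ∀ a ∈ P.support, a ∈ Q.support → a = y)
    (hadj : ∀ a ∈ P.support, ∀ b ∈ Q.support, G.Adj a b → a = y ∨ b = y) :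
    IsInducedPath G (P.append Q) := by
  constructor
  · rw [Walk.isPath_def, Walk.support_append, List.nodup_append']
    refine ⟨hP.1.support_nodup, hQ.1.support_nodup.tail, fun a ha hb => ?_⟩
    have h := heq a ha (List.mem_of_mem_tail hb)
    subst h
    have := hQ.1.support_nodup
    rw [← Walk.cons_tail_support, List.nodup_cons] at this
    exact this.1 hb
  · have key : ∀ a ∈ P.support, ∀ b ∈ Q.support, G.Adj a b → s(a, b) ∈ (P.append Q).edges := by
      intro a ha b hb hab
      rw [Walk.edges_append, List.mem_append]
      rcases hadj a ha b hb hab with rfl | rfl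
      · exact Or.inr (hQ.2 _ (Walk.start_mem_support _) b hb hab)
      · exact Or.inl (hP.2 a ha _ (Walk.end_mem_support _) hab)
    intro a ha b hb hab
    rw [Walk.mem_support_append_iff] at ha hb
    rcases ha with ha | ha <;> rcases hb with hb | hb
    · rw [Walk.edges_append, List.mem_append]
      exact Or.inl (hP.2 a ha b hb hab)
    · exact key a ha b hb hab
    · rw [Sym2.eq_swap]
      exact key b hb a ha hab.symm
    · rw [Walk.edges_append, List.mem_append]
      exact Or.inr (hQ.2 a ha b hb hab)

lemma cons {x y z : V} {P : G.Walk y z} (hP : IsInducedPath G P) (h : G.Adj x y)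
    (hx : ∀ a ∈ P.support, x = a ∨ G.Adj x a → a = y) : IsInducedPath G (Walk.cons h P) := by
  have hne : x ∉ P.support := fun hm => h.ne (hx x hm (Or.inl rfl))
  refine (append (of_adj h) hP ?_ ?_ : IsInducedPath G (h.toWalk.append P))
  · intro a ha hb
    exact (by simpa using ha : a = x ∨ a = y).resolve_left (fun e => hne (e ▸ hb))
  · intro a ha b hb hab
    rcases (by simpa using ha : a = x ∨ a = y) with rfl | rfl
    · exact Or.inr (hx b hb (Or.inr hab))
    · exact Or.inl rfl

lemma support_inter [DecidableEq V] {x y a b : V} {P : G.Walk x y} (hP : P.IsPath)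
    (ha : a ∈ P.support) (h1 : b ∈ (P.takeUntil a ha).support)
    (h2 : b ∈ (P.dropUntil a ha).support) : b = a := by
  have h := hP.support_nodup
  rw [← P.take_spec ha, Walk.support_append, List.nodup_append'] at h
  by_contra hne
  rw [← Walk.cons_tail_support, List.mem_cons] at h2
  exact h.2.2 h1 (h2.resolve_left hne)

lemma takeUntil [DecidableEq V] {x y a : V} {P : G.Walk x y} (hP : IsInducedPath G P)
    (ha : a ∈ P.support) : IsInducedPath G (P.takeUntil a ha) := by
  refine ⟨hP.1.takeUntil ha, fun b hb c hc hbc => ?_⟩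
  have h := hP.2 b (P.support_takeUntil_subset_support ha hb) c
    (P.support_takeUntil_subset_support ha hc) hbc
  rw [← P.take_spec ha, Walk.edges_append, List.mem_append] at h
  refine h.resolve_right fun h => hbc.ne ?_
  rw [support_inter hP.1 ha hb (Walk.fst_mem_support_of_mem_edges _ h),
    support_inter hP.1 ha hc (Walk.snd_mem_support_of_mem_edges _ h)]

lemma adj_end [DecidableEq V] {x y a b : V} {P : G.Walk x y} (hP : IsInducedPath G P)
    (ha : a ∈ P.support) (hay : a ≠ y) (hb : b ∈ (P.takeUntil a ha).support)
    (hby : G.Adj b y) : b = a := by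
  have h := hP.2 b (P.support_takeUntil_subset_support ha hb) y (Walk.end_mem_support _) hby
  rw [← P.take_spec ha, Walk.edges_append, List.mem_append] at h
  rcases h with h | h
  · exact absurd (support_inter hP.1 ha (Walk.snd_mem_support_of_mem_edges _ h)
      (Walk.end_mem_support _)).symm hay
  · exact support_inter hP.1 ha hb (Walk.fst_mem_support_of_mem_edges _ h)

/-- Two induced paths with the same nonadjacent ends and no further contact form a hole. -/
lemma isHole_append {x y : V} {P : G.Walk x y} {Q : G.Walk y x} (hP : IsInducedPath G P)
    (hQ : IsInducedPath G Q) (hxy : x ≠ y) (hnadj : ¬ G.Adj x y)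
    (heq : ∀ a ∈ P.support, a ∈ Q.support → a = x ∨ a = y)
    (hadj : ∀ a ∈ P.support, ∀ b ∈ Q.support, G.Adj a b →
      a = x ∨ a = y ∨ b = x ∨ b = y) :
    IsHole G (P.append Q) := by
  have hl : ∀ {u v : V} (R : G.Walk u v), u ≠ v → ¬ G.Adj u v → 2 ≤ R.length := by
    intro u v R h1 h2
    by_contra h
    rcases (by omega : R.length = 0 ∨ R.length = 1) with h | h
    · exact h1 (Walk.eq_of_length_eq_zero h)
    · exact h2 (Walk.adj_of_length_eq_one h)
  have l1 := hl P hxy hnadj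
  have l2 := hl Q hxy.symm (fun h => hnadj h.symm)
  refine ⟨hP.1.isCycle_append hQ.1 ?_ (Or.inl (by omega)), by rw [Walk.length_append]; omega, ?_⟩
  · intro a ha hb
    have n1 := hP.1.support_nodup
    have n2 := hQ.1.support_nodup
    rw [← Walk.cons_tail_support, List.nodup_cons] at n1 n2
    rcases heq a (List.mem_of_mem_tail ha) (List.mem_of_mem_tail hb) with rfl | rfl
    · exact n1.1 ha
    · exact n2.1 hb
  · have key : ∀ a ∈ P.support, ∀ b ∈ Q.support, G.Adj a b → s(a, b) ∈ (P.append Q).edges := by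
      intro a ha b hb hab
      rw [Walk.edges_append, List.mem_append]
      rcases hadj a ha b hb hab with rfl | rfl | rfl | rfl
      · exact Or.inr (hQ.2 _ (Walk.end_mem_support _) b hb hab)
      · exact Or.inr (hQ.2 _ (Walk.start_mem_support _) b hb hab)
      · exact Or.inl (hP.2 a ha _ (Walk.start_mem_support _) hab)
      · exact Or.inl (hP.2 a ha _ (Walk.end_mem_support _) hab)
    intro a ha b hb hab
    rw [Walk.mem_support_append_iff] at ha hb
    rcases ha with ha | ha <;> rcases hb with hb | hb
    · rw [Walk.edges_append, List.mem_append]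
      exact Or.inl (hP.2 a ha b hb hab)
    · exact key a ha b hb hab
    · rw [Sym2.eq_swap]
      exact key b hb a ha hab.symm
    · rw [Walk.edges_append, List.mem_append]
      exact Or.inr (hQ.2 a ha b hb hab)

end IsInducedPath

/-- The part of an induced path strictly after its start and up to an internal vertex `p`. -/
lemma exists_walk_to_interior {u v p : V} {P : G.Walk u v} (hP : IsInducedPath G P)
    (hp : p ∈ wInterior P) :
    ∃ (y : V) (R : G.Walk y p), G.Adj u y ∧
      ∀ a ∈ R.support, a ∈ wInterior P ∧ (G.Adj a v → a = p) := by
  classical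
  obtain ⟨hps, hpu, hpv⟩ := hp
  have hT := (hP.takeUntil hps).1
  have hsub := P.support_takeUntil_subset_support hps
  have hend := fun b hb => hP.adj_end hps hpv (b := b) hb
  have hv : v ∉ (P.takeUntil p hps).support :=
    Walk.endpoint_notMem_support_takeUntil hP.1 hps hpv.symm
  generalize P.takeUntil p hps = T at hT hsub hend hv
  cases T with
  | nil => exact absurd rfl hpu
  | cons h R =>
    rw [Walk.cons_isPath_iff] at hT
    refine ⟨_, R, h, fun a ha => ?_⟩
    have ha' : a ∈ (Walk.cons h R).support := by simp [ha]
    exact ⟨⟨hsub ha', fun e => hT.2 (e ▸ ha), fun e => hv (e ▸ ha')⟩, hend a ha'⟩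

/-- Between two vertex sets joined by a walk there is an induced path inside that walk which meets
each of the two sets only at its end. -/
lemma exists_inducedPath_between {A B : Set V} {y z : V} (R : G.Walk y z) (hy : y ∈ A)
    (hz : z ∈ B) :
    ∃ (y' z' : V) (Q : G.Walk y' z'), y' ∈ A ∧ z' ∈ B ∧ IsInducedPath G Q ∧
      (∀ a ∈ Q.support, a ∈ R.support) ∧ (∀ a ∈ Q.support, a ∈ A → a = y') ∧
      (∀ a ∈ Q.support, a ∈ B → a = z') := by
  classical
  let S : ℕ → Prop := fun k => ∃ (y' z' : V) (Q : G.Walk y' z'), y' ∈ A ∧ z' ∈ B ∧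
    (∀ a ∈ Q.support, a ∈ R.support) ∧ Q.length = k
  have hS : ∃ k, S k := ⟨_, y, z, R, hy, hz, fun _ h => h, rfl⟩
  obtain ⟨y', z', Q0, hy', hz', hsub0, hlen0⟩ := Nat.find_spec hS
  have hmin0 : ∀ (y₁ z₁ : V) (Q₁ : G.Walk y₁ z₁), y₁ ∈ A → z₁ ∈ B →
      (∀ a ∈ Q₁.support, a ∈ R.support) → Q0.length ≤ Q₁.length := fun y₁ z₁ Q₁ h1 h2 h3 =>
    hlen0 ▸ Nat.find_min' hS ⟨y₁, z₁, Q₁, h1, h2, h3, rfl⟩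
  obtain ⟨Q, hQ, hsub, hmin⟩ : ∃ Q : G.Walk y' z', Q.IsPath ∧ (∀ a ∈ Q.support, a ∈ R.support) ∧
      ∀ (y₁ z₁ : V) (Q₁ : G.Walk y₁ z₁), y₁ ∈ A → z₁ ∈ B →
      (∀ a ∈ Q₁.support, a ∈ R.support) → Q.length ≤ Q₁.length :=
    ⟨Q0.bypass, Q0.bypass_isPath, fun a ha => hsub0 a (Q0.support_bypass_subset_support ha),
      fun y₁ z₁ Q₁ h1 h2 h3 => (Q0.length_bypass_le_length).trans (hmin0 y₁ z₁ Q₁ h1 h2 h3)⟩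
  refine ⟨y', z', Q, hy', hz', ⟨hQ, ?_⟩, hsub, ?_, ?_⟩
  · have key : ∀ i j : ℕ, i < j → j ≤ Q.length → G.Adj (Q.getVert i) (Q.getVert j) →
        s(Q.getVert i, Q.getVert j) ∈ Q.edges := by
      intro i j hij hj hadj
      have h := hmin _ _ ((Q.take i).append (Walk.cons hadj (Q.drop j))) hy' hz' (by
        intro a ha
        rw [Walk.mem_support_append_iff, Walk.support_cons, List.mem_cons] at ha
        rcases ha with ha | rfl | ha
        · exact hsub _ ((Q.isSubwalk_take i).support_subset ha)
        · exact hsub _ (Q.getVert_mem_support i)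
        · exact hsub _ ((Q.isSubwalk_drop j).support_subset ha))
      rw [Walk.length_append, Walk.length_cons, Walk.take_length, Walk.drop_length] at h
      have : j = i + 1 := by omega
      subst this
      exact (Q.mk_mem_edges_iff_exists).2 ⟨i, by omega, rfl⟩
    intro a ha b hb hab
    obtain ⟨i, rfl, hi⟩ := Walk.mem_support_iff_exists_getVert.1 ha
    obtain ⟨j, rfl, hj⟩ := Walk.mem_support_iff_exists_getVert.1 hb
    rcases lt_trichotomy i j with h | rfl | h
    · exact key i j h hj hab
    · exact absurd rfl hab.ne
    · rw [Sym2.eq_swap]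
      exact key j i h hi hab.symm
  · intro a ha haA
    by_contra hne
    have h := hmin _ _ (Q.dropUntil a ha) haA hz'
      fun b hb => hsub b (Q.support_dropUntil_subset_support ha hb)
    exact absurd (Q.length_dropUntil_lt_length ha hne) (by omega)
  · intro a ha haB
    by_contra hne
    have h := hmin _ _ (Q.takeUntil a ha) hy' haB
      fun b hb => hsub b (Q.support_takeUntil_subset_support ha hb)
    exact absurd (Q.length_takeUntil_lt_length ha hne) (by omega)

end InducedPaths

/-- `c` parametrizes the odd hole `w` of a graph in `𝒢ₗ` by the integers modulo `2l+1`. -/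
structure HoleParam (G : SimpleGraph V) (l : ℕ) {v : V} (w : G.Walk v v) (c : ℤ → V) : Prop where
  four_le : 4 ≤ l
  girth_le : ∀ (a : V) (q : G.Walk a a), q.IsCycle → 2 * l + 1 ≤ q.length
  odd_length : ∀ (a : V) (q : G.Walk a a), IsHole G q → Odd q.length → q.length = 2 * l + 1
  hole : IsHole G w
  inj : ∀ x y, c x = c y ↔ (2 * l + 1 : ℤ) ∣ x - y
  adj : ∀ x y, G.Adj (c x) (c y) ↔ (2 * l + 1 : ℤ) ∣ x - y - 1 ∨ (2 * l + 1 : ℤ) ∣ x - y + 1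
  mem_support : ∀ a, a ∈ w.support ↔ ∃ t, a = c t
  mem_edges : ∀ e, e ∈ w.edges ↔ ∃ t, e = s(c t, c (t + 1))

lemma Int.eq_zero_of_dvd_of_lt {n x : ℤ} (h : n ∣ x) (h1 : -n < x) (h2 : x < n) : x = 0 :=
  Int.eq_zero_of_abs_lt_dvd h (abs_lt.2 ⟨h1, h2⟩)

lemma Int.eq_zero_or_eq_of_dvd_of_lt {n x : ℤ} (h : n ∣ x) (h1 : -n < x) (h2 : x < 2 * n) :
    x = 0 ∨ x = n := by
  by_cases hx : x < n
  · exact Or.inl (Int.eq_zero_of_dvd_of_lt h h1 hx)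
  · have := Int.eq_zero_of_dvd_of_lt (dvd_sub_self_right.2 h) (by omega) (by omega : x - n < n)
    omega

lemma mem_support_cases {G : SimpleGraph V} {x y a : V} {P : G.Walk x y} (ha : a ∈ P.support) :
    a = x ∨ a = y ∨ a ∈ wInterior P := by
  by_cases h1 : a = x
  · exact Or.inl h1
  · by_cases h2 : a = y
    · exact Or.inr (Or.inl h2)
    · exact Or.inr (Or.inr ⟨ha, h1, h2⟩)

lemma exists_mem_wInterior {G : SimpleGraph V} {x y : V} {P : G.Walk x y} (hP : P.IsPath)
    (hne : x ≠ y) (hnadj : ¬ G.Adj x y) : ∃ a, a ∈ wInterior P := by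
  cases P with
  | nil => exact absurd rfl hne
  | @cons _ z _ h Q =>
    rw [Walk.cons_isPath_iff] at hP
    exact ⟨z, by simp, h.ne', fun e => hnadj (e ▸ h)⟩

namespace HoleParam

variable {G : SimpleGraph V} {l : ℕ} {v : V} {w : G.Walk v v} {c : ℤ → V}

lemma ne (H : HoleParam G l w c) {x y : ℤ} (h1 : x < y) (h2 : y < x + (2 * l + 1)) :
    c x ≠ c y := fun h => by
  have := Int.eq_zero_of_dvd_of_lt ((H.inj x y).1 h) (by omega) (by omega)
  omega

lemma not_adj (H : HoleParam G l w c) {x y : ℤ} (h1 : x + 1 < y) (h2 : y < x + 2 * l) :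
    ¬ G.Adj (c x) (c y) := fun h => by
  rcases (H.adj x y).1 h with h | h
  · have := Int.eq_zero_or_eq_of_dvd_of_lt (dvd_neg.2 h) (by omega) (by omega)
    omega
  · have := Int.eq_zero_or_eq_of_dvd_of_lt (dvd_neg.2 h) (by omega) (by omega)
    omega

lemma add_period (H : HoleParam G l w c) (x : ℤ) : c (x + (2 * l + 1)) = c x :=
  (H.inj _ _).2 ⟨1, by ring⟩

lemma sub_period (H : HoleParam G l w c) (x : ℤ) : c (x - (2 * l + 1)) = c x :=
  (H.inj _ _).2 ⟨-1, by ring⟩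

lemma adj_succ (H : HoleParam G l w c) (x : ℤ) : G.Adj (c x) (c (x + 1)) :=
  (H.adj _ _).2 (Or.inr ⟨0, by ring⟩)

lemma reflect (H : HoleParam G l w c) (s : ℤ) : HoleParam G l w (fun t => c (s - t)) where
  four_le := H.four_le
  girth_le := H.girth_le
  odd_length := H.odd_length
  hole := H.hole
  inj x y := by
    rw [H.inj, ← dvd_neg]
    ring_nf
  adj x y := by
    rw [H.adj, or_comm, ← dvd_neg, ← dvd_neg (b := s - x - (s - y) - 1)]
    ring_nf
  mem_support a := by
    rw [H.mem_support]
    constructor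
    · rintro ⟨t, rfl⟩
      exact ⟨s - t, by ring_nf⟩
    · rintro ⟨t, rfl⟩
      exact ⟨s - t, rfl⟩
  mem_edges e := by
    rw [H.mem_edges]
    constructor
    · rintro ⟨t, rfl⟩
      exact ⟨s - t - 1, by rw [Sym2.eq_swap]; ring_nf⟩
    · rintro ⟨t, rfl⟩
      exact ⟨s - t - 1, by rw [Sym2.eq_swap]; ring_nf⟩

lemma shift (H : HoleParam G l w c) (s : ℤ) : HoleParam G l w (fun t => c (s + t)) := by
  have h := (H.reflect s).reflect 0
  have e : (fun t => (fun t => c (s - t)) (0 - t)) = fun t => c (s + t) := by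
    funext t
    simp
  rwa [e] at h

lemma exists_eq_add (H : HoleParam G l w c) (s t : ℤ) :
    ∃ e : ℤ, 0 ≤ e ∧ e < 2 * l + 1 ∧ c t = c (s + e) := by
  refine ⟨(t - s) % (2 * l + 1), Int.emod_nonneg _ (by omega), Int.emod_lt_of_pos _ (by omega), ?_⟩
  rw [H.inj]
  refine ⟨(t - s) / (2 * l + 1), ?_⟩
  have := Int.emod_add_mul_ediv (t - s) (2 * l + 1)
  linarith

/-- The arc of the hole of length `k` starting at `c s`. -/
lemma exists_arc (H : HoleParam G l w c) (s : ℤ) (k : ℕ) (hk : k < 2 * l + 1) {a b : V}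
    (ha : a = c s) (hb : b = c (s + k)) :
    ∃ Q : G.Walk a b, Q.IsPath ∧ Q.length = k ∧
      (∀ x, x ∈ Q.support ↔ ∃ t : ℤ, 0 ≤ t ∧ t ≤ k ∧ x = c (s + t)) ∧
      (∀ e, e ∈ Q.edges ↔ ∃ t : ℤ, 0 ≤ t ∧ t < k ∧ e = s(c (s + t), c (s + t + 1))) := by
  subst ha
  induction k generalizing s b with
  | zero =>
    have : b = c s := by rw [hb]; simp
    subst this
    refine ⟨Walk.nil, Walk.IsPath.nil, rfl, fun x => ?_, fun e => ?_⟩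
    · rw [Walk.support_nil, List.mem_singleton]
      constructor
      · rintro rfl
        exact ⟨0, le_rfl, by simp, by simp⟩
      · rintro ⟨t, h1, h2, rfl⟩
        have : t = 0 := by omega
        simp [this]
    · simp only [Walk.edges_nil, List.not_mem_nil, false_iff]
      rintro ⟨t, h1, h2, -⟩
      omega
  | succ k ih =>
    obtain ⟨Q, h1, h2, h3, h4⟩ := ih (s + 1) (by omega) (b := b) (by rw [hb]; push_cast; ring_nf)
    refine ⟨Walk.cons (H.adj_succ s) Q, h1.cons ?_, by simp [h2], fun x => ?_, fun e => ?_⟩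
    · rw [h3]
      rintro ⟨t, h5, h6, h7⟩
      exact H.ne (by omega) (by omega) h7
    · rw [Walk.support_cons, List.mem_cons, h3]
      constructor
      · rintro (rfl | ⟨t, h5, h6, rfl⟩)
        · exact ⟨0, by simp, by omega, by simp⟩
        · exact ⟨t + 1, by omega, by push_cast; omega, by ring_nf⟩
      · rintro ⟨t, h5, h6, rfl⟩
        by_cases ht : t = 0
        · simp [ht]
        · exact Or.inr ⟨t - 1, by omega, by push_cast at h6; omega, by ring_nf⟩
    · rw [Walk.edges_cons, List.mem_cons, h4]
      constructor
      · rintro (rfl | ⟨t, h5, h6, rfl⟩)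
        · exact ⟨0, by simp, by push_cast; omega, by simp⟩
        · exact ⟨t + 1, by omega, by push_cast; omega, by ring_nf⟩
      · rintro ⟨t, h5, h6, rfl⟩
        by_cases ht : t = 0
        · simp [ht]
        · exact Or.inr ⟨t - 1, by omega, by push_cast at h6; omega, by ring_nf⟩

lemma isInducedPath_arc (H : HoleParam G l w c) {s : ℤ} {k : ℕ} (hk : k < 2 * l) {a b : V}
    {Q : G.Walk a b} (hQ : Q.IsPath)
    (hs : ∀ x, x ∈ Q.support ↔ ∃ t : ℤ, 0 ≤ t ∧ t ≤ k ∧ x = c (s + t))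
    (he : ∀ e, e ∈ Q.edges ↔ ∃ t : ℤ, 0 ≤ t ∧ t < k ∧ e = s(c (s + t), c (s + t + 1))) :
    IsInducedPath G Q := by
  refine ⟨hQ, fun x hx y hy hxy => ?_⟩
  obtain ⟨t, h5, h6, rfl⟩ := (hs x).1 hx
  obtain ⟨t', h5', h6', rfl⟩ := (hs y).1 hy
  rw [he]
  by_contra hcon
  have n1 : t' ≠ t + 1 := by
    rintro rfl
    exact hcon ⟨t, h5, by omega, by ring_nf⟩
  have n2 : t ≠ t' + 1 := by
    rintro rfl
    exact hcon ⟨t', h5', by omega, by rw [Sym2.eq_swap]; ring_nf⟩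
  rcases lt_trichotomy t t' with h | rfl | h
  · exact H.not_adj (by omega) (by omega) hxy
  · exact hxy.ne rfl
  · exact H.not_adj (by omega) (by omega) hxy.symm

/-- A path leaving the hole is at least as long as either arc between its ends allows. -/
lemma le_length (H : HoleParam G l w c) {s e : ℤ} (he : 0 < e) (he' : e < 2 * l + 1) {a b : V}
    (ha : a = c s) (hb : b = c (s + e)) {P : G.Walk a b} (hP : P.IsPath)
    (hout : ∃ y ∈ P.support, ∀ t, y ≠ c t) :
    (2 * l + 1 : ℤ) ≤ P.length + e ∧ e ≤ P.length := by
  obtain ⟨y, hy, hyc⟩ := hout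
  constructor
  · obtain ⟨Q, h1, h2, h3, -⟩ := H.exists_arc s e.toNat (by omega) (a := a) (b := b) ha
      (by rw [hb, Int.toNat_of_nonneg he.le])
    have hne : P ≠ Q := by
      rintro rfl
      obtain ⟨t, -, -, h⟩ := (h3 y).1 hy
      exact hyc _ h
    obtain ⟨x, -, -, q, hq, hq'⟩ := hP.exists_isCycle_length_le_add_of_ne h1 hne
    have := H.girth_le _ q hq
    omega
  · obtain ⟨Q, h1, h2, h3, -⟩ := H.exists_arc (s + e) (2 * l + 1 - e).toNat (by omega)
      (a := b) (b := a) hb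
      (by rw [ha, Int.toNat_of_nonneg (by omega), ← H.add_period]; ring_nf)
    have hne : P ≠ Q.reverse := by
      rintro rfl
      rw [Walk.support_reverse, List.mem_reverse] at hy
      obtain ⟨t, -, -, h⟩ := (h3 y).1 hy
      exact hyc _ h
    obtain ⟨x, -, -, q, hq, hq'⟩ := hP.exists_isCycle_length_le_add_of_ne h1.reverse hne
    have := H.girth_le _ q hq
    rw [Walk.length_reverse] at hq'
    omega

/-- A vertex outside the hole has at most one neighbour on it. -/
lemma eq_of_adj (H : HoleParam G l w c) {y : V} (hy : ∀ t, y ≠ c t) {s t : ℤ}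
    (hs : G.Adj y (c s)) (ht : G.Adj y (c t)) : c s = c t := by
  obtain ⟨e, h1, h2, h3⟩ := H.exists_eq_add s t
  by_contra hne
  have he : 0 < e := by
    rcases h1.lt_or_eq with h | rfl
    · exact h
    · simp [h3] at hne
  have hP : (Walk.cons hs.symm (Walk.cons ht Walk.nil)).IsPath := by
    simp [hne, hs.ne', ht.ne]
  have := H.le_length he h2 rfl h3 hP ⟨y, by simp, hy⟩
  have := H.four_le
  simp at *
  omega

lemma isShortJump (H : HoleParam G l w c) {a b : V} {P : G.Walk a b} (hP : IsInducedPath G P)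
    {s t : ℤ} (ha : a = c s) (hb : b = c t) (hne : a ≠ b) (hnadj : ¬ G.Adj a b)
    (hdisj : ∀ y ∈ wInterior P, ∀ r, y ≠ c r ∧ (G.Adj y (c r) → c r = a ∨ c r = b)) :
    IsShortJump G w P := by
  refine ⟨⟨H.hole, (H.mem_support _).2 ⟨_, ha⟩, (H.mem_support _).2 ⟨_, hb⟩, hne, hnadj, hP, ?_⟩, ?_⟩
  · intro y hy hyw
    obtain ⟨r, hr⟩ := (H.mem_support _).1 hyw
    exact (hdisj y hy r).1 hr
  · intro x hx hxa hxb y hy hxy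
    obtain ⟨r, rfl⟩ := (H.mem_support _).1 hx
    rcases (hdisj y hy r).2 hxy.symm with h | h
    · exact hxa h
    · exact hxb h

lemma arcsOf (H : HoleParam G l w c) {s : ℤ} {k k' : ℕ} (hk : 0 < k) (hk' : 0 < k')
    (hkk : k + k' = 2 * l + 1) {a b : V} (ha : a = c s)
    {Q : G.Walk a b} {R : G.Walk b a} (hQ : Q.IsPath) (hR : R.IsPath)
    (hQs : ∀ x, x ∈ Q.support ↔ ∃ t : ℤ, 0 ≤ t ∧ t ≤ k ∧ x = c (s + t))
    (hQe : ∀ e, e ∈ Q.edges ↔ ∃ t : ℤ, 0 ≤ t ∧ t < k ∧ e = s(c (s + t), c (s + t + 1)))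
    (hRs : ∀ x, x ∈ R.support ↔ ∃ t : ℤ, 0 ≤ t ∧ t ≤ k' ∧ x = c (s + k + t))
    (hRe : ∀ e, e ∈ R.edges ↔ ∃ t : ℤ, 0 ≤ t ∧ t < k' ∧ e = s(c (s + k + t), c (s + k + t + 1)))
    (hb : b = c (s + k)) :
    ArcsOf G w Q R.reverse := by
  refine ⟨(H.mem_support _).2 ⟨_, ha⟩, (H.mem_support _).2 ⟨_, hb⟩, ?_, hQ, hR.reverse, ?_, ?_⟩
  · rw [ha, hb]
    exact H.ne (by omega) (by omega)
  · ext x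
    simp only [Walk.support_reverse, List.mem_reverse, Set.mem_inter_iff, Set.mem_ofPred_eq,
      Set.mem_insert_iff, Set.mem_singleton_iff]
    constructor
    · rintro ⟨h1, h2⟩
      obtain ⟨t, h3, h4, rfl⟩ := (hQs x).1 h1
      obtain ⟨t', h5, h6, h7⟩ := (hRs _).1 h2
      rcases Int.eq_zero_or_eq_of_dvd_of_lt ((H.inj _ _).1 h7.symm) (by omega) (by omega) with h | h
      · right
        rw [hb]
        congr 1
        omega
      · left
        rw [ha]
        congr 1
        omega
    · rintro (rfl | rfl)
      · exact ⟨Walk.start_mem_support _, Walk.end_mem_support _⟩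
      · exact ⟨Walk.end_mem_support _, Walk.start_mem_support _⟩
  · ext e
    simp only [Walk.edges_reverse, List.mem_reverse, Set.mem_ofPred_eq, Set.mem_union]
    rw [H.mem_edges, hQe, hRe]
    constructor
    · rintro ⟨t, rfl⟩
      obtain ⟨r, h1, h2, h3⟩ := H.exists_eq_add s t
      have h4 : c (t + 1) = c (s + r + 1) := by
        rw [H.inj] at h3 ⊢
        ring_nf at h3 ⊢
        exact h3
      by_cases hr : r < k
      · exact Or.inl ⟨r, h1, hr, by rw [h3, h4]⟩
      · refine Or.inr ⟨r - k, by omega, by omega, ?_⟩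
        rw [h3, h4]
        ring_nf
    · rintro (⟨t, -, -, rfl⟩ | ⟨t, -, -, rfl⟩)
      · exact ⟨_, rfl⟩
      · exact ⟨_, rfl⟩

lemma exists_arcsOf (H : HoleParam G l w c) {s : ℤ} {k k' : ℕ} (hk : 2 ≤ k) (hk' : 2 ≤ k')
    (hkk : k + k' = 2 * l + 1) {a b : V} (ha : a = c s) (hb : b = c (s + k)) :
    ∃ Q R : G.Walk a b, ArcsOf G w Q R ∧ IsInducedPath G Q ∧ IsInducedPath G R ∧
      Q.length = k ∧ R.length = k' ∧
      (∀ x, x ∈ Q.support ↔ ∃ t : ℤ, 0 ≤ t ∧ t ≤ k ∧ x = c (s + t)) ∧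
      (∀ x, x ∈ R.support ↔ ∃ t : ℤ, k ≤ t ∧ t ≤ 2 * l + 1 ∧ x = c (s + t)) := by
  obtain ⟨Q, hQ, hQl, hQs, hQe⟩ := H.exists_arc s k (by omega) (a := a) (b := b) ha hb
  obtain ⟨R, hR, hRl, hRs, hRe⟩ := H.exists_arc (s + k) k' (by omega) (a := b) (b := a) hb
    (by rw [ha, ← H.add_period s]; congr 1; omega)
  refine ⟨Q, R.reverse, H.arcsOf (by omega) (by omega) hkk ha hQ hR hQs hQe hRs hRe hb,
    H.isInducedPath_arc (by omega) hQ hQs hQe,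
    (H.isInducedPath_arc (by omega) hR hRs hRe).reverse, hQl, by rw [Walk.length_reverse, hRl],
    hQs, fun x => ?_⟩
  rw [Walk.support_reverse, List.mem_reverse, hRs]
  constructor
  · rintro ⟨t, h1, h2, rfl⟩
    exact ⟨k + t, by omega, by omega, by ring_nf⟩
  · rintro ⟨t, h1, h2, rfl⟩
    exact ⟨t - k, by omega, by omega, by ring_nf⟩

/-- A short jump and an arc between its ends form a hole. -/
lemma isHole_jump_append {a b : V} {P Q : G.Walk a b}
    (hP : IsShortJump G w P) (hQ : IsInducedPath G Q) (hQw : ∀ x ∈ Q.support, x ∈ w.support) :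
    IsHole G (P.append Q.reverse) := by
  obtain ⟨⟨-, -, -, hne, hnadj, hind, hdisj⟩, hno⟩ := hP
  refine hind.isHole_append hQ.reverse hne hnadj ?_ ?_
  · intro x hx hxQ
    rw [Walk.support_reverse, List.mem_reverse] at hxQ
    rcases mem_support_cases hx with h | h | h
    · exact Or.inl h
    · exact Or.inr h
    · exact absurd (hQw x hxQ) (hdisj x h)
  · intro x hx y hy hxy
    rw [Walk.support_reverse, List.mem_reverse] at hy
    rcases mem_support_cases hx with h | h | h
    · exact Or.inl h
    · exact Or.inr (Or.inl h)
    · by_contra hcon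
      push Not at hcon
      exact hno y (hQw y hy) hcon.2.2.1 hcon.2.2.2 x h hxy.symm

/-- The shorter arc between the ends of a short jump lies in a jump hole. -/
lemma inJumpHoleOver (H : HoleParam G l w c) {s e : ℤ} (he : 0 < e) (he' : e < 2 * l + 1)
    {a b : V} (ha : a = c s) (hb : b = c (s + e)) {P : G.Walk a b} (hP : IsShortJump G w P) :
    (2 * e ≤ 2 * l + 1 ∧ ∀ t, 0 ≤ t → t ≤ e → InJumpHoleOver G w (c (s + t))) ∨
    (2 * l + 1 ≤ 2 * e ∧ ∀ t, e ≤ t → t ≤ 2 * l + 1 → InJumpHoleOver G w (c (s + t))) := by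
  obtain ⟨⟨hw, has, hbs, hne, hnadj, hind, hdisj⟩, hno⟩ := id hP
  obtain ⟨k, rfl⟩ := Int.eq_ofNat_of_zero_le he.le
  obtain ⟨k', hkk⟩ : ∃ k', k + k' = 2 * l + 1 := ⟨2 * l + 1 - k, by omega⟩
  have hk1 : k ≠ 1 := by
    rintro rfl
    rw [ha, hb] at hnadj
    exact hnadj (by simpa using H.adj_succ s)
  have hk1' : k' ≠ 1 := by
    rintro rfl
    apply hnadj
    rw [ha, hb, ← H.add_period s]
    have := (H.adj_succ (s + k)).symm
    convert this using 2
    omega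
  obtain ⟨Q, R, hQR, hQ, hR, hQl, hRl, hQs, hRs⟩ :=
    H.exists_arcsOf (s := s) (k := k) (k' := k') (a := a) (b := b)
      (by omega) (by omega) hkk ha hb
  have hholeQ := isHole_jump_append hP hQ fun x hx => by
    obtain ⟨t, -, -, h⟩ := (hQs x).1 hx
    exact (H.mem_support x).2 ⟨_, h⟩
  have hholeR := isHole_jump_append hP hR fun x hx => by
    obtain ⟨t, -, -, h⟩ := (hRs x).1 hx
    exact (H.mem_support x).2 ⟨_, h⟩
  have hRQ : ArcsOf G w R Q := by
    obtain ⟨h1, h2, h3, h4, h5, h6, h7⟩ := hQR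
    exact ⟨h1, h2, h3, h5, h4, by rw [Set.inter_comm, h6], by rw [Set.union_comm, h7]⟩
  obtain ⟨y, hy⟩ := exists_mem_wInterior hind.1 hne hnadj
  have hlen := H.le_length he he' ha hb hind.1
    ⟨y, hy.1, fun t h => hdisj y hy ((H.mem_support y).2 ⟨t, h⟩)⟩
  have hlQ : (P.append Q.reverse).length = P.length + k := by simp [hQl]
  have hlR : (P.append R.reverse).length = P.length + k' := by simp [hRl]
  rcases Nat.even_or_odd (P.length + k) with hpar | hpar
  · have hpar' : Odd (P.length + k') := by
      rw [Nat.even_iff] at hpar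
      rw [Nat.odd_iff]
      omega
    rw [← hlR] at hpar'
    have := H.odd_length _ _ hholeR hpar'
    exact Or.inr ⟨by omega, fun t h1 h2 => ⟨a, b, P, R, Q, ⟨hP, hRQ, hholeR, hpar'⟩,
      Or.inr ((hRs _).2 ⟨t, h1, by omega, rfl⟩)⟩⟩
  · rw [← hlQ] at hpar
    have := H.odd_length _ _ hholeQ hpar
    exact Or.inl ⟨by omega, fun t h1 h2 => ⟨a, b, P, Q, R, ⟨hP, hQR, hholeQ, hpar⟩,
      Or.inr ((hQs _).2 ⟨t, h1, by omega, rfl⟩)⟩⟩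

/-- The start of a short jump lies in a jump hole. -/
lemma inJumpHoleOver_start (H : HoleParam G l w c) {s t : ℤ} (h1 : s < t)
    (h2 : t < s + (2 * l + 1)) {P : G.Walk (c s) (c t)} (hP : IsShortJump G w P) :
    InJumpHoleOver G w (c s) := by
  rcases H.inJumpHoleOver (s := s) (e := t - s) (by omega) (by omega) rfl (by simp) hP with
    ⟨-, h⟩ | ⟨-, h⟩
  · simpa using h 0 le_rfl (by omega)
  · have := h (2 * l + 1) (by omega) (by omega)
    rwa [H.add_period] at this

end HoleParam

namespace HoleParam

variable {G : SimpleGraph V} {l : ℕ} {v : V} {w : G.Walk v v} {c : ℤ → V}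

/-- Two sets of hole vertices joined by a walk outside the hole that touches no further vertex of
the hole are joined by a short jump. -/
lemma exists_isShortJump (H : HoleParam G l w c) {A B : Set V} (hA : ∀ a ∈ A, ∃ t, a = c t)
    (hB : ∀ b ∈ B, ∃ t, b = c t) (hAB : ∀ a ∈ A, ∀ b ∈ B, a ≠ b ∧ ¬ G.Adj a b) {y z : V}
    (R : G.Walk y z) (hy : ∃ a ∈ A, G.Adj y a) (hz : ∃ b ∈ B, G.Adj z b)
    (hR : ∀ x ∈ R.support, ∀ t, x ≠ c t ∧ (G.Adj x (c t) → c t ∈ A ∨ c t ∈ B)) :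
    ∃ a ∈ A, ∃ b ∈ B, ∃ P : G.Walk a b, IsShortJump G w P := by
  obtain ⟨y', z', Q, ⟨a, haA, hya⟩, ⟨b, hbB, hzb⟩, hQ, hQR, hQA, hQB⟩ :=
    exists_inducedPath_between (A := {x | ∃ a ∈ A, G.Adj x a}) (B := {x | ∃ b ∈ B, G.Adj x b})
      R hy hz
  obtain ⟨s, hs⟩ := hA a haA
  obtain ⟨t, ht⟩ := hB b hbB
  have hQ' : IsInducedPath G (Q.append hzb.toWalk) := by
    refine hQ.append (IsInducedPath.of_adj hzb) ?_ ?_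
    · intro x hx hx'
      rcases (by simpa using hx' : x = z' ∨ x = b) with h | h
      · exact h
      · exact absurd (h.trans ht) (hR x (hQR x hx) t).1
    · intro x hx x' hx' hxx
      rcases (by simpa using hx' : x' = z' ∨ x' = b) with h | rfl
      · exact Or.inr h
      · exact Or.inl (hQB x hx ⟨x', hbB, hxx⟩)
  have hP : IsInducedPath G (Walk.cons hya.symm (Q.append hzb.toWalk)) := by
    refine hQ'.cons _ ?_
    intro x hx hax
    have hx' : x ∈ Q.support ∨ x = b := by
      rw [Walk.mem_support_append_iff] at hx
      rcases hx with hx | hx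
      · exact Or.inl hx
      · rcases (by simpa using hx : x = z' ∨ x = b) with rfl | h
        · exact Or.inl (Walk.end_mem_support _)
        · exact Or.inr h
    rcases hx' with hx' | rfl
    · rcases hax with rfl | hax
      · exact absurd hs (hR a (hQR a hx') s).1
      · exact hQA x hx' ⟨a, haA, hax.symm⟩
    · rcases hax with h | h
      · exact absurd h (hAB a haA x hbB).1
      · exact absurd h (hAB a haA x hbB).2
  refine ⟨a, haA, b, hbB, _, H.isShortJump hP hs ht (hAB a haA b hbB).1 (hAB a haA b hbB).2 ?_⟩
  rintro x ⟨hx, hxa, hxb⟩ r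
  have hxQ : x ∈ Q.support := by
    rw [Walk.support_cons, List.mem_cons, Walk.mem_support_append_iff] at hx
    rcases hx with hx | hx | hx
    · exact absurd hx hxa
    · exact hx
    · rcases (by simpa using hx : x = z' ∨ x = b) with rfl | h
      · exact Walk.end_mem_support _
      · exact absurd h hxb
  refine ⟨(hR x (hQR x hxQ) r).1, fun hxr => ?_⟩
  have hout : ∀ t, x ≠ c t := fun t => (hR x (hQR x hxQ) t).1
  rcases (hR x (hQR x hxQ) r).2 hxr with h | h
  · left
    have := hQA x hxQ ⟨_, h, hxr⟩
    subst this
    rw [hs] at hya ⊢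
    exact H.eq_of_adj hout hxr hya
  · right
    have := hQB x hxQ ⟨_, h, hxr⟩
    subst this
    rw [ht] at hzb ⊢
    exact H.eq_of_adj hout hxr hzb

/-- Two touching jumps contain a short jump from a side of the first to a side of the second. -/
lemma exists_isShortJump_of_touch (H : HoleParam G l w c) {A B : Set V}
    (hA : ∀ a ∈ A, ∃ t, a = c t) (hB : ∀ b ∈ B, ∃ t, b = c t)
    (hAB : ∀ a ∈ A, ∀ b ∈ B, a ≠ b ∧ ¬ G.Adj a b) {u1 v1 u2 v2 p q : V}
    {P1 : G.Walk u1 v1} {P2 : G.Walk u2 v2} (h1 : IsInducedPath G P1) (h2 : IsInducedPath G P2)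
    (hp : p ∈ wInterior P1) (hq : q ∈ wInterior P2) (hpq : p = q ∨ G.Adj p q)
    (hu1 : u1 ∈ A) (hu2 : u2 ∈ B) (hpv : ¬ G.Adj p v1) (hqv : ¬ G.Adj q v2)
    (lab1 : ∀ y ∈ wInterior P1, ∀ t, y ≠ c t ∧ (G.Adj y (c t) → c t ∈ A ∨ c t = v1))
    (lab2 : ∀ y ∈ wInterior P2, ∀ t, y ≠ c t ∧ (G.Adj y (c t) → c t ∈ B ∨ c t = v2)) :
    ∃ a ∈ A, ∃ b ∈ B, ∃ P : G.Walk a b, IsShortJump G w P := by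
  obtain ⟨y, R1, hy, hR1⟩ := exists_walk_to_interior h1 hp
  obtain ⟨z, R2, hz, hR2⟩ := exists_walk_to_interior h2 hq
  obtain ⟨R, hR⟩ : ∃ R : G.Walk y z, ∀ x ∈ R.support, x ∈ R1.support ∨ x ∈ R2.support := by
    rcases hpq with rfl | hpq
    · refine ⟨R1.append R2.reverse, fun x hx => ?_⟩
      rwa [Walk.mem_support_append_iff, Walk.support_reverse, List.mem_reverse] at hx
    · refine ⟨R1.append (Walk.cons hpq R2.reverse), fun x hx => ?_⟩
      rw [Walk.mem_support_append_iff, Walk.support_cons, List.mem_cons, Walk.support_reverse,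
        List.mem_reverse] at hx
      rcases hx with hx | rfl | hx
      · exact Or.inl hx
      · exact Or.inl (Walk.end_mem_support _)
      · exact Or.inr hx
  refine H.exists_isShortJump hA hB hAB R ⟨u1, hu1, hy.symm⟩ ⟨u2, hu2, hz.symm⟩ fun x hx t => ?_
  rcases hR x hx with hx | hx
  · obtain ⟨hx1, hx2⟩ := hR1 x hx
    refine ⟨(lab1 x hx1 t).1, fun hxt => ?_⟩
    rcases (lab1 x hx1 t).2 hxt with h | h
    · exact Or.inl h
    · rw [h] at hxt
      rw [hx2 hxt] at hxt
      exact absurd hxt hpv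
  · obtain ⟨hx1, hx2⟩ := hR2 x hx
    refine ⟨(lab2 x hx1 t).1, fun hxt => ?_⟩
    rcases (lab2 x hx1 t).2 hxt with h | h
    · exact Or.inr h
    · rw [h] at hxt
      rw [hx2 hxt] at hxt
      exact absurd hxt hqv

/-- Hole vertices with equal or adjacent neighbours outside the hole are close to antipodal. -/
lemma le_three (H : HoleParam G l w c) {p q : V} (hp : ∀ t, p ≠ c t) (hq : ∀ t, q ≠ c t)
    (hpq : p = q ∨ G.Adj p q) {s e : ℤ} (he : 0 < e) (he' : e < 2 * l + 1)
    (hs : G.Adj p (c s)) (ht : G.Adj q (c (s + e))) :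
    (2 * l + 1 : ℤ) ≤ 3 + e ∧ e ≤ 3 := by
  have hne := H.ne (x := s) (y := s + e) (by omega) (by omega)
  rcases hpq with rfl | hpq
  · exact absurd (H.eq_of_adj hp hs ht) hne
  · have hP : (Walk.cons hs.symm (Walk.cons hpq (Walk.cons ht Walk.nil))).IsPath := by
      simp [hne, hs.ne', hpq.ne, ht.ne, (hq s).symm, hp]
    have := H.le_length he he' rfl rfl hP ⟨p, by simp, hp⟩
    simpa using this

/-- Prolonging an induced path by an arc of the hole leaving its start. -/
lemma exists_append_arc (H : HoleParam G l w c) {k : ℕ} (hk : k < 2 * l) {u z b : V}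
    {P : G.Walk u z} (hP : IsInducedPath G P) (hu : u = c 0) (hb : b = c k)
    (hsep : ∀ a ∈ P.support, a ≠ u → ∀ t : ℤ, 0 ≤ t → t ≤ k →
      a ≠ c t ∧ (G.Adj a (c t) → t = 0)) :
    ∃ X : G.Walk z b, IsInducedPath G X ∧ X.length = P.length + k ∧
      ∀ a ∈ X.support, a ∈ P.support ∨ ∃ t : ℤ, 0 ≤ t ∧ t ≤ k ∧ a = c t := by
  obtain ⟨U, hU, hUl, hUs, hUe⟩ := H.exists_arc 0 k (by omega) (a := u) (b := b) hu
    (by rw [hb]; simp)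
  simp only [zero_add] at hUs
  have hUi := H.isInducedPath_arc (s := 0) (by omega) hU (by simpa using hUs) hUe
  refine ⟨P.reverse.append U, hP.reverse.append hUi ?_ ?_, by simp [hUl], ?_⟩
  · intro a ha haU
    rw [Walk.support_reverse, List.mem_reverse] at ha
    obtain ⟨t, h3, h4, h5⟩ := (hUs a).1 haU
    by_contra hau
    exact (hsep a ha hau t h3 h4).1 h5
  · intro a ha b hb hab
    rw [Walk.support_reverse, List.mem_reverse] at ha
    obtain ⟨t, h3, h4, rfl⟩ := (hUs b).1 hb
    by_cases hau : a = u
    · exact Or.inl hau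
    · right
      rw [(hsep a ha hau t h3 h4).2 hab, hu]
  · intro a ha
    rw [Walk.mem_support_append_iff, Walk.support_reverse, List.mem_reverse, hUs] at ha
    exact ha

end HoleParam

/-- `P` is an induced path joining `c 0` to `c (-h)` outside the hole parametrized by `c`, all of
whose contacts with the hole lie on the arc `c (-h), …, c 0`, and which closes to an odd cycle
with this arc. -/
structure IsHalf (G : SimpleGraph V) (c : ℤ → V) (h : ℤ) {u v : V} (P : G.Walk u v) : Prop where
  start_eq : u = c 0
  end_eq : v = c (-h)
  two_le : 2 ≤ h
  induced : IsInducedPath G P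
  outside : ∀ y ∈ wInterior P, ∀ t, y ≠ c t
  contact : ∀ y ∈ wInterior P, ∀ t, G.Adj y (c t) → ∃ s, -h ≤ s ∧ s ≤ 0 ∧ c t = c s
  odd : Odd ((P.length : ℤ) + h)

namespace IsHalf

variable {G : SimpleGraph V} {l : ℕ} {v0 : V} {w : G.Walk v0 v0} {c : ℤ → V} {h i d : ℤ}
  {u v : V} {P : G.Walk u v}

lemma reverse (hP : IsHalf G c h P) : IsHalf G (fun t => c (-h - t)) h P.reverse where
  start_eq := by simpa using hP.end_eq
  end_eq := by simpa using hP.start_eq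
  two_le := hP.two_le
  induced := hP.induced.reverse
  outside y hy t := hP.outside y (mem_wInterior_reverse.1 hy) _
  contact y hy t ht := by
    obtain ⟨s, h1, h2, h3⟩ := hP.contact y (mem_wInterior_reverse.1 hy) _ ht
    exact ⟨-h - s, by omega, by omega, by rw [h3]; ring_nf⟩
  odd := by simpa using hP.odd

lemma le_length (hP : IsHalf G c h P) (H : HoleParam G l w c) (hh : h < 2 * l) :
    (2 * l + 1 : ℤ) ≤ P.length + h := by
  have h2 := hP.two_le
  have hs := hP.start_eq
  have he := hP.end_eq
  obtain ⟨y, hy⟩ := exists_mem_wInterior hP.induced.1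
    (by rw [hs, he]; exact (H.ne (by omega) (by omega)).symm)
    (by rw [hs, he]; exact fun hadj => H.not_adj (x := -h) (y := 0) (by omega) (by omega) hadj.symm)
  have := H.le_length (s := -h) (e := h) (by omega) (by omega) he (by rw [hs]; simp)
    hP.induced.1.reverse ⟨y, by simpa using hy.1, hP.outside y hy⟩
  simpa using this.1

/-- Prolonging a half by an arc of the hole leaving its start. -/
lemma exists_append_arc (hP : IsHalf G c h P) (H : HoleParam G l w c) {k : ℕ}
    (hk : k + h + 1 < 2 * l) {b : V} (hb : b = c k) :
    ∃ X : G.Walk v b, IsInducedPath G X ∧ X.length = P.length + k ∧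
      ∀ a ∈ X.support, a ∈ wInterior P ∨ ∃ t : ℤ, (t = -h ∨ 0 ≤ t ∧ t ≤ k) ∧ a = c t := by
  have h2 := hP.two_le
  obtain ⟨X, hX, hXl, hXs⟩ := H.exists_append_arc (k := k) (by omega) hP.induced hP.start_eq hb <| by
    intro a ha hau t h3 h4
    rcases mem_support_cases ha with e | e | e
    · exact absurd e hau
    · rw [e, hP.end_eq]
      exact ⟨H.ne (by omega) (by omega), fun hadj =>
        absurd hadj (H.not_adj (by omega) (by omega))⟩
    · refine ⟨hP.outside a e t, fun hadj => ?_⟩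
      obtain ⟨s, h6, h7, h8⟩ := hP.contact a e _ hadj
      have := Int.eq_zero_of_dvd_of_lt ((H.inj _ _).1 h8) (by omega) (by omega)
      omega
  refine ⟨X, hX, hXl, fun a ha => ?_⟩
  rcases hXs a ha with ha | ⟨t, h3, h4, rfl⟩
  · rcases mem_support_cases ha with e | e | e
    · exact Or.inr ⟨0, Or.inr (by omega), e.trans hP.start_eq⟩
    · exact Or.inr ⟨-h, Or.inl rfl, e.trans hP.end_eq⟩
    · exact Or.inl e
  · exact Or.inr ⟨t, Or.inr ⟨h3, h4⟩, rfl⟩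

end IsHalf

/-- Two halves over disjoint arcs of the same hole. -/
structure IsPair (G : SimpleGraph V) (l : ℕ) {v : V} (w : G.Walk v v) (c : ℤ → V) (h i d : ℤ)
    {u1 v1 u2 v2 : V} (P1 : G.Walk u1 v1) (P2 : G.Walk u2 v2) : Prop where
  param : HoleParam G l w c
  left : IsHalf G c h P1
  right : IsHalf G (fun t => c (i - t)) d P2
  one_le : 1 ≤ i
  lt : i + d + h < 2 * l + 1

namespace IsPair

variable {G : SimpleGraph V} {l : ℕ} {v : V} {w : G.Walk v v} {c : ℤ → V} {h i d : ℤ}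
  {u1 v1 u2 v2 : V} {P1 : G.Walk u1 v1} {P2 : G.Walk u2 v2}

lemma swap (K : IsPair G l w c h i d P1 P2) :
    IsPair G l w (fun t => c (i - t)) d i h P2 P1 where
  param := K.param.reflect i
  left := K.right
  right := by simpa using K.left
  one_le := K.one_le
  lt := by have := K.lt; omega

lemma reflect (K : IsPair G l w c h i d P1 P2) :
    IsPair G l w (fun t => c (-h - t)) h (2 * l + 1 - h - i - d) d P1.reverse P2.reverse where
  param := K.param.reflect (-h)
  left := K.left.reverse
  right := by
    have := K.right.reverse
    have e : (fun t => c (-h - (2 * l + 1 - h - i - d - t))) =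
        fun t => (fun t => c (i - t)) (-d - t) := by
      funext t
      change _ = c _
      rw [← K.param.add_period]
      ring_nf
    rwa [e]
  one_le := by have := K.lt; omega
  lt := by have := K.one_le; omega

lemma start_right (K : IsPair G l w c h i d P1 P2) : u2 = c i := by
  simpa using K.right.start_eq

lemma end_right (K : IsPair G l w c h i d P1 P2) : v2 = c (i + d) := by
  simpa using K.right.end_eq

lemma contact_right (K : IsPair G l w c h i d P1 P2) {y : V} (hy : y ∈ wInterior P2) {t : ℤ}
    (ht : G.Adj y (c t)) : ∃ s, i ≤ s ∧ s ≤ i + d ∧ c t = c s := by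
  obtain ⟨s, h1, h2, h3⟩ := K.right.contact y hy (i - t) (by simpa using ht)
  exact ⟨i - s, by omega, by omega, by simpa using h3⟩

lemma outside_right (K : IsPair G l w c h i d P1 P2) {y : V} (hy : y ∈ wInterior P2) (t : ℤ) :
    y ≠ c t := by
  simpa using K.right.outside y hy (i - t)

/-- The two halves touch. -/
lemma exists_touch (K : IsPair G l w c h i d P1 P2) :
    ∃ p ∈ wInterior P1, ∃ q ∈ wInterior P2, p = q ∨ G.Adj p q := by
  by_contra hcon
  push Not at hcon
  have H := K.param
  have hh := K.left.two_le
  have hd := K.right.two_le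
  have hi := K.one_le
  have hlt := K.lt
  obtain ⟨X, hX, hXl, hXs⟩ := K.left.exists_append_arc H (k := i.toNat) (b := u2) (by omega)
    (by rw [K.start_right, Int.toNat_of_nonneg (by omega)])
  obtain ⟨Y, hY, hYl, hYs⟩ := K.right.reverse.exists_append_arc ((H.reflect i).reflect (-d))
    (k := (2 * l + 1 - h - i - d).toNat) (b := v1) (by omega)
    (by
      rw [K.left.end_eq, Int.toNat_of_nonneg (by omega), ← H.add_period]
      ring_nf)
  have hXs' : ∀ a ∈ X.support, a ∈ wInterior P1 ∨
      ∃ t : ℤ, (t = -h ∨ 0 ≤ t ∧ t ≤ i) ∧ a = c t := fun a ha => by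
    rcases hXs a ha with h | ⟨t, h, rfl⟩
    · exact Or.inl h
    · exact Or.inr ⟨t, by omega, rfl⟩
  have hYs' : ∀ a ∈ Y.support, a ∈ wInterior P2 ∨
      ∃ t : ℤ, (t = i ∨ i + d ≤ t ∧ t ≤ 2 * l + 1 - h) ∧ a = c t := fun a ha => by
    rcases hYs a ha with h | ⟨t, h, rfl⟩
    · exact Or.inl (mem_wInterior_reverse.1 h)
    · exact Or.inr ⟨i + d + t, by omega, by ring_nf⟩
  have hhole : IsHole G (X.append Y) := by
    refine hX.isHole_append hY ?_ ?_ ?_ ?_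
    · rw [K.left.end_eq, K.start_right]
      exact H.ne (by omega) (by omega)
    · rw [K.left.end_eq, K.start_right]
      exact H.not_adj (by omega) (by omega)
    · intro a ha ha'
      rcases hXs' a ha with h1 | ⟨t, h1, rfl⟩ <;> rcases hYs' _ ha' with h2 | ⟨t', h2, h3⟩
      · exact absurd rfl (hcon a h1 a h2).1
      · exact absurd h3 (K.left.outside a h1 _)
      · exact absurd rfl (K.outside_right h2 t)
      · rw [K.left.end_eq, K.start_right]
        rcases Int.eq_zero_or_eq_of_dvd_of_lt ((H.inj _ _).1 h3.symm) (by omega) (by omega)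
          with h | h
        · right
          congr 1
          omega
        · left
          congr 1
          omega
    · intro a ha b hb hab
      rw [K.left.end_eq, K.start_right]
      rcases hXs' a ha with h1 | ⟨t, h1, rfl⟩ <;> rcases hYs' _ hb with h2 | ⟨t', h2, rfl⟩
      · exact absurd hab (hcon a h1 b h2).2
      · obtain ⟨s, h4, h5, h6⟩ := K.left.contact a h1 _ hab
        have := Int.eq_zero_or_eq_of_dvd_of_lt ((H.inj _ _).1 h6) (by omega) (by omega)
        right; right; left
        rw [h6]
        congr 1
        omega
      · obtain ⟨s, h4, h5, h6⟩ := K.contact_right h2 hab.symm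
        have := Int.eq_zero_or_eq_of_dvd_of_lt ((H.inj _ _).1 h6.symm) (by omega) (by omega)
        right; left
        congr 1
        omega
      · have : t' = t + 1 ∧ t' = i ∨ t = -h ∧ t' = 2 * l - h := by
          rcases (H.adj _ _).1 hab.symm with h | h
          · have := Int.eq_zero_or_eq_of_dvd_of_lt h (by omega) (by omega)
            omega
          · have := Int.eq_zero_or_eq_of_dvd_of_lt h (by omega) (by omega)
            omega
        rcases this with ⟨-, rfl⟩ | ⟨rfl, -⟩
        · simp
        · simp
  have ho1 := K.left.odd
  have ho2 := K.right.odd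
  have hlen : (X.append Y).length = 2 * l + 1 := by
    refine H.odd_length _ _ hhole ?_
    rw [Walk.length_append, hXl, hYl, Walk.length_reverse]
    rw [Int.odd_iff] at ho1 ho2
    rw [Nat.odd_iff]
    omega
  rw [Walk.length_append, hXl, hYl, Walk.length_reverse] at hlen
  have := K.left.le_length H (by omega)
  have := K.right.le_length (H.reflect i) (by omega)
  omega

end IsPair

/-- An induced path with its last edge removed. -/
lemma IsInducedPath.exists_init {G : SimpleGraph V} {x y q : V} {P : G.Walk x y}
    (hP : IsInducedPath G P) (hq : q ∈ P.support) (hqy : G.Adj q y) :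
    ∃ R : G.Walk x q, IsInducedPath G R ∧ R.length + 1 = P.length ∧
      (∀ a ∈ R.support, a ∈ P.support ∧ a ≠ y) ∧ ∀ a ∈ P.support, G.Adj a y → a = q := by
  have hP' := hP.reverse
  have hsup : ∀ a, a ∈ P.support ↔ a ∈ P.reverse.support := fun a => by simp
  rw [hsup] at hq
  rw [← Walk.length_reverse P]
  simp only [hsup]
  generalize P.reverse = Q at hP' hq
  cases Q with
  | nil => simp at hq; exact absurd hq hqy.ne
  | @cons _ z _ h R =>
    have hy := ((Walk.cons_isPath_iff _ _).1 hP'.1).2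
    have hnbr : ∀ a ∈ (Walk.cons h R).support, G.Adj a y → a = z := fun a ha hay => by
      have := hP'.2 a ha y (by simp) hay
      rw [Walk.edges_cons, List.mem_cons] at this
      rcases this with h | h
      · rcases Sym2.eq_iff.1 h with ⟨-, h⟩ | ⟨h, -⟩
        · exact absurd h (by rintro rfl; exact hy (Walk.start_mem_support _))
        · exact h
      · exact absurd (Walk.snd_mem_support_of_mem_edges _ h) hy
    have hqz := hnbr q hq hqy
    subst hqz
    refine ⟨R.reverse, ?_, by simp, ?_, hnbr⟩
    · refine IsInducedPath.reverse ⟨((Walk.cons_isPath_iff _ _).1 hP'.1).1, fun a ha b hb hab => ?_⟩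
      have := hP'.2 a (by simp [ha]) b (by simp [hb]) hab
      rw [Walk.edges_cons, List.mem_cons] at this
      rcases this with h | h
      · rcases Sym2.eq_iff.1 h with ⟨rfl, -⟩ | ⟨-, rfl⟩
        · exact absurd ha hy
        · exact absurd hb hy
      · exact h
    · intro a ha
      rw [Walk.support_reverse, List.mem_reverse] at ha
      exact ⟨by simp [ha], fun e => hy (e ▸ ha)⟩

namespace IsPair

variable {G : SimpleGraph V} {l : ℕ} {v : V} {w : G.Walk v v} {c : ℤ → V} {h i d : ℤ}
  {u1 v1 u2 v2 : V} {P1 : G.Walk u1 v1} {P2 : G.Walk u2 v2}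

lemma exists_isShortJump_of_sides (K : IsPair G l w c h i d P1 P2) {A B : Set ℤ}
    (hAB : ∀ s ∈ A, ∀ t ∈ B, s + 1 < t ∧ t < s + 2 * l) {a1 b1 a2 b2 : ℤ}
    {x1 y1 x2 y2 : V} (ha1 : a1 ∈ A) (ha2 : a2 ∈ B) (hx1 : x1 = c a1) (hy1 : y1 = c b1)
    (hx2 : x2 = c a2) (hy2 : y2 = c b2) {Q1 : G.Walk x1 y1} {Q2 : G.Walk x2 y2}
    (h1 : IsInducedPath G Q1) (h2 : IsInducedPath G Q2)
    (hQ1 : ∀ x, x ∈ wInterior Q1 ↔ x ∈ wInterior P1)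
    (hQ2 : ∀ x, x ∈ wInterior Q2 ↔ x ∈ wInterior P2)
    (hA : ∀ s, -h ≤ s → s ≤ 0 → s ∈ A ∨ s = b1) (hB : ∀ t, i ≤ t → t ≤ i + d → t ∈ B ∨ t = b2)
    {p q : V} (hp : p ∈ wInterior P1) (hq : q ∈ wInterior P2) (hpq : p = q ∨ G.Adj p q)
    (hpy : ¬ G.Adj p y1) (hqy : ¬ G.Adj q y2) :
    ∃ s ∈ A, ∃ t ∈ B, ∃ P : G.Walk (c s) (c t), IsShortJump G w P := by
  have H := K.param
  have key := H.exists_isShortJump_of_touch (A := c '' A) (B := c '' B) (p := p) (q := q)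
    (P1 := Q1) (P2 := Q2) ?_ ?_ ?_ h1 h2 ((hQ1 p).2 hp) ((hQ2 q).2 hq) hpq
    ⟨a1, ha1, hx1.symm⟩ ⟨a2, ha2, hx2.symm⟩ hpy hqy ?_ ?_
  · obtain ⟨_, ⟨s, hs, rfl⟩, _, ⟨t, ht, rfl⟩, P, hP⟩ := key
    exact ⟨s, hs, t, ht, P, hP⟩
  · rintro _ ⟨s, -, rfl⟩
    exact ⟨s, rfl⟩
  · rintro _ ⟨s, -, rfl⟩
    exact ⟨s, rfl⟩
  · rintro _ ⟨s, hs, rfl⟩ _ ⟨t, ht, rfl⟩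
    obtain ⟨h3, h4⟩ := hAB s hs t ht
    exact ⟨H.ne (by omega) (by omega), H.not_adj h3 h4⟩
  · intro y hy t
    rw [hQ1] at hy
    refine ⟨K.left.outside y hy t, fun hyt => ?_⟩
    obtain ⟨s, h3, h4, h5⟩ := K.left.contact y hy t hyt
    rcases hA s h3 h4 with h | rfl
    · exact Or.inl ⟨s, h, h5.symm⟩
    · exact Or.inr (h5.trans hy1.symm)
  · intro y hy t
    rw [hQ2] at hy
    refine ⟨K.outside_right hy t, fun hyt => ?_⟩
    obtain ⟨s, h3, h4, h5⟩ := K.contact_right hy hyt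
    rcases hB s h3 h4 with h | rfl
    · exact Or.inl ⟨s, h, h5.symm⟩
    · exact Or.inr (h5.trans hy2.symm)

lemma exists_isShortJump_low (K : IsPair G l w c h i d P1 P2) (hi : 2 ≤ i)
    {p q : V} (hp : p ∈ wInterior P1) (hq : q ∈ wInterior P2) (hpq : p = q ∨ G.Adj p q)
    (hpv : ¬ G.Adj p v1) (hqv : ¬ G.Adj q v2) :
    ∃ s t, -h < s ∧ s ≤ 0 ∧ i ≤ t ∧ t < i + d ∧
      ∃ P : G.Walk (c s) (c t), IsShortJump G w P := by
  have hh := K.left.two_le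
  have hd := K.right.two_le
  have hlt := K.lt
  obtain ⟨s, ⟨h1, h2⟩, t, ⟨h3, h4⟩, h5⟩ := K.exists_isShortJump_of_sides (A := Set.Ioc (-h) 0)
    (B := Set.Ico i (i + d)) (fun s hs t ht => by
      simp only [Set.mem_Ioc, Set.mem_Ico] at hs ht
      omega)
    (by simp; omega) (by simp; omega) K.left.start_eq K.left.end_eq K.start_right K.end_right
    K.left.induced K.right.induced (fun _ => Iff.rfl) (fun _ => Iff.rfl)
    (fun s h1 h2 => by simp only [Set.mem_Ioc]; omega)
    (fun s h1 h2 => by simp only [Set.mem_Ico]; omega) hp hq hpq hpv hqv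
  exact ⟨s, t, h1, h2, h3, h4, h5⟩

lemma exists_isShortJump (K : IsPair G l w c h i d P1 P2) :
    ∃ s t, -h ≤ s ∧ s ≤ 0 ∧ i ≤ t ∧ t ≤ i + d ∧ t - s < i + d + h ∧
      ∃ P : G.Walk (c s) (c t), IsShortJump G w P := by
  have hh := K.left.two_le
  have hd := K.right.two_le
  have hlt := K.lt
  have hi := K.one_le
  have H := K.param
  obtain ⟨p, hp, q, hq, hpq⟩ := K.exists_touch
  have hpout := K.left.outside p hp
  have hqout := fun t => K.outside_right hq t
  have hpx : G.Adj p u1 → ¬ G.Adj p v1 := by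
    rw [K.left.start_eq, K.left.end_eq]
    exact fun h1 h2 => H.ne (by omega) (by omega) (H.eq_of_adj hpout h2 h1)
  have hqx : G.Adj q u2 → ¬ G.Adj q v2 := by
    rw [K.start_right, K.end_right]
    exact fun h1 h2 => H.ne (by omega) (by omega) (H.eq_of_adj hqout h1 h2)
  by_cases h1 : ¬ G.Adj p u1 ∧ ¬ G.Adj q v2
  · obtain ⟨s, ⟨h5, h6⟩, t, ⟨h7, h8⟩, h9⟩ := K.exists_isShortJump_of_sides (A := Set.Ico (-h) 0)
      (B := Set.Ico i (i + d))
      (fun s hs t ht => by simp only [Set.mem_Ico] at hs ht; omega)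
      (by simp; omega) (by simp; omega) K.left.end_eq K.left.start_eq K.start_right K.end_right
      K.left.induced.reverse K.right.induced (fun _ => mem_wInterior_reverse) (fun _ => Iff.rfl)
      (fun s h1 h2 => by simp only [Set.mem_Ico]; omega)
      (fun s h1 h2 => by simp only [Set.mem_Ico]; omega) hp hq hpq h1.1 h1.2
    exact ⟨s, t, h5, by omega, h7, by omega, by omega, h9⟩
  by_cases h2 : ¬ G.Adj p v1 ∧ ¬ G.Adj q u2
  · obtain ⟨s, ⟨h5, h6⟩, t, ⟨h7, h8⟩, h9⟩ := K.exists_isShortJump_of_sides (A := Set.Ioc (-h) 0)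
      (B := Set.Ioc i (i + d))
      (fun s hs t ht => by simp only [Set.mem_Ioc] at hs ht; omega)
      (by simp; omega) (by simp; omega) K.left.start_eq K.left.end_eq K.end_right K.start_right
      K.left.induced K.right.induced.reverse (fun _ => Iff.rfl) (fun _ => mem_wInterior_reverse)
      (fun s h1 h2 => by simp only [Set.mem_Ioc]; omega)
      (fun s h1 h2 => by simp only [Set.mem_Ioc]; omega) hp hq hpq h2.1 h2.2
    exact ⟨s, t, by omega, h6, by omega, h8, by omega, h9⟩
  exfalso
  have h3 : G.Adj p u1 ∧ G.Adj q u2 ∨ G.Adj p v1 ∧ G.Adj q v2 := by tauto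
  rcases h3 with ⟨h3, h4⟩ | ⟨h3, h4⟩
  · rw [K.left.start_eq] at h3
    have := H.le_three hpout hqout hpq (s := 0) (e := i) (by omega) (by omega) h3
      (by rwa [zero_add, ← K.start_right])
    omega
  · rw [K.end_right] at h4
    have := H.le_three hqout hpout (hpq.imp Eq.symm fun h => h.symm) (s := i + d)
      (e := 2 * l + 1 - h - i - d) (by omega) (by omega) h4 (by
        rw [K.left.end_eq, ← H.add_period] at h3
        convert h3 using 2
        ring)
    omega

/-- If both halves are of length two, all vertices of the two arcs except at most two are in jump
holes, provided the contacts of the halves are all at the ends `v1`, `v2`. -/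
lemma exists_forall_of_touch (K : IsPair G l w c 2 i 2 P1 P2)
    (hall : ∀ p ∈ wInterior P1, ∀ q ∈ wInterior P2, p = q ∨ G.Adj p q →
      G.Adj p v1 ∨ G.Adj q v2) {p q : V} (hp : p ∈ wInterior P1) (hq : q ∈ wInterior P2)
    (hpq : p = q ∨ G.Adj p q) (hpv : ¬ G.Adj p v1) :
    ∃ y z, ∀ t, (-2 ≤ t ∧ t ≤ 0 ∨ i ≤ t ∧ t ≤ i + 2) →
      InJumpHoleOver G w (c t) ∨ c t = y ∨ c t = z := by
  classical
  have H := K.param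
  have hlt := K.lt
  have hi := K.one_le
  have hl := H.four_le
  have hu1 := K.left.start_eq
  have hv2 := K.end_right
  have hqv : G.Adj q v2 := (hall p hp q hq hpq).resolve_left hpv
  have hqout := fun t => K.outside_right hq t
  have hx : ∀ x ∈ wInterior P1, ¬ G.Adj x v2 := fun x hx hadj => by
    rw [hv2] at hadj
    obtain ⟨s, h1, h2, h3⟩ := K.left.contact x hx _ hadj
    exact H.ne (by omega) (by omega) h3.symm
  have hqu : ¬ G.Adj u1 q := fun hadj => by
    rw [hu1] at hadj
    obtain ⟨s, h1, h2, h3⟩ := K.contact_right hq hadj.symm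
    exact H.ne (by omega) (by omega) h3
  have hadjpq : G.Adj p q := hpq.resolve_left (by rintro rfl; exact hx p hp hqv)
  obtain ⟨u', p1, T0, rfl, hp1, hT0, hTR, -, hTq⟩ :=
    exists_inducedPath_between (A := {u1}) (B := {x | G.Adj x q}) (P1.takeUntil p hp.1) rfl hadjpq
  have hT : ∀ a ∈ T0.support, (a = u' ∨ a ∈ wInterior P1) ∧ ¬ G.Adj a v1 := fun a ha => by
    have ha' := P1.support_takeUntil_subset_support hp.1 (hTR a ha)
    have hav : ¬ G.Adj a v1 := fun hadj => by
      rw [K.left.induced.adj_end hp.1 hp.2.2 (hTR a ha) hadj] at hadj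
      exact hpv hadj
    refine ⟨?_, hav⟩
    rcases mem_support_cases ha' with h | h | h
    · exact Or.inl h
    · exact absurd (h ▸ hTR a ha)
        (Walk.endpoint_notMem_support_takeUntil K.left.induced.1 hp.1 hp.2.2.symm)
    · exact Or.inr h
  have hTout : ∀ a ∈ T0.support, a = u' ∨ ∀ t, a ≠ c t := fun a ha =>
    (hT a ha).1.imp_right fun h => K.left.outside a h
  have hqT : q ∉ T0.support := fun h => by
    rcases (hT q h).1 with e | e
    · exact hqout 0 (e.trans hu1)
    · exact hx q e hqv
  have hp1q : G.Adj p1 q := hp1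
  obtain ⟨R, hR, hRl, hRs, hRq⟩ := K.right.induced.exists_init hq.1 hqv
  have hRcase : ∀ a ∈ R.support, a = u2 ∨ a ∈ wInterior P2 := fun a ha => by
    rcases mem_support_cases (hRs a ha).1 with e | e | e
    · exact Or.inl e
    · exact absurd e (hRs a ha).2
    · exact Or.inr e
  have hR1 : IsInducedPath G (T0.append hp1q.toWalk) := by
    refine hT0.append (IsInducedPath.of_adj hp1q) ?_ ?_
    · intro a ha hb
      exact (by simpa using hb : a = p1 ∨ a = q).resolve_right (by rintro rfl; exact hqT ha)
    · intro a ha b hb hab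
      rcases (by simpa using hb : b = p1 ∨ b = q) with rfl | rfl
      · exact Or.inr rfl
      · exact Or.inl (hTq a ha hab)
  have hR1s : ∀ a ∈ (T0.append hp1q.toWalk).support, a ∈ T0.support ∨ a = q := fun a ha => by
    rw [Walk.mem_support_append_iff] at ha
    rcases ha with ha | ha
    · exact Or.inl ha
    · rcases (by simpa using ha : a = p1 ∨ a = q) with rfl | rfl
      · exact Or.inl (Walk.end_mem_support _)
      · exact Or.inr rfl
  have hR1l : (T0.append hp1q.toWalk).length = T0.length + 1 := by simp
  generalize T0.append hp1q.toWalk = R1 at hR1 hR1s hR1l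
  obtain ⟨X, hX, hXl, hXs⟩ := (H.reflect i).exists_append_arc (k := i.toNat) (b := u') (by omega)
    hR K.right.start_eq (by rw [hu1, Int.toNat_of_nonneg (by omega), sub_self]) <| by
      intro a ha hau t h1 h2
      have ha' := (hRcase a ha).resolve_left hau
      refine ⟨K.outside_right ha' _, fun hadj => ?_⟩
      obtain ⟨s, h3, h4, h5⟩ := K.contact_right ha' hadj
      have := Int.eq_zero_of_dvd_of_lt ((H.inj _ _).1 h5) (by omega) (by omega)
      omega
  have hXs' : ∀ a ∈ X.support, a ∈ wInterior P2 ∨ ∃ t, 0 ≤ t ∧ t ≤ i ∧ a = c t := fun a ha => by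
    rcases hXs a ha with h | ⟨t, h1, h2, rfl⟩
    · rcases hRcase a h with rfl | h
      · exact Or.inr ⟨i, by omega, le_rfl, K.start_right⟩
      · exact Or.inl h
    · exact Or.inr ⟨i - t, by omega, by omega, rfl⟩
  have hO : IsHole G (R1.append X) := by
    refine hR1.isHole_append hX ?_ hqu ?_ ?_
    · rw [hu1]
      exact (hqout 0).symm
    · intro a ha hb
      rcases hR1s a ha with ha | rfl
      · rcases (hT a ha).1 with e | e
        · exact Or.inl e
        · rcases hXs' a hb with e' | ⟨t, -, -, e'⟩
          · rcases hall a e a e' (Or.inl rfl) with h | h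
            · exact absurd h (hT a ha).2
            · exact absurd h (hx a e)
          · exact absurd e' (K.left.outside a e t)
      · exact Or.inr rfl
    · intro a ha b hb hab
      rcases hR1s a ha with ha | rfl
      · rcases (hT a ha).1 with e | e
        · exact Or.inl e
        · rcases hXs' b hb with e' | ⟨t, h1, h2, rfl⟩
          · right; right; right
            exact hRq b e'.1 ((hall a e b e' (Or.inr hab)).resolve_left (hT a ha).2)
          · obtain ⟨s, h3, h4, h5⟩ := K.left.contact a e _ hab
            have := Int.eq_zero_of_dvd_of_lt ((H.inj _ _).1 h5) (by omega) (by omega)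
            right; right; left
            rw [hu1]
            congr 1
            omega
      · exact Or.inr (Or.inl rfl)
  have hTi : IsInducedPath G (R1.append hqv.toWalk) := by
    refine hR1.append (IsInducedPath.of_adj hqv) ?_ ?_
    · intro a ha hb
      refine (by simpa using hb : a = q ∨ a = v2).resolve_right ?_
      rintro rfl
      rcases hR1s _ ha with ha | e
      · rcases hTout _ ha with e | e
        · rw [hv2, hu1] at e
          exact H.ne (by omega) (by omega) e.symm
        · exact e _ hv2
      · exact hqv.ne e.symm
    · intro a ha b hb hab
      rcases (by simpa using hb : b = q ∨ b = v2) with rfl | rfl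
      · exact Or.inr rfl
      · left
        rcases hR1s a ha with ha | rfl
        · rcases (hT a ha).1 with e | e
          · rw [hv2, e, hu1] at hab
            exact absurd hab (H.not_adj (by omega) (by omega))
          · exact absurd hab (hx a e)
        · rfl
  have hTs : ∀ a ∈ (R1.append hqv.toWalk).support,
      a = u' ∨ a = v2 ∨ (∀ t, a ≠ c t) ∧ (a = q ∨ a ∈ T0.support ∧ a ∈ wInterior P1) :=
    fun a ha => by
      rw [Walk.mem_support_append_iff] at ha
      have : a ∈ R1.support ∨ a = v2 := by
        rcases ha with ha | ha
        · exact Or.inl ha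
        · rcases (by simpa using ha : a = q ∨ a = v2) with rfl | h
          · exact Or.inl (Walk.end_mem_support _)
          · exact Or.inr h
      rcases this with h | h
      · rcases hR1s a h with h | rfl
        · rcases (hT a h).1 with e | e
          · exact Or.inl e
          · exact Or.inr (Or.inr ⟨K.left.outside a e, Or.inr ⟨h, e⟩⟩)
        · exact Or.inr (Or.inr ⟨hqout, Or.inl rfl⟩)
      · exact Or.inr (Or.inl h)
  have hTl : (R1.append hqv.toWalk).length = T0.length + 2 := by simp [hR1l]
  have hqTs : q ∈ (R1.append hqv.toWalk).support := by
    rw [Walk.mem_support_append_iff]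
    exact Or.inl (Walk.end_mem_support _)
  generalize R1.append hqv.toWalk = T at hTi hTs hTl hqTs
  have hcontact : ∀ a ∈ T.support, (∀ t, a ≠ c t) → ∀ t, G.Adj a (c t) →
      c t = u' ∨ c t = v2 ∨ c t = c (-1) ∧ a ∈ T0.support := by
    intro a ha hout t hat
    rcases hTs a ha with e | e | ⟨-, e | ⟨ha0, e⟩⟩
    · exact absurd (e.trans hu1) (hout 0)
    · exact absurd (e.trans hv2) (hout _)
    · subst e
      right; left
      rw [hv2] at hqv ⊢
      exact H.eq_of_adj hout hat hqv
    · obtain ⟨s, h1, h2, h3⟩ := K.left.contact a e t hat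
      obtain rfl | rfl | rfl : s = 0 ∨ s = -1 ∨ s = -2 := by omega
      · exact Or.inl (h3.trans hu1.symm)
      · exact Or.inr (Or.inr ⟨h3, ha0⟩)
      · rw [h3, ← K.left.end_eq] at hat
        exact absurd hat (hT a ha0).2
  have hlenT := (H.le_length (s := 0) (e := i + 2) (by omega) (by omega) hu1 (by rw [hv2, zero_add])
    hTi.1 ⟨q, hqTs, hqout⟩).1
  have hlen2 := K.right.le_length (H.reflect i) (by omega)
  have hodd2 := K.right.odd
  have hOeven : Even (R1.append X).length := by
    by_contra hcon
    have := H.odd_length _ _ hO (Nat.not_even_iff_odd.1 hcon)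
    rw [Walk.length_append, hXl] at this
    omega
  obtain ⟨k, hk⟩ := Int.eq_ofNat_of_zero_le (by omega : 0 ≤ i + 2)
  obtain ⟨A, -, -, hA, -, hAl, -, hAs, -⟩ := H.exists_arcsOf (s := 0) (k := k) (k' := 2 * l + 1 - k)
    (by omega) (by omega) (by omega) hu1 (by rw [hv2, ← hk, zero_add] : v2 = _)
  have huv : u' ≠ v2 ∧ ¬ G.Adj u' v2 := by
    rw [hu1, hv2]
    exact ⟨H.ne (by omega) (by omega), H.not_adj (by omega) (by omega)⟩
  have hO2 : IsHole G (T.append A.reverse) := by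
    refine hTi.isHole_append hA.reverse huv.1 huv.2 ?_ ?_
    · intro a ha hb
      rw [Walk.support_reverse, List.mem_reverse] at hb
      obtain ⟨t, -, -, h⟩ := (hAs a).1 hb
      rcases hTs a ha with e | e | ⟨e, -⟩
      · exact Or.inl e
      · exact Or.inr e
      · exact absurd h (e _)
    · intro a ha b hb hab
      rw [Walk.support_reverse, List.mem_reverse] at hb
      obtain ⟨t, h1, h2, rfl⟩ := (hAs b).1 hb
      rcases hTs a ha with e | e | ⟨e, -⟩
      · exact Or.inl e
      · exact Or.inr (Or.inl e)
      · rcases hcontact a ha e _ hab with h | h | ⟨h, -⟩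
        · exact Or.inr (Or.inr (Or.inl h))
        · exact Or.inr (Or.inr (Or.inr h))
        · exact absurd h.symm (H.ne (by omega) (by omega))
  have hT0l : (T0.length : ℤ) + i + 4 = 2 * l + 1 := by
    have hlO : (T.append A.reverse).length = T0.length + 2 + k := by simp [hTl, hAl]
    have := H.odd_length _ _ hO2 (by
      rw [hlO, Nat.odd_iff]
      rw [Walk.length_append, hXl, Nat.even_iff] at hOeven
      rw [Int.odd_iff] at hodd2
      omega)
    omega
  have hm1 : ∀ t, c t = c (-1) → c t ∉ T.support := by
    intro t ht h
    rw [ht] at h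
    rcases hTs _ h with e | e | ⟨e, -⟩
    · rw [hu1] at e
      exact H.ne (by omega) (by omega) e
    · rw [hv2] at e
      exact H.ne (by omega) (by omega) e
    · exact e _ rfl
  have hshort : IsShortJump G w T := by
    refine H.isShortJump hTi hu1 hv2 huv.1 huv.2 ?_
    rintro x ⟨hxT, hxu, hxv⟩ r
    have hxout := ((hTs x hxT).resolve_left hxu).resolve_left hxv |>.1
    refine ⟨hxout r, fun hxr => ?_⟩
    rcases hcontact x hxT hxout r hxr with h | h | ⟨h, hx0⟩
    · exact Or.inl h
    · exact Or.inr h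
    · exfalso
      have hspec := congrArg Walk.length (T.take_spec hxT)
      rw [Walk.length_append, hTl] at hspec
      have hnm := hm1 r h
      have l1 := (H.le_length (s := -1) (e := 1) (by omega) (by omega) h (by simpa using hu1)
        (P := Walk.cons hxr.symm (T.takeUntil x hxT).reverse)
        ((hTi.1.takeUntil hxT).reverse.cons (by
          rw [Walk.support_reverse, List.mem_reverse]
          exact fun hm => hnm (T.support_takeUntil_subset_support hxT hm)))
        ⟨x, by simp, hxout⟩).1
      have l2 := (H.le_length (s := -1) (e := i + 3) (by omega) (by omega) h
        (by rw [hv2]; ring_nf) (P := Walk.cons hxr.symm (T.dropUntil x hxT))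
        ((hTi.1.dropUntil hxT).cons
          fun hm => hnm (T.support_dropUntil_subset_support hxT hm))
        ⟨x, by simp, hxout⟩).2
      simp only [Walk.length_cons, Walk.length_reverse] at l1 l2
      push_cast at l1 l2
      omega
  rcases H.inJumpHoleOver (s := 0) (e := i + 2) (by omega) (by omega) hu1
    (by rw [hv2, zero_add]) hshort with ⟨-, hcov⟩ | ⟨-, hcov⟩
  · refine ⟨c (-1), c (-2), fun t ht => ?_⟩
    by_cases h0 : 0 ≤ t
    · left
      simpa using hcov t h0 (by omega)
    · obtain rfl | rfl : t = -1 ∨ t = -2 := by omega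
      · simp
      · simp
  · refine ⟨c i, c (i + 1), fun t ht => ?_⟩
    by_cases h0 : t ≤ 0
    · left
      have := hcov (t + (2 * l + 1)) (by omega) (by omega)
      rwa [zero_add, H.add_period] at this
    · obtain rfl | rfl | rfl : t = i ∨ t = i + 1 ∨ t = i + 2 := by omega
      · simp
      · simp
      · left
        simpa using hcov (i + 2) le_rfl (by omega)

/-- Either the ends `u1`, `u2` lie in jump holes or all vertices of the two arcs but at most two
do. -/
lemma ends_or_forall (K : IsPair G l w c 2 i 2 P1 P2) :
    InJumpHoleOver G w (c 0) ∧ InJumpHoleOver G w (c i) ∨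
    ∃ y z, ∀ t, (-2 ≤ t ∧ t ≤ 0 ∨ i ≤ t ∧ t ≤ i + 2) →
      InJumpHoleOver G w (c t) ∨ c t = y ∨ c t = z := by
  have H := K.param
  have hlt := K.lt
  have hl := H.four_le
  have near : ∀ s t e : ℤ, s ≤ e → e ≤ t →
      (∀ r, 0 ≤ r → r ≤ t - s → InJumpHoleOver G w (c (s + r))) → InJumpHoleOver G w (c e) := by
    intro s t e h1 h2 h
    simpa using h (e - s) (by omega) (by omega)
  rcases (K.one_le).lt_or_eq with hi | hi
  · by_cases hall : ∀ p ∈ wInterior P1, ∀ q ∈ wInterior P2, p = q ∨ G.Adj p q →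
      G.Adj p v1 ∨ G.Adj q v2
    · right
      obtain ⟨p, hp, q, hq, hpq⟩ := K.exists_touch
      by_cases hpv : G.Adj p v1
      · by_cases hqv : G.Adj q v2
        · exfalso
          rw [K.end_right] at hqv
          rw [K.left.end_eq, ← H.add_period] at hpv
          have := H.le_three (K.outside_right hq) (K.left.outside p hp)
            (hpq.imp Eq.symm fun h => h.symm) (s := i + 2) (e := 2 * l + 1 - 4 - i)
            (by omega) (by omega) hqv (by convert hpv using 2; ring)
          omega
        · obtain ⟨y, z, h⟩ := K.swap.exists_forall_of_touch
            (fun q hq p hp hqp => (hall p hp q hq (hqp.imp Eq.symm fun h => h.symm)).symm)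
            hq hp (hpq.imp Eq.symm fun h => h.symm) hqv
          refine ⟨y, z, fun t ht => ?_⟩
          simpa using h (i - t) (by omega)
      · exact K.exists_forall_of_touch hall hp hq hpq hpv
    · push Not at hall
      obtain ⟨p, hp, q, hq, hpq, hpv, hqv⟩ := hall
      obtain ⟨s, t, h1, h2, h3, h4, P, hP⟩ := K.exists_isShortJump_low hi hp hq hpq hpv hqv
      rcases H.inJumpHoleOver (s := s) (e := t - s) (by omega) (by omega) rfl (by simp) hP with
        ⟨-, hcov⟩ | ⟨-, hcov⟩
      · exact Or.inl ⟨near s t 0 h2 (by omega) hcov, near s t i (by omega) h3 hcov⟩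
      · right
        refine ⟨c 0, c i, fun r hr => ?_⟩
        by_cases h5 : r < 0
        · left
          have := hcov (r + (2 * l + 1) - s) (by omega) (by omega)
          rwa [add_sub_cancel, H.add_period] at this
        · by_cases h6 : i < r
          · left
            have := hcov (r - s) (by omega) (by omega)
            rwa [add_sub_cancel] at this
          · obtain rfl | rfl : r = 0 ∨ r = i := by omega
            · simp
            · simp
  · left
    obtain ⟨s, t, h1, h2, h3, h4, h5, P, hP⟩ := K.exists_isShortJump
    rcases H.inJumpHoleOver (s := s) (e := t - s) (by omega) (by omega) rfl (by simp) hP with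
      ⟨-, hcov⟩ | ⟨h, -⟩
    · exact ⟨near s t 0 h2 (by omega) hcov, near s t i (by omega) h3 hcov⟩
    · omega

/-- If both halves are of length two, all vertices of the two arcs except at most two are in jump
holes. -/
lemma exists_forall (K : IsPair G l w c 2 i 2 P1 P2) :
    ∃ y z, ∀ t, (-2 ≤ t ∧ t ≤ 0 ∨ i ≤ t ∧ t ≤ i + 2) →
      InJumpHoleOver G w (c t) ∨ c t = y ∨ c t = z := by
  have H := K.param
  rcases K.ends_or_forall with ⟨h1, h2⟩ | h
  · rcases K.reflect.ends_or_forall with ⟨h3, h4⟩ | ⟨y, z, h⟩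
    · have h4' : InJumpHoleOver G w (c (i + 2)) := by
        rw [← H.sub_period]
        convert h4 using 2
        ring
      refine ⟨c (-1), c (i + 1), fun t ht => ?_⟩
      obtain rfl | rfl | rfl | rfl | rfl | rfl :
        t = 0 ∨ t = -1 ∨ t = -2 ∨ t = i ∨ t = i + 1 ∨ t = i + 2 := by omega
      · exact Or.inl h1
      · simp
      · exact Or.inl (by simpa using h3)
      · exact Or.inl h2
      · simp
      · exact Or.inl h4'
    · refine ⟨y, z, fun t ht => ?_⟩
      rcases ht with ht | ht
      · simpa using h (-2 - t) (by omega)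
      · have := h (-2 - t + (2 * l + 1)) (by omega)
        have e : c (-2 - (-2 - t + (2 * l + 1))) = c t := by
          rw [← H.add_period]
          ring_nf
        rwa [e] at this
  · exact h

/-- If the first half has length two, at most two vertices of its arc are in no jump hole. -/
lemma exists_forall_left (K : IsPair G l w c 2 i d P1 P2) :
    ∃ y z, ∀ t, (-2 ≤ t ∧ t ≤ 0) → InJumpHoleOver G w (c t) ∨ c t = y ∨ c t = z := by
  have hlt := K.lt
  have hi := K.one_le
  obtain ⟨s, t, h1, h2, h3, h4, h5, P, hP⟩ := K.exists_isShortJump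
  have hs := K.param.inJumpHoleOver_start (by omega) (by omega) hP
  obtain rfl | rfl | rfl : s = 0 ∨ s = -1 ∨ s = -2 := by omega
  · refine ⟨c (-1), c (-2), fun r hr => ?_⟩
    obtain rfl | rfl | rfl : r = 0 ∨ r = -1 ∨ r = -2 := by omega
    all_goals simp [hs]
  · refine ⟨c 0, c (-2), fun r hr => ?_⟩
    obtain rfl | rfl | rfl : r = 0 ∨ r = -1 ∨ r = -2 := by omega
    all_goals simp [hs]
  · refine ⟨c 0, c (-1), fun r hr => ?_⟩
    obtain rfl | rfl | rfl : r = 0 ∨ r = -1 ∨ r = -2 := by omega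
    all_goals simp [hs]

end IsPair

namespace HoleParam

variable {G : SimpleGraph V} {l : ℕ} {v0 : V} {w : G.Walk v0 v0} {c : ℤ → V}

lemma congr_add (H : HoleParam G l w c) {x y : ℤ} (h : c x = c y) (k : ℤ) :
    c (x + k) = c (y + k) := by
  rw [H.inj] at h ⊢
  convert h using 1
  ring

/-- A path running along the hole and avoiding the successor of its start. -/
lemma eq_of_edges_subset (H : HoleParam G l w c) {s : ℤ} {a b : V} {Q : G.Walk a b}
    (hQ : Q.IsPath) (ha : a = c s) (he : ∀ e ∈ Q.edges, e ∈ w.edges)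
    (hs : c (s + 1) ∉ Q.support) :
    b = c (s - Q.length) ∧
      ∀ x, x ∈ Q.support ↔ ∃ t : ℤ, 0 ≤ t ∧ t ≤ Q.length ∧ x = c (s - t) := by
  induction Q generalizing s with
  | nil =>
    refine ⟨by simpa using ha, fun x => ?_⟩
    rw [Walk.support_nil, List.mem_singleton]
    constructor
    · rintro rfl
      exact ⟨0, by simp [ha]⟩
    · rintro ⟨t, h1, h2, rfl⟩
      obtain rfl : t = 0 := by simp at h2; omega
      simp [ha]
  | @cons a z b h R ih =>
    rw [Walk.cons_isPath_iff] at hQ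
    rw [Walk.support_cons, List.mem_cons, not_or] at hs
    have hz : z = c (s - 1) := by
      obtain ⟨t, ht⟩ := (H.mem_edges _).1 (he s(a, z) (by simp))
      rw [ha] at ht
      rcases Sym2.eq_iff.1 ht with ⟨h1, rfl⟩ | ⟨h1, rfl⟩
      · refine absurd ?_ hs.2
        rw [H.congr_add h1 1]
        exact Walk.start_mem_support R
      · have := H.congr_add h1 (-1)
        rw [add_neg_cancel_right] at this
        exact this.symm
    obtain ⟨h1, h2⟩ := ih hQ.1 hz (fun e h => he e (by simp [h])) 
      (by rw [sub_add_cancel, ← ha]; exact hQ.2)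
    refine ⟨h1.trans (by rw [Walk.length_cons]; push_cast; ring_nf), fun x => ?_⟩
    rw [Walk.support_cons, List.mem_cons, h2, Walk.length_cons]
    constructor
    · rintro (rfl | ⟨t, h3, h4, rfl⟩)
      · exact ⟨0, by simp, by positivity, by simp [ha]⟩
      · exact ⟨t + 1, by omega, by push_cast; omega, by ring_nf⟩
    · rintro ⟨t, h3, h4, rfl⟩
      by_cases ht : t = 0
      · simp [ht, ha]
      · exact Or.inr ⟨t - 1, by omega, by push_cast at h4; omega, by ring_nf⟩

/-- A path running along the hole and avoiding one vertex is the arc not containing it. -/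
lemma arc_of_edges_subset (H : HoleParam G l w c) {h i : ℤ} (hh : 0 < h) (hi : 0 < i)
    (hih : i + h < 2 * l + 1) {a b : V} {Q : G.Walk a b} (hQ : Q.IsPath) (ha : a = c 0)
    (hb : b = c (-h)) (he : ∀ e ∈ Q.edges, e ∈ w.edges) (hQi : c i ∉ Q.support) :
    Q.length = h ∧ ∀ x ∈ Q.support, ∃ t, -h ≤ t ∧ t ≤ 0 ∧ x = c t := by
  cases Q with
  | nil => exact absurd (ha.symm.trans hb) (H.ne (by omega) (by omega)).symm
  | @cons _ z _ hadj R =>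
    rw [Walk.cons_isPath_iff] at hQ
    rw [Walk.support_cons, List.mem_cons, not_or] at hQi
    have heR : ∀ e ∈ R.edges, e ∈ w.edges := fun e h => he e (by simp [h])
    obtain ⟨t, ht⟩ := (H.mem_edges _).1 (he s(a, z) (by simp))
    rw [ha] at ht
    have hlt : ∀ {c' : ℤ → V}, HoleParam G l w c' → c' 0 = c 0 →
        (∀ x, x ∈ R.support ↔ ∃ t : ℤ, 0 ≤ t ∧ t ≤ R.length ∧ x = c' (-1 - t)) →
        (R.length : ℤ) < 2 * l := fun H' h0 hs => by
      by_contra hcon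
      refine hQ.2 ((hs a).2 ⟨2 * l, by omega, by omega, ?_⟩)
      rw [ha, ← h0, ← H'.sub_period]
      ring_nf
    rcases Sym2.eq_iff.1 ht with ⟨h1, rfl⟩ | ⟨h1, rfl⟩
    · exfalso
      have H' := H.reflect 0
      obtain ⟨h2, h3⟩ := H'.eq_of_edges_subset (s := -1) hQ.1 (by
        simpa using (H.congr_add h1 1).symm) heR (by simpa [← ha] using hQ.2)
      have h4 := hlt H' (by simp) h3
      replace h2 := hb.symm.trans h2
      have := Int.eq_zero_or_eq_of_dvd_of_lt (dvd_neg.2 ((H.inj _ _).1 h2)) (by omega) (by omega)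
      refine hQi.2 ((h3 _).2 ⟨i - 1, by omega, by omega, ?_⟩)
      ring_nf
    · obtain ⟨h2, h3⟩ := H.eq_of_edges_subset (s := -1) hQ.1 (by
        simpa using (H.congr_add h1 (-1)).symm) heR (by simpa [← ha] using hQ.2)
      have h4 := hlt H rfl h3
      replace h2 := hb.symm.trans h2
      have := Int.eq_zero_of_dvd_of_lt ((H.inj _ _).1 h2) (by omega) (by omega)
      refine ⟨by rw [Walk.length_cons]; push_cast; omega, fun x hx => ?_⟩
      rw [Walk.support_cons, List.mem_cons, h3] at hx
      rcases hx with rfl | ⟨t, h5, h6, rfl⟩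
      · exact ⟨0, by omega, le_rfl, ha⟩
      · exact ⟨-1 - t, by omega, by omega, rfl⟩

end HoleParam

lemma IsHalf.of_across {G : SimpleGraph V} {l : ℕ} {v0 : V} {w : G.Walk v0 v0} {c : ℤ → V}
    (H : HoleParam G l w c) {h i : ℤ} (hh : 0 < h) (hi : 0 < i) (hih : i + h < 2 * l + 1)
    {u v : V} {P A B : G.Walk u v} (hu : u = c 0) (hv : v = c (-h)) (hAi : c i ∉ wInterior A)
    (hP : IsShortJumpAcross G w P A B ∨ IsLocalJumpAcross G w P A B ∧ A.length = 2) :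
    IsHalf G c h P ∧ A.length = h ∧ ∀ x ∈ A.support, ∃ t, -h ≤ t ∧ t ≤ 0 ∧ x = c t := by
  obtain ⟨⟨-, -, -, hne, hnadj, hind, hdisj⟩, harcs⟩ : IsJump G w P ∧ ArcsOf G w A B :=
    hP.elim (fun h => ⟨h.1.1, h.2.1⟩) (fun h => ⟨h.1.1, h.1.2.1⟩)
  obtain ⟨-, -, -, hA, -, -, hAB⟩ := harcs
  have hcover : ∀ e, e ∈ w.edges ↔ e ∈ A.edges ∨ e ∈ B.edges := fun e => Set.ext_iff.1 hAB e
  have hAi' : c i ∉ A.support := fun hm => by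
    rcases mem_support_cases hm with e | e | e
    · rw [hu] at e
      exact H.ne (by omega) (by omega) e.symm
    · rw [hv] at e
      exact H.ne (by omega) (by omega) e.symm
    · exact hAi e
  obtain ⟨hlen, hsup⟩ := H.arc_of_edges_subset hh hi hih hA hu hv
    (fun e he => (hcover e).2 (Or.inl he)) hAi'
  have h2 : 2 ≤ h := by
    by_contra hcon
    obtain rfl : h = 1 := by omega
    rw [hu, hv] at hnadj
    exact hnadj (by simpa using (H.adj_succ (-1)).symm)
  have hout : ∀ y ∈ wInterior P, ∀ t, y ≠ c t := fun y hy t e =>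
    hdisj y hy ((H.mem_support y).2 ⟨t, e⟩)
  have hcontact : ∀ y ∈ wInterior P, ∀ t, G.Adj y (c t) → ∃ s, -h ≤ s ∧ s ≤ 0 ∧ c t = c s := by
    intro y hy t hyt
    rcases hP with hP | hP
    · by_cases h1 : c t = u
      · exact ⟨0, by omega, le_rfl, h1.trans hu⟩
      · by_cases h2 : c t = v
        · exact ⟨-h, le_rfl, by omega, h2.trans hv⟩
        · exact absurd hyt.symm (hP.1.2 _ ((H.mem_support _).2 ⟨t, rfl⟩) h1 h2 y hy)
    · have hm : c t ∈ A.support ∨ c t ∈ B.support :=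
        ((hcover _).1 ((H.mem_edges _).2 ⟨t, rfl⟩)).imp
          (fun e => Walk.fst_mem_support_of_mem_edges _ e)
          (fun e => Walk.fst_mem_support_of_mem_edges _ e)
      rcases hm with hm | hm
      · exact hsup _ hm
      · rcases mem_support_cases hm with e | e | e
        · exact ⟨0, by omega, le_rfl, e.trans hu⟩
        · exact ⟨-h, le_rfl, by omega, e.trans hv⟩
        · exact absurd hyt.symm (hP.1.2.2.2 _ e y hy)
  refine ⟨⟨hu, hv, h2, hind, hout, hcontact, ?_⟩, hlen, hsup⟩
  rcases hP with hP | hP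
  · have := hP.2.2.2
    rw [Walk.length_append, Walk.length_reverse, Nat.odd_iff] at this
    rw [Int.odd_iff]
    omega
  · obtain rfl : h = 2 := by rw [← hlen, hP.2]; rfl
    have hl := H.four_le
    obtain ⟨y, hy⟩ := exists_mem_wInterior hind.1 hne hnadj
    have hPl := (H.le_length (s := -2) (e := 2) (by omega) (by omega) hv (by simpa using hu)
      hind.1.reverse ⟨y, by simpa using hy.1, hout y hy⟩).1
    obtain ⟨Q, -, -, hQ, -, hQl, -, hQs, -⟩ := H.exists_arcsOf (s := 0) (k := 2 * l - 1) (k' := 2)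
      (by omega) le_rfl (by omega) hu (show v = _ by
        rw [hv, ← H.add_period]
        congr 1
        omega)
    have hhole : IsHole G (P.append Q.reverse) := by
      refine hind.isHole_append hQ.reverse hne hnadj ?_ ?_
      · intro a ha hb
        rw [Walk.support_reverse, List.mem_reverse] at hb
        obtain ⟨t, -, -, e⟩ := (hQs a).1 hb
        rcases mem_support_cases ha with h | h | h
        · exact Or.inl h
        · exact Or.inr h
        · exact absurd e (hout a h _)
      · intro a ha b hb hab
        rw [Walk.support_reverse, List.mem_reverse] at hb
        obtain ⟨t, h3, h4, rfl⟩ := (hQs b).1 hb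
        rcases mem_support_cases ha with h | h | h
        · exact Or.inl h
        · exact Or.inr (Or.inl h)
        · obtain ⟨s, h5, h6, h7⟩ := hcontact a h _ hab
          right; right
          rw [h7]
          rcases Int.eq_zero_or_eq_of_dvd_of_lt ((H.inj _ _).1 h7) (by omega) (by omega) with e | e
          · left
            rw [hu]
            congr 1
            omega
          · right
            rw [hv]
            congr 1
            omega
    by_contra hcon
    rw [Int.not_odd_iff_even, Int.even_iff] at hcon
    have hlh : (P.append Q.reverse).length = P.length + (2 * l - 1) := by simp [hQl]
    have := H.odd_length _ _ hhole (by rw [hlh, Nat.odd_iff]; omega)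
    rw [Walk.length_reverse] at hPl
    omega

lemma IsOddHole.exists_holeParam {G : SimpleGraph V} {l : ℕ} (hl : 4 ≤ l) (hG : MemGFam G l) {v : V}
    {w : G.Walk v v} (hw : IsOddHole G w) :
    ∃ c, HoleParam G l w c ∧ w.length = 2 * l + 1 ∧
      ∀ i : ℕ, i ≤ w.length → w.getVert i = c i := by
  have hgirth : ∀ (a : V) (q : G.Walk a a), q.IsCycle → 2 * l + 1 ≤ q.length := fun a q hq => by
    have := hq.girth_le_length
    rwa [hG.1] at this
  have hodd : ∀ (a : V) (q : G.Walk a a), IsHole G q → Odd q.length → q.length = 2 * l + 1 :=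
    fun a q hq hq' => by
      have := hgirth a q hq.1
      have := hG.2 a q ⟨hq, hq'⟩
      rw [Nat.odd_iff] at hq'
      omega
  have hlen := hodd v w hw.1 hw.2
  let c : ℤ → V := fun t => w.getVert (t % (2 * l + 1)).toNat
  have hper : ∀ x y : ℤ, (2 * l + 1 : ℤ) ∣ x - y → c x = c y := fun x y h => by
    have : x % (2 * l + 1) = y % (2 * l + 1) :=
      Int.emod_eq_emod_iff_emod_sub_eq_zero.2 (Int.emod_eq_zero_of_dvd h)
    simp only [c, this]
  have hget : ∀ i : ℕ, i ≤ w.length → w.getVert i = c i := fun i hi => by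
    rcases hi.lt_or_eq with h | rfl
    · simp only [c]
      rw [Int.emod_eq_of_lt (by omega) (by omega), Int.toNat_natCast]
    · rw [hper w.length 0 (by rw [hlen]; simp)]
      simp [c]
  have hinj : ∀ x y, c x = c y ↔ (2 * l + 1 : ℤ) ∣ x - y := fun x y => by
    refine ⟨fun h => ?_, hper x y⟩
    have h1 := Int.emod_nonneg x (show (2 * l + 1 : ℤ) ≠ 0 by omega)
    have h2 := Int.emod_nonneg y (show (2 * l + 1 : ℤ) ≠ 0 by omega)
    have h3 := Int.emod_lt_of_pos x (show (0 : ℤ) < 2 * l + 1 by omega)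
    have h4 := Int.emod_lt_of_pos y (show (0 : ℤ) < 2 * l + 1 by omega)
    have h5 := hw.1.1.getVert_injOn' (by rw [Set.mem_ofPred_eq]; omega)
      (by rw [Set.mem_ofPred_eq]; omega) h
    exact Int.dvd_of_emod_eq_zero (Int.emod_eq_emod_iff_emod_sub_eq_zero.1 (by omega))
  have hex : ∀ t, ∃ i : ℕ, i < w.length ∧ c t = c i ∧ c (t + 1) = c (i + 1) := fun t => by
    have h1 := Int.emod_nonneg t (show (2 * l + 1 : ℤ) ≠ 0 by omega)
    have h3 := Int.emod_lt_of_pos t (show (0 : ℤ) < 2 * l + 1 by omega)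
    have h4 : (2 * l + 1 : ℤ) ∣ t - (t % (2 * l + 1)).toNat := by
      rw [Int.toNat_of_nonneg h1]
      exact Int.dvd_self_sub_emod
    exact ⟨(t % (2 * l + 1)).toNat, by omega, hper _ _ h4, hper _ _ (by simpa using h4)⟩
  have hedge : ∀ e, e ∈ w.edges ↔ ∃ t, e = s(c t, c (t + 1)) := fun e => by
    induction e with | _ a b
    rw [w.mk_mem_edges_iff_exists]
    constructor
    · rintro ⟨i, hi, he⟩
      refine ⟨i, ?_⟩
      rw [← he, hget i hi.le, hget (i + 1) hi]
      simp
    · rintro ⟨t, ht⟩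
      obtain ⟨i, hi, h1, h2⟩ := hex t
      refine ⟨i, hi, ?_⟩
      rw [ht, h1, h2, hget i hi.le, hget (i + 1) hi]
      simp
  have hmem : ∀ a, a ∈ w.support ↔ ∃ t, a = c t := fun a => by
    rw [Walk.mem_support_iff_exists_getVert]
    constructor
    · rintro ⟨i, rfl, hi⟩
      exact ⟨i, hget i hi⟩
    · rintro ⟨t, rfl⟩
      obtain ⟨i, hi, h1, -⟩ := hex t
      exact ⟨i, by rw [h1, hget i hi.le], hi.le⟩
  have hadj : ∀ t, G.Adj (c t) (c (t + 1)) := fun t =>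
    w.adj_of_mem_edges ((hedge _).2 ⟨t, rfl⟩)
  refine ⟨c, ⟨hl, hgirth, hodd, hw.1, hinj, fun x y => ⟨fun h => ?_, fun h => ?_⟩, hmem,
    hedge⟩, hlen, hget⟩
  · obtain ⟨t, ht⟩ := (hedge _).1
      (hw.1.2.2 _ ((hmem _).2 ⟨x, rfl⟩) _ ((hmem _).2 ⟨y, rfl⟩) h)
    rcases Sym2.eq_iff.1 ht with ⟨h1, h2⟩ | ⟨h1, h2⟩ <;> rw [hinj] at h1 h2
    · right
      exact (by ring : x - y + 1 = x - t - (y - (t + 1))) ▸ dvd_sub h1 h2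
    · left
      exact (by ring : x - y - 1 = x - (t + 1) - (y - t)) ▸ dvd_sub h1 h2
  · rcases h with h | h
    · rw [hper x (y + 1) (by rwa [← sub_sub])]
      exact (hadj y).symm
    · rw [hper y (x + 1) 
        (by rwa [← dvd_neg, neg_sub, add_sub_right_comm])]
      exact hadj x

/-- A parametrisation of the hole adapted to four vertices appearing in cyclic order. -/
lemma CyclicOrder4.exists_holeParam {G : SimpleGraph V} {l : ℕ} (hl : 4 ≤ l) (hG : MemGFam G l)
    {v a b c d : V} {w : G.Walk v v} (hw : IsOddHole G w) (h : CyclicOrder4 G w a b c d) :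
    ∃ (f : ℤ → V) (i j k : ℤ), HoleParam G l w f ∧ 0 < i ∧ i < j ∧ j < k ∧ k < 2 * l + 1 ∧
      a = f 0 ∧ b = f i ∧ c = f j ∧ d = f k := by
  obtain ⟨f, H, hlen, hget⟩ := hw.exists_holeParam hl hG
  obtain ⟨m, hm⟩ := h
  obtain ⟨g, hg⟩ := List.sublist_iff_exists_fin_orderEmbedding_get_eq.1 hm
  have hL : (w.support.tail.rotate m).length = 2 * l + 1 := by simp [hlen]
  have key : ∀ x, (w.support.tail.rotate m).get x = f (x + (m + 1)) := fun x => by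
    have hx : (x + m) % (2 * l + 1) < 2 * l + 1 := Nat.mod_lt _ (by omega)
    have h1 : (w.support.tail.rotate m).get x = w.getVert ((x + m) % (2 * l + 1) + 1) := by
      rw [List.get_eq_getElem, List.getElem_rotate, List.getElem_tail,
        Walk.support_getElem_eq_getVert]
      simp [hlen]
    rw [h1, hget _ (by omega), H.inj]
    have h2 : ((2 * l + 1 : ℕ) : ℤ) ∣ ((x + m : ℕ) % (2 * l + 1 : ℕ) : ℕ) - (x + m : ℕ) := by
      rw [Int.natCast_mod, ← dvd_neg, neg_sub]
      exact Int.dvd_self_sub_emod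
    push_cast at h2 ⊢
    convert h2 using 1
    ring
  let x0 := g ⟨0, by simp⟩
  let x1 := g ⟨1, by simp⟩
  let x2 := g ⟨2, by simp⟩
  let x3 := g ⟨3, by simp⟩
  have h01 : x0 < x1 := g.strictMono (by simp)
  have h12 : x1 < x2 := g.strictMono (by simp)
  have h23 : x2 < x3 := g.strictMono (by simp)
  have h3 := x3.2
  rw [Fin.lt_def] at h01 h12 h23
  have e0 := (hg ⟨0, by simp⟩).trans (key x0)
  have e1 := (hg ⟨1, by simp⟩).trans (key x1)
  have e2 := (hg ⟨2, by simp⟩).trans (key x2)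
  have e3 := (hg ⟨3, by simp⟩).trans (key x3)
  refine ⟨_, x1 - x0, x2 - x0, x3 - x0, H.shift (x0 + (m + 1)), by omega, by omega, by omega,
    by omega, ?_, ?_, ?_, ?_⟩
  · exact e0.trans (congrArg f (by ring))
  · exact e1.trans (congrArg f (by ring))
  · exact e2.trans (congrArg f (by ring))
  · exact e3.trans (congrArg f (by ring))

lemma IsShortJumpAcross.not_isLocalJumpAcross {G : SimpleGraph V} {v s t : V} {w : G.Walk v v}
    {P A B : G.Walk s t} (h : IsShortJumpAcross G w P A B) (hA : ∀ a ∈ A.support, a ∈ w.support) :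
    ¬ IsLocalJumpAcross G w P A B := by
  rintro ⟨-, -, ⟨a, ha, b, hb, hab⟩, -⟩
  exact h.1.2 a (hA a ha.1) ha.2.1 ha.2.2 b hb hab

/-- For two uncrossing jumps as above, each short or local across
one vertex, if at least one of them is local then at most two vertices of
`V(C(v1,u1) ∪ C(u2,v2))` lie in no jump hole over `C`. -/
theorem uncrossing_jumps_with_local {V : Type*} [Fintype V]
    (l : ℕ) (hl : 4 ≤ l) (G : SimpleGraph V) (hG : MemGFam G l)
    {v u1 v1 u2 v2 : V} (w : G.Walk v v) (hw : IsOddHole G w)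
    (P1 A1 B1 : G.Walk u1 v1) (P2 A2 B2 : G.Walk u2 v2)
    (hne : ({u1, v1} : Set V) ≠ {u2, v2})
    (horder : CyclicOrder4 G w u1 u2 v2 v1)
    (hA1 : u2 ∉ wInterior A1 ∧ v2 ∉ wInterior A1)
    (hA2 : u1 ∉ wInterior A2 ∧ v1 ∉ wInterior A2)
    (h1 : IsShortJumpAcross G w P1 A1 B1 ∨
      (IsLocalJumpAcross G w P1 A1 B1 ∧ A1.length = 2))
    (h2 : IsShortJumpAcross G w P2 A2 B2 ∨
      (IsLocalJumpAcross G w P2 A2 B2 ∧ A2.length = 2))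
    (hloc : IsLocalJumpAcross G w P1 A1 B1 ∨ IsLocalJumpAcross G w P2 A2 B2) :
    ({x | (x ∈ A1.support ∨ x ∈ A2.support) ∧ ¬ InJumpHoleOver G w x}).ncard ≤ 2 := by
  obtain ⟨c, i, j, k, H, hi, hij, hjk, hk, hu1, hu2, hv2, hv1⟩ :=
    horder.exists_holeParam hl hG hw
  have hl1 := IsHalf.of_across H (h := 2 * l + 1 - k) (i := i) (by omega) hi (by omega) hu1
    (by rw [hv1, ← H.sub_period]; congr 1; ring) (hu2 ▸ hA1.1) h1
  have hl2 := IsHalf.of_across (H.reflect i) (h := j - i) (i := i) (by omega) hi (by omega)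
    (by simpa using hu2) (by rw [hv2]; congr 1; ring) (by simpa [← hu1] using hA2.1) h2
  have K : IsPair G l w c (2 * l + 1 - k) i (j - i) P1 P2 :=
    ⟨H, hl1.1, hl2.1, hi, by omega⟩
  have hw1 : ∀ a ∈ A1.support, a ∈ w.support := fun a ha => by
    obtain ⟨t, -, -, rfl⟩ := hl1.2.2 a ha
    exact (H.mem_support _).2 ⟨_, rfl⟩
  have hw2 : ∀ a ∈ A2.support, a ∈ w.support := fun a ha => by
    obtain ⟨t, -, -, rfl⟩ := hl2.2.2 a ha
    exact (H.mem_support _).2 ⟨_, rfl⟩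
  suffices ∃ y z, ∀ x, x ∈ A1.support ∨ x ∈ A2.support → InJumpHoleOver G w x ∨ x = y ∨ x = z by
    obtain ⟨y, z, h⟩ := this
    refine (Set.ncard_le_ncard (t := {y, z}) ?_).trans
      ((Set.ncard_insert_le y {z}).trans (by rw [Set.ncard_singleton]))
    rintro x ⟨hx, hx'⟩
    exact (h x hx).resolve_left hx'
  rcases h1 with h1 | ⟨-, h1⟩ <;> rcases h2 with h2 | ⟨-, h2⟩
  · exact absurd hloc (not_or.2 ⟨h1.not_isLocalJumpAcross hw1, h2.not_isLocalJumpAcross hw2⟩)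
  · have hd : j - i = 2 := by rw [← hl2.2.1, h2]; rfl
    rw [hd] at K hl2
    obtain ⟨y, z, h⟩ := K.swap.exists_forall_left
    refine ⟨y, z, fun x hx => hx.elim
      (fun hx => Or.inl ⟨_, _, P1, A1, B1, h1, Or.inr hx⟩) (fun hx => ?_)⟩
    obtain ⟨t, ht, ht', rfl⟩ := hl2.2.2 x hx
    exact h t ⟨ht, ht'⟩
  · have hh : 2 * (l : ℤ) + 1 - k = 2 := by rw [← hl1.2.1, h1]; rfl
    rw [hh] at K hl1
    obtain ⟨y, z, h⟩ := K.exists_forall_left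
    refine ⟨y, z, fun x hx => hx.elim (fun hx => ?_)
      (fun hx => Or.inl ⟨_, _, P2, A2, B2, h2, Or.inr hx⟩)⟩
    obtain ⟨t, ht, ht', rfl⟩ := hl1.2.2 x hx
    exact h t ⟨ht, ht'⟩
  · have hh : 2 * (l : ℤ) + 1 - k = 2 := by rw [← hl1.2.1, h1]; rfl
    have hd : j - i = 2 := by rw [← hl2.2.1, h2]; rfl
    rw [hh] at K hl1
    rw [hd] at K hl2
    obtain ⟨y, z, h⟩ := K.exists_forall
    refine ⟨y, z, fun x hx => ?_⟩
    rcases hx with hx | hx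
    · obtain ⟨t, ht, ht', rfl⟩ := hl1.2.2 x hx
      exact h t (Or.inl ⟨ht, ht'⟩)
    · obtain ⟨t, ht, ht', rfl⟩ := hl2.2.2 x hx
      exact h (i - t) (Or.inr ⟨by omega, by omega⟩)
end

section
/- Let l ≥ 4 be an integer and let G ∈ 𝒢_l be 4-vertex-critical. Then either G has no odd K4-subdivision, or G has an odd K4-subdivision H = (u1, u2, u3, u4, P1, P2, Q1, Q2, L1, L2) such that every minimal direct connection (v1, v2)-path linking H \ P2* and P2* (where P2* is the set of internal vertices of P2) satisfies: the set of neighbours of v1 in H equals {u3} or {u4}, and the set of neighbours of v2 in H consists exactly of the unique neighbour in P2* of that vertex u3 (respectively u4). -/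
open SimpleGraph

variable {V : Type*}

namespace SimpleGraph.Walk

variable {G : SimpleGraph V} {x y z : V}

theorem IsPath.append_of_inter {A : G.Walk x y} {B : G.Walk y z} (hA : A.IsPath) (hB : B.IsPath)
    (h : ∀ a ∈ A.support, a ∈ B.support → a = y) : (A.append B).IsPath := by
  rw [isPath_def, support_append, List.nodup_append']
  refine ⟨hA.support_nodup, hB.support_nodup.tail, fun a ha hb => ?_⟩
  have hay := h a ha (List.mem_of_mem_tail hb)
  have hn := hB.support_nodup
  rw [← cons_tail_support, List.nodup_cons] at hn
  exact hn.1 (hay ▸ hb)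

theorem IsPath.eq_of_mem_append {A : G.Walk x y} {B : G.Walk y z} (h : (A.append B).IsPath)
    {a : V} (ha : a ∈ A.support) (hb : a ∈ B.support) : a = y := by
  by_contra hne
  exact IsPath.ne_of_mem_support_of_append h hne ha hb rfl

theorem IsPath.mem_tail_support {A : G.Walk x y} {a : V} (ha : a ∈ A.support) (hne : a ≠ x) :
    a ∈ A.support.tail := by
  rw [mem_support_iff] at ha
  exact ha.resolve_left hne

theorem IsPath.notMem_tail_support {A : G.Walk x y} (hA : A.IsPath) : x ∉ A.support.tail := by
  have hn := hA.support_nodup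
  rw [← cons_tail_support, List.nodup_cons] at hn
  exact hn.1

theorem isCycle_append_reverse {A B : G.Walk x y} (hA : A.IsPath) (hB : B.IsPath)
    (h : ∀ a ∈ A.support, a ∈ B.support → a = x ∨ a = y) (hl : 1 < A.length ∨ 1 < B.length) :
    (A.append B.reverse).IsCycle := by
  refine hA.isCycle_append ((isPath_reverse_iff B).mpr hB) (fun a ha hb => ?_) (by simpa using hl)
  have hb' : a ∈ B.support := by simpa using List.mem_of_mem_tail hb
  rcases h a (List.mem_of_mem_tail ha) hb' with rfl | rfl
  · exact hA.notMem_tail_support ha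
  · exact ((isPath_reverse_iff B).mpr hB).notMem_tail_support hb

theorem inter_of_isCycle_triangle {X : G.Walk x y} {Y : G.Walk y z} {Z : G.Walk x z}
    (hxy : x ≠ y) (hyz : y ≠ z) (hxz : x ≠ z) (h : ((X.append Y).append Z.reverse).IsCycle) :
    (∀ a ∈ X.support, a ∈ Y.support → a = y) ∧ (∀ a ∈ X.support, a ∈ Z.support → a = x) ∧
      ∀ a ∈ Y.support, a ∈ Z.support → a = z := by
  have h1 : (X.append Y).IsPath := h.isPath_of_append_left (not_nil_of_ne hxz.symm)
  rw [← append_assoc] at h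
  have h2 : (Y.append Z.reverse).IsPath := h.isPath_of_append_right (not_nil_of_ne hxy)
  have h3 : ∀ a ∈ Y.support, a ∈ Z.support → a = z := fun a ha hb =>
    h2.eq_of_mem_append ha (by simpa using hb)
  refine ⟨fun a ha hb => h1.eq_of_mem_append ha hb, fun a ha hb => ?_, h3⟩
  by_contra hne
  have hn := h.support_nodup
  rw [tail_support_append, List.nodup_append'] at hn
  have hay : a ≠ y := by
    rintro rfl
    exact hyz (h3 _ (start_mem_support _) hb)
  refine hn.2.2 (IsPath.mem_tail_support ha hne) (IsPath.mem_tail_support ?_ hay)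
  rw [mem_support_append_iff]
  right
  simpa using hb

theorem isCycle_triangle {X : G.Walk x y} {Y : G.Walk y z} {Z : G.Walk x z}
    (hX : X.IsPath) (hY : Y.IsPath) (hZ : Z.IsPath) (hxy : x ≠ y) (hyz : y ≠ z)
    (h1 : ∀ a ∈ X.support, a ∈ Y.support → a = y) (h2 : ∀ a ∈ X.support, a ∈ Z.support → a = x)
    (h3 : ∀ a ∈ Y.support, a ∈ Z.support → a = z) :
    ((X.append Y).append Z.reverse).IsCycle := by
  refine isCycle_append_reverse (hX.append_of_inter hY h1) hZ (fun a ha hb => ?_) (Or.inl ?_)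
  · rcases (mem_support_append_iff _ _).1 ha with ha | ha
    · exact Or.inl (h2 a ha hb)
    · exact Or.inr (h3 a ha hb)
  · have := (not_nil_iff_lt_length).1 (not_nil_of_ne (p := X) hxy)
    have := (not_nil_iff_lt_length).1 (not_nil_of_ne (p := Y) hyz)
    rw [length_append]
    omega

theorem exists_short_arc [DecidableEq V] {v : V} (w : G.Walk v v) {a b : V} (ha : a ∈ w.support)
    (hb : b ∈ w.support) : ∃ W : G.Walk a b, W.support ⊆ w.support ∧ W.edges ⊆ w.edges ∧
      2 * W.length ≤ w.length := by
  have hb' : b ∈ (w.rotate a ha).support := (mem_support_rotate_iff w a ha).2 hb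
  have hsub : ∀ c, c ∈ (w.rotate a ha).support → c ∈ w.support :=
      fun c hc => (mem_support_rotate_iff w a ha).1 hc
  have hedg : ∀ e, e ∈ (w.rotate a ha).edges → e ∈ w.edges := fun e he =>
    ((rotate_edges w a ha).mem_iff).1 he
  have hlen : (w.rotate a ha).length = w.length := by simp
  obtain ⟨q, r, hqr⟩ := mem_support_iff_exists_append.1 hb'
  rw [hqr] at hsub hedg hlen
  rw [length_append] at hlen
  simp only [mem_support_append_iff, edges_append, List.mem_append] at hsub hedg
  by_cases hc : q.length ≤ r.length
  · exact ⟨q, fun c hc => hsub c (Or.inl hc), fun c hc => hedg c (Or.inl hc), by omega⟩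
  · refine ⟨r.reverse, fun c hc => hsub c (Or.inr (by simpa using hc)),
      fun c hc => hedg c (Or.inr (by simpa using hc)), ?_⟩
    rw [length_reverse]
    omega

end SimpleGraph.Walk

namespace MemGFam

variable {G : SimpleGraph V} {l : ℕ} {x y : V}

theorem le_length (hG : MemGFam G l) {w : G.Walk x x} (hw : w.IsCycle) : 2 * l + 1 ≤ w.length :=
  hG.1 ▸ hw.girth_le_length

theorem length_eq (hG : MemGFam G l) {w : G.Walk x x} (hw : IsOddHole G w) :
    w.length = 2 * l + 1 := by
  have h1 := hG.le_length hw.1.1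
  have h2 := hG.2 _ w hw
  obtain ⟨k, hk⟩ := hw.2
  omega

theorem le_length_add (hG : MemGFam G l) {P W : G.Walk x y} (hP : P.IsPath)
    (h : (∃ a ∈ P.support, a ∉ W.support) ∨ ∃ e ∈ P.edges, e ∉ W.edges) :
    2 * l + 1 ≤ P.length + W.length := by
  classical
  have hne : P ≠ W.bypass := by
    rintro rfl
    rcases h with ⟨a, ha, hb⟩ | ⟨a, ha, hb⟩
    · exact hb (W.support_bypass_subset_support ha)
    · exact hb (W.edges_bypass_subset_edges ha)
  obtain ⟨_, _, _, w, hw, hl⟩ := hP.exists_isCycle_length_le_add_of_ne W.bypass_isPath hne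
  have := hG.le_length hw
  have := W.length_bypass_le_length
  omega

theorem isOddHole (hG : MemGFam G l) (hl : 2 ≤ l) {w : G.Walk x x} (hw : w.IsCycle)
    (hlen : w.length = 2 * l + 1) : IsOddHole G w := by
  classical
  refine ⟨⟨hw, by omega, fun a ha b hb hab => ?_⟩, l, hlen⟩
  by_contra hne
  obtain ⟨W, -, hW, hWl⟩ := w.exists_short_arc ha hb
  have := hG.le_length_add (P := hab.toWalk) (W := W) (.of_adj hab)
    (Or.inr ⟨s(a, b), by simp, fun h => hne (hW h)⟩)
  simp at this
  omega

end MemGFam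

namespace K4Sub

variable {G : SimpleGraph V} {l : ℕ}

/-- Arrises of `H` meet only in common branch vertices, opposite arrises have equal length,
and every face has length `2l+1`. -/
structure Tight (H : K4Sub G) (l : ℕ) : Prop where
  P1Q1 : ∀ a ∈ H.P1.support, a ∈ H.Q1.support → a = H.u2
  P1L1 : ∀ a ∈ H.P1.support, a ∈ H.L1.support → a = H.u1
  Q1L1 : ∀ a ∈ H.Q1.support, a ∈ H.L1.support → a = H.u3
  P1L2 : ∀ a ∈ H.P1.support, a ∈ H.L2.support → a = H.u2
  P1Q2 : ∀ a ∈ H.P1.support, a ∈ H.Q2.support → a = H.u1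
  L2Q2 : ∀ a ∈ H.L2.support, a ∈ H.Q2.support → a = H.u4
  Q1P2 : ∀ a ∈ H.Q1.support, a ∈ H.P2.support → a = H.u3
  Q1L2 : ∀ a ∈ H.Q1.support, a ∈ H.L2.support → a = H.u2
  P2L2 : ∀ a ∈ H.P2.support, a ∈ H.L2.support → a = H.u4
  L1P2 : ∀ a ∈ H.L1.support, a ∈ H.P2.support → a = H.u3
  L1Q2 : ∀ a ∈ H.L1.support, a ∈ H.Q2.support → a = H.u1
  P2Q2 : ∀ a ∈ H.P2.support, a ∈ H.Q2.support → a = H.u4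
  lenP : H.P2.length = H.P1.length
  lenQ : H.Q2.length = H.Q1.length
  lenL : H.L2.length = H.L1.length
  sum : H.P1.length + H.Q1.length + H.L1.length = 2 * l + 1

theorem branch_ne (H : K4Sub G) : H.u1 ≠ H.u2 ∧ H.u1 ≠ H.u3 ∧ H.u1 ≠ H.u4 ∧ H.u2 ≠ H.u3 ∧
    H.u2 ≠ H.u4 ∧ H.u3 ≠ H.u4 := by
  have := H.hu
  simp at this
  tauto

theorem tight_of_isOddK4 (hG : MemGFam G l) {H : K4Sub G} (h : IsOddK4 G H) : H.Tight l := by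
  obtain ⟨h12, h13, h14, h23, h24, h34⟩ := H.branch_ne
  obtain ⟨a1, a2, a3⟩ := Walk.inter_of_isCycle_triangle h12 h23 h13 h.1.1.1
  obtain ⟨b1, b2, b3⟩ := Walk.inter_of_isCycle_triangle h12 h24 h14 h.2.1.1.1
  obtain ⟨c1, c2, c3⟩ := Walk.inter_of_isCycle_triangle h23 h34 h24 h.2.2.1.1.1
  obtain ⟨d1, d2, d3⟩ := Walk.inter_of_isCycle_triangle h13 h34 h14 h.2.2.2.1.1
  have l1 := hG.length_eq h.1
  have l2 := hG.length_eq h.2.1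
  have l3 := hG.length_eq h.2.2.1
  have l4 := hG.length_eq h.2.2.2
  simp only [C1, C2, C3, C4, Walk.length_append, Walk.length_reverse] at l1 l2 l3 l4
  exact ⟨a1, a2, a3, b1, b2, b3, c1, c2, c3, d1, d2, d3, by omega, by omega, by omega, by omega⟩

theorem Tight.isOddK4 (hG : MemGFam G l) (hl : 2 ≤ l) {H : K4Sub G} (h : H.Tight l) :
    IsOddK4 G H := by
  obtain ⟨h12, h13, h14, h23, h24, h34⟩ := H.branch_ne
  have := h.lenP
  have := h.lenQ
  have := h.lenL
  have := h.sum
  refine ⟨hG.isOddHole hl (Walk.isCycle_triangle H.hP1 H.hQ1 H.hL1 h12 h23 h.P1Q1 h.P1L1 h.Q1L1) ?_,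
    hG.isOddHole hl (Walk.isCycle_triangle H.hP1 H.hL2 H.hQ2 h12 h24 h.P1L2 h.P1Q2 h.L2Q2) ?_,
    hG.isOddHole hl (Walk.isCycle_triangle H.hQ1 H.hP2 H.hL2 h23 h34 h.Q1P2 h.Q1L2 h.P2L2) ?_,
    hG.isOddHole hl (Walk.isCycle_triangle H.hL1 H.hP2 H.hQ2 h13 h34 h.L1P2 h.L1Q2 h.P2Q2) ?_⟩ <;>
  · simp only [C1, C2, C3, C4, Walk.length_append, Walk.length_reverse]
    omega

/-- Renaming of the branch vertices by `u1 → u2 → u3 → u1`. -/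
def rot (H : K4Sub G) : K4Sub G where
  u1 := H.u2
  u2 := H.u3
  u3 := H.u1
  u4 := H.u4
  P1 := H.Q1
  P2 := H.Q2
  Q1 := H.L1.reverse
  Q2 := H.L2
  L1 := H.P1.reverse
  L2 := H.P2
  hu := by
    obtain ⟨h12, h13, h14, h23, h24, h34⟩ := H.branch_ne
    simp [h12.symm, h13.symm, h14, h23, h24, h34]
  hP1 := H.hQ1
  hP2 := H.hQ2
  hQ1 := H.hL1.reverse
  hQ2 := H.hL2
  hL1 := H.hP1.reverse
  hL2 := H.hP2
  hP := H.hQ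
  hQ := by simpa using H.hL
  hL := by simpa using H.hP

/-- Renaming which exchanges `u1` and `u2`. -/
def swap12 (H : K4Sub G) : K4Sub G where
  u1 := H.u2
  u2 := H.u1
  u3 := H.u3
  u4 := H.u4
  P1 := H.P1.reverse
  P2 := H.P2
  Q1 := H.L1
  Q2 := H.L2
  L1 := H.Q1
  L2 := H.Q2
  hu := by
    obtain ⟨h12, h13, h14, h23, h24, h34⟩ := H.branch_ne
    simp [h12.symm, h13, h14, h23, h24, h34]
  hP1 := H.hP1.reverse
  hP2 := H.hP2
  hQ1 := H.hL1
  hQ2 := H.hL2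
  hL1 := H.hQ1
  hL2 := H.hQ2
  hP := by simpa using H.hP
  hQ := H.hL
  hL := H.hQ

/-- Renaming which exchanges `u3` and `u4`. -/
def swap34 (H : K4Sub G) : K4Sub G where
  u1 := H.u1
  u2 := H.u2
  u3 := H.u4
  u4 := H.u3
  P1 := H.P1
  P2 := H.P2.reverse
  Q1 := H.L2
  Q2 := H.L1
  L1 := H.Q2
  L2 := H.Q1
  hu := by
    obtain ⟨h12, h13, h14, h23, h24, h34⟩ := H.branch_ne
    simp [h12, h13, h14, h23, h24, h34.symm]
  hP1 := H.hP1
  hP2 := H.hP2.reverse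
  hQ1 := H.hL2
  hQ2 := H.hL1
  hL1 := H.hQ2
  hL2 := H.hQ1
  hP := by simpa using H.hP
  hQ := fun a ha hb => H.hL a hb ha
  hL := fun a ha hb => H.hQ a hb ha

theorem Tight.rot {H : K4Sub G} (h : H.Tight l) : H.rot.Tight l := by
  obtain ⟨P1Q1, P1L1, Q1L1, P1L2, P1Q2, L2Q2, Q1P2, Q1L2, P2L2, L1P2, L1Q2, P2Q2, p, q, r, s⟩ := h
  constructor <;> simp only [K4Sub.rot, Walk.support_reverse, List.mem_reverse, Walk.length_reverse]
  case sum => omega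
  all_goals first | assumption | (intro a ha hb; solve_by_elim)

theorem Tight.swap12 {H : K4Sub G} (h : H.Tight l) : H.swap12.Tight l := by
  obtain ⟨P1Q1, P1L1, Q1L1, P1L2, P1Q2, L2Q2, Q1P2, Q1L2, P2L2, L1P2, L1Q2, P2Q2, p, q, r, s⟩ := h
  constructor <;>
    simp only [K4Sub.swap12, Walk.support_reverse, List.mem_reverse, Walk.length_reverse]
  case sum => omega
  all_goals first | assumption | (intro a ha hb; solve_by_elim)

theorem Tight.swap34 {H : K4Sub G} (h : H.Tight l) : H.swap34.Tight l := by
  obtain ⟨P1Q1, P1L1, Q1L1, P1L2, P1Q2, L2Q2, Q1P2, Q1L2, P2L2, L1P2, L1Q2, P2Q2, p, q, r, s⟩ := h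
  constructor <;>
    simp only [K4Sub.swap34, Walk.support_reverse, List.mem_reverse, Walk.length_reverse]
  case sum => omega
  all_goals first | assumption | omega | (intro a ha hb; solve_by_elim)

theorem verts_rot (H : K4Sub G) : H.rot.verts = H.verts := by
  ext a
  simp only [verts, rot, Set.mem_ofPred_eq, Walk.support_reverse, List.mem_reverse]
  tauto

theorem verts_swap12 (H : K4Sub G) : H.swap12.verts = H.verts := by
  ext a
  simp only [verts, swap12, Set.mem_ofPred_eq, Walk.support_reverse, List.mem_reverse]
  tauto

theorem verts_swap34 (H : K4Sub G) : H.swap34.verts = H.verts := by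
  ext a
  simp only [verts, swap34, Set.mem_ofPred_eq, Walk.support_reverse, List.mem_reverse]
  tauto

theorem edges_rot (H : K4Sub G) : H.rot.edges = H.edges := by
  ext a
  simp only [edges, rot, Set.mem_ofPred_eq, Walk.edges_reverse, List.mem_reverse]
  tauto

theorem edges_swap12 (H : K4Sub G) : H.swap12.edges = H.edges := by
  ext a
  simp only [edges, swap12, Set.mem_ofPred_eq, Walk.edges_reverse, List.mem_reverse]
  tauto

theorem edges_swap34 (H : K4Sub G) : H.swap34.edges = H.edges := by
  ext a
  simp only [edges, swap34, Set.mem_ofPred_eq, Walk.edges_reverse, List.mem_reverse]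
  tauto

theorem wInterior_swap34 (H : K4Sub G) : wInterior H.swap34.P2 = wInterior H.P2 := by
  ext a
  simp only [wInterior, swap34, Set.mem_ofPred_eq, Walk.support_reverse, List.mem_reverse]
  tauto

theorem Tight.lt_add (hG : MemGFam G l) {H : K4Sub G} (h : H.Tight l) :
    l < H.P1.length + H.Q1.length := by
  obtain ⟨h12, h13, h14, h23, h24, h34⟩ := H.branch_ne
  have := hG.le_length_add (W := H.Q2.append H.P2.reverse) (H.hP1.append_of_inter H.hQ1 h.P1Q1)
    (Or.inl ⟨H.u2, by simp, fun hc => ?_⟩)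
  · simp only [Walk.length_append, Walk.length_reverse, h.lenP, h.lenQ] at this
    omega
  · rcases (Walk.mem_support_append_iff _ _).1 hc with hc | hc
    · exact h12 (h.P1Q2 _ (Walk.end_mem_support _) hc).symm
    · exact H.hP _ (Walk.end_mem_support _) (by simpa using hc)

theorem Tight.length_le (hG : MemGFam G l) {H : K4Sub G} (h : H.Tight l) :
    H.P1.length ≤ l ∧ H.Q1.length ≤ l ∧ H.L1.length ≤ l := by
  have h1 := h.lt_add hG
  have h2 := h.rot.lt_add hG
  have h3 := h.rot.rot.lt_add hG
  have h4 := h.sum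
  simp only [K4Sub.rot, Walk.length_reverse] at h2 h3
  omega

/-- `x` and `y` are joined by a walk of `H` of length at most `2l-2`. -/
def Close (H : K4Sub G) (l : ℕ) (x y : V) : Prop :=
  ∃ W : G.Walk x y, (∀ a ∈ W.support, a ∈ H.verts) ∧ (∀ e ∈ W.edges, e ∈ H.edges) ∧
    W.length + 2 ≤ 2 * l

theorem Close.symm {H : K4Sub G} {x y : V} (h : H.Close l x y) : H.Close l y x := by
  obtain ⟨W, h1, h2, h3⟩ := h
  exact ⟨W.reverse, by simpa using h1, by simpa using h2, by simpa using h3⟩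

theorem close_rot {H : K4Sub G} {x y : V} : H.rot.Close l x y ↔ H.Close l x y := by
  simp only [Close, verts_rot, edges_rot]

theorem close_of_mem_cycle {H : K4Sub G} (hl : 4 ≤ l) {v x y : V} (w : G.Walk v v)
    (hv : ∀ a ∈ w.support, a ∈ H.verts) (he : ∀ e ∈ w.edges, e ∈ H.edges)
    (hw : w.length = 2 * l + 1) (hx : x ∈ w.support) (hy : y ∈ w.support) : H.Close l x y := by
  classical
  obtain ⟨W, h1, h2, h3⟩ := w.exists_short_arc hx hy
  exact ⟨W, fun a ha => hv a (h1 ha), fun a ha => he a (h2 ha), by omega⟩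

theorem Tight.close_opposite (hG : MemGFam G l) (hl : 4 ≤ l) {H : K4Sub G} (h : H.Tight l)
    {x y : V} (hx : x ∈ H.P1.support) (hy : y ∈ H.P2.support) : H.Close l x y := by
  obtain ⟨A, B, hAB⟩ := Walk.mem_support_iff_exists_append.1 hx
  obtain ⟨C, D, hCD⟩ := Walk.mem_support_iff_exists_append.1 hy
  have h1 := congrArg Walk.length hAB
  have h2 := congrArg Walk.length hCD
  have h3 := h.length_le hG
  have h4 := h.sum
  have := h.lenP
  have := h.lenQ
  have := h.lenL
  have hv : ∀ a, (a ∈ A.support ∨ a ∈ B.support ∨ a ∈ C.support ∨ a ∈ D.support ∨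
      a ∈ H.Q1.support ∨ a ∈ H.Q2.support ∨ a ∈ H.L1.support ∨ a ∈ H.L2.support) →
      a ∈ H.verts := by
    intro a
    simp only [verts, hAB, hCD, Set.mem_ofPred_eq, Walk.mem_support_append_iff]
    tauto
  have he : ∀ a, (a ∈ A.edges ∨ a ∈ B.edges ∨ a ∈ C.edges ∨ a ∈ D.edges ∨
      a ∈ H.Q1.edges ∨ a ∈ H.Q2.edges ∨ a ∈ H.L1.edges ∨ a ∈ H.L2.edges) → a ∈ H.edges := by
    intro a
    simp only [edges, hAB, hCD, Set.mem_ofPred_eq, Walk.edges_append, List.mem_append]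
    tauto
  rw [Walk.length_append] at h1 h2
  have key : ∀ W : G.Walk x y, (∀ a ∈ W.support, a ∈ A.support ∨ a ∈ B.support ∨
      a ∈ C.support ∨ a ∈ D.support ∨ a ∈ H.Q1.support ∨ a ∈ H.Q2.support ∨ a ∈ H.L1.support ∨
      a ∈ H.L2.support) → (∀ a ∈ W.edges, a ∈ A.edges ∨ a ∈ B.edges ∨
      a ∈ C.edges ∨ a ∈ D.edges ∨ a ∈ H.Q1.edges ∨ a ∈ H.Q2.edges ∨ a ∈ H.L1.edges ∨
      a ∈ H.L2.edges) → W.length + 2 ≤ 2 * l → H.Close l x y := fun W p q r =>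
    ⟨W, fun a ha => hv a (p a ha), fun a ha => he a (q a ha), r⟩
  have hcase : A.length + H.L1.length + C.length + 2 ≤ 2 * l ∨
      A.length + H.Q2.length + D.length + 2 ≤ 2 * l ∨
      B.length + H.Q1.length + C.length + 2 ≤ 2 * l ∨
      B.length + H.L2.length + D.length + 2 ≤ 2 * l := by omega
  rcases hcase with hc | hc | hc | hc
  · refine key ((A.reverse.append H.L1).append C) ?_ ?_ ?_
    · intro a
      simp only [Walk.mem_support_append_iff, Walk.support_reverse, List.mem_reverse]
      tauto
    · intro a
      simp only [Walk.edges_append, Walk.edges_reverse, List.mem_append, List.mem_reverse]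
      tauto
    · simpa using hc
  · refine key ((A.reverse.append H.Q2).append D.reverse) ?_ ?_ ?_
    · intro a
      simp only [Walk.mem_support_append_iff, Walk.support_reverse, List.mem_reverse]
      tauto
    · intro a
      simp only [Walk.edges_append, Walk.edges_reverse, List.mem_append, List.mem_reverse]
      tauto
    · simpa using hc
  · refine key ((B.append H.Q1).append C) ?_ ?_ ?_
    · intro a; simp only [Walk.mem_support_append_iff]; tauto
    · intro a; simp only [Walk.edges_append, List.mem_append]; tauto
    · simpa using hc
  · refine key ((B.append H.L2).append D.reverse) ?_ ?_ ?_
    · intro a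
      simp only [Walk.mem_support_append_iff, Walk.support_reverse, List.mem_reverse]
      tauto
    · intro a
      simp only [Walk.edges_append, Walk.edges_reverse, List.mem_append, List.mem_reverse]
      tauto
    · simpa using hc

theorem support_C1_subset (H : K4Sub G) : ∀ a ∈ H.C1.support, a ∈ H.verts := by
  intro a ha
  simp only [C1, Walk.mem_support_append_iff, Walk.support_reverse, List.mem_reverse] at ha
  rcases ha with (ha | ha) | ha <;> simp only [verts, Set.mem_ofPred_eq, ha, true_or, or_true]

theorem edges_C1_subset (H : K4Sub G) : ∀ e ∈ H.C1.edges, e ∈ H.edges := by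
  intro a ha
  simp only [C1, Walk.edges_append, Walk.edges_reverse, List.mem_append, List.mem_reverse] at ha
  rcases ha with (ha | ha) | ha <;> simp only [edges, Set.mem_ofPred_eq, ha, true_or, or_true]

theorem support_C2_subset (H : K4Sub G) : ∀ a ∈ H.C2.support, a ∈ H.verts := by
  intro a ha
  simp only [C2, Walk.mem_support_append_iff, Walk.support_reverse, List.mem_reverse] at ha
  rcases ha with (ha | ha) | ha <;> simp only [verts, Set.mem_ofPred_eq, ha, true_or, or_true]

theorem edges_C2_subset (H : K4Sub G) : ∀ e ∈ H.C2.edges, e ∈ H.edges := by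
  intro a ha
  simp only [C2, Walk.edges_append, Walk.edges_reverse, List.mem_append, List.mem_reverse] at ha
  rcases ha with (ha | ha) | ha <;> simp only [edges, Set.mem_ofPred_eq, ha, true_or, or_true]

theorem support_C3_subset (H : K4Sub G) : ∀ a ∈ H.C3.support, a ∈ H.verts := by
  intro a ha
  simp only [C3, Walk.mem_support_append_iff, Walk.support_reverse, List.mem_reverse] at ha
  rcases ha with (ha | ha) | ha <;> simp only [verts, Set.mem_ofPred_eq, ha, true_or, or_true]

theorem edges_C3_subset (H : K4Sub G) : ∀ e ∈ H.C3.edges, e ∈ H.edges := by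
  intro a ha
  simp only [C3, Walk.edges_append, Walk.edges_reverse, List.mem_append, List.mem_reverse] at ha
  rcases ha with (ha | ha) | ha <;> simp only [edges, Set.mem_ofPred_eq, ha, true_or, or_true]

theorem support_C4_subset (H : K4Sub G) : ∀ a ∈ H.C4.support, a ∈ H.verts := by
  intro a ha
  simp only [C4, Walk.mem_support_append_iff, Walk.support_reverse, List.mem_reverse] at ha
  rcases ha with (ha | ha) | ha <;> simp only [verts, Set.mem_ofPred_eq, ha, true_or, or_true]

theorem edges_C4_subset (H : K4Sub G) : ∀ e ∈ H.C4.edges, e ∈ H.edges := by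
  intro a ha
  simp only [C4, Walk.edges_append, Walk.edges_reverse, List.mem_append, List.mem_reverse] at ha
  rcases ha with (ha | ha) | ha <;> simp only [edges, Set.mem_ofPred_eq, ha, true_or, or_true]

theorem Tight.close (hG : MemGFam G l) (hl : 4 ≤ l) {H : K4Sub G} (h : H.Tight l)
    {x y : V} (hx : x ∈ H.verts) (hy : y ∈ H.verts) : H.Close l x y := by
  have hodd := h.isOddK4 hG (by omega)
  have c1 := close_of_mem_cycle (x := x) (y := y) hl H.C1 H.support_C1_subset
    H.edges_C1_subset (hG.length_eq hodd.1)
  have c2 := close_of_mem_cycle (x := x) (y := y) hl H.C2 H.support_C2_subset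
    H.edges_C2_subset (hG.length_eq hodd.2.1)
  have c3 := close_of_mem_cycle (x := x) (y := y) hl H.C3 H.support_C3_subset
    H.edges_C3_subset (hG.length_eq hodd.2.2.1)
  have c4 := close_of_mem_cycle (x := x) (y := y) hl H.C4 H.support_C4_subset
    H.edges_C4_subset (hG.length_eq hodd.2.2.2)
  clear hodd
  simp only [C1, C2, C3, C4, Walk.mem_support_append_iff, Walk.support_reverse,
    List.mem_reverse] at c1 c2 c3 c4
  have o : ∀ a b, (a ∈ H.P1.support → b ∈ H.P2.support → H.Close l a b) ∧
      (a ∈ H.Q1.support → b ∈ H.Q2.support → H.Close l a b) ∧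
      (a ∈ H.L1.support → b ∈ H.L2.support → H.Close l a b) := fun a b =>
    ⟨fun ha hb => h.close_opposite hG hl ha hb,
      fun ha hb => close_rot.1 (h.rot.close_opposite hG hl ha hb),
      fun ha hb => close_rot.1 (close_rot.1 (h.rot.rot.close_opposite hG hl
        (by simpa [K4Sub.rot] using ha) hb))⟩
  obtain ⟨o1, o2, o3⟩ := o x y
  obtain ⟨o4, o5, o6⟩ := o y x
  rcases hx with hx | hx | hx | hx | hx | hx <;> rcases hy with hy | hy | hy | hy | hy | hy <;>
    first
    | exact c1 (by simp only [hx, true_or, or_true]) (by simp only [hy, true_or, or_true])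
    | exact c2 (by simp only [hx, true_or, or_true]) (by simp only [hy, true_or, or_true])
    | exact c3 (by simp only [hx, true_or, or_true]) (by simp only [hy, true_or, or_true])
    | exact c4 (by simp only [hx, true_or, or_true]) (by simp only [hy, true_or, or_true])
    | exact o1 hx hy
    | exact o2 hx hy
    | exact o3 hx hy
    | exact (o4 hy hx).symm
    | exact (o5 hy hx).symm
    | exact (o6 hy hx).symm

theorem Tight.mem_edges (hG : MemGFam G l) (hl : 4 ≤ l) {H : K4Sub G} (h : H.Tight l)
    {x y : V} (hx : x ∈ H.verts) (hy : y ∈ H.verts) (hxy : G.Adj x y) : s(x, y) ∈ H.edges := by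
  obtain ⟨W, -, h2, h3⟩ := h.close hG hl hx hy
  by_contra hc
  have := hG.le_length_add (P := hxy.toWalk) (W := W) (.of_adj hxy)
    (Or.inr ⟨s(x, y), by simp, fun hh => hc (h2 _ hh)⟩)
  simp at this
  omega

theorem Tight.eq_of_adj (hG : MemGFam G l) (hl : 4 ≤ l) {H : K4Sub G} (h : H.Tight l)
    {v x y : V} (hv : v ∉ H.verts) (hx : x ∈ H.verts) (hy : y ∈ H.verts) (hvx : G.Adj v x)
    (hvy : G.Adj v y) : x = y := by
  obtain ⟨W, h1, -, h3⟩ := h.close hG hl hx hy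
  by_contra hc
  have := hG.le_length_add (P := (Walk.nil.cons hvy).cons hvx.symm) (W := W)
    (by simp [hvy.ne, hvx.ne', hc]) (Or.inl ⟨v, by simp, fun hh => hv (h1 _ hh)⟩)
  simp at this
  omega

/-- The bounds on the length `k` of an induced ear of `H` from `x` to `y` which are imposed
by the girth and by the absence of long odd holes. -/
structure Ear (H : K4Sub G) (l k : ℕ) (x y : V) : Prop where
  eq_of_odd : ∀ A : G.Walk x y, A.IsPath → (∀ a ∈ A.support, a ∈ H.verts) →
    (∀ a ∈ A.support, ∀ b ∈ A.support, s(a, b) ∈ H.edges → s(a, b) ∈ A.edges) →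
    Odd (A.length + k) → A.length + k = 2 * l + 1
  le : ∀ A : G.Walk x y, (∀ a ∈ A.support, a ∈ H.verts) → 2 * l + 1 ≤ A.length + k

theorem Ear.swap12 {H : K4Sub G} {k : ℕ} {x y : V} (h : H.Ear l k x y) :
    H.swap12.Ear l k x y := by
  constructor
  · rw [verts_swap12, edges_swap12]
    exact h.1
  · rw [verts_swap12]
    exact h.2

theorem Ear.swap34 {H : K4Sub G} {k : ℕ} {x y : V} (h : H.Ear l k x y) :
    H.swap34.Ear l k x y := by
  constructor
  · rw [verts_swap34, edges_swap34]
    exact h.1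
  · rw [verts_swap34]
    exact h.2

theorem Tight.ear (hG : MemGFam G l) (hl : 4 ≤ l) {H : K4Sub G} (h : H.Tight l) {x y : V}
    {R : G.Walk x y} (hR : R.IsPath) (hlen : 2 ≤ R.length)
    (hRH : ∀ a ∈ R.support, a ∈ H.verts → a = x ∨ a = y)
    (hRR : ∀ a ∈ R.support, a ∉ H.verts → ∀ b, b ∈ R.support ∨ b ∈ H.verts →
      G.Adj a b → s(a, b) ∈ R.edges) : H.Ear l R.length x y := by
  constructor
  · intro A hA hAv hAe hodd
    have hcyc : (A.append R.reverse).IsCycle :=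
      Walk.isCycle_append_reverse hA hR (fun a ha hb => hRH a hb (hAv a ha)) (Or.inr (by omega))
    have hl' := hG.le_length hcyc
    have hhole : IsOddHole G (A.append R.reverse) := by
      refine ⟨⟨hcyc, by omega, fun a ha b hb hab => ?_⟩, by simpa using hodd⟩
      simp only [Walk.mem_support_append_iff, Walk.support_reverse, List.mem_reverse] at ha hb
      simp only [Walk.edges_append, Walk.edges_reverse, List.mem_append, List.mem_reverse]
      by_cases hav : a ∈ H.verts
      · by_cases hbv : b ∈ H.verts
        · have hmem : ∀ c, c ∈ A.support ∨ c ∈ R.support → c ∈ H.verts → c ∈ A.support := by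
            rintro c (hc | hc) hcv
            · exact hc
            · rcases hRH c hc hcv with rfl | rfl <;> simp
          exact Or.inl (hAe a (hmem a ha hav) b (hmem b hb hbv) (h.mem_edges hG hl hav hbv hab))
        · right
          rw [Sym2.eq_swap]
          exact hRR b (hb.resolve_left fun hc => hbv (hAv b hc)) hbv a (Or.inr hav) hab.symm
      · right
        exact hRR a (ha.resolve_left fun hc => hav (hAv a hc)) hav b
          (hb.symm.imp id fun hc => hAv b hc) hab
    simpa using hG.length_eq hhole
  · intro A hAv
    have : ∃ a ∈ R.support, a ∉ A.support := by
      have h1 : R.getVert 1 ∈ R.support := R.getVert_mem_support 1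
      refine ⟨R.getVert 1, h1, fun hc => ?_⟩
      rcases hRH _ h1 (hAv _ hc) with hx | hy
      · rw [hR.getVert_eq_start_iff (by omega)] at hx
        omega
      · rw [hR.getVert_eq_end_iff (by omega)] at hy
        omega
    have := hG.le_length_add hR (Or.inl this)
    omega

theorem Tight.ear_across_P1 {H : K4Sub G} (h : H.Tight l) {k : ℕ} {x y : V}
    (hx : x ∈ wInterior H.P1) (hy : y ∈ wInterior H.P2) (hE : H.Ear l k x y)
    {A : G.Walk H.u1 x} {B : G.Walk x H.u2} {C : G.Walk H.u3 y} {D : G.Walk y H.u4}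
    (hAB : H.P1 = A.append B) (hCD : H.P2 = C.append D)
    (hodd : Odd (A.length + H.L1.length + C.length + k)) :
    A.length + H.L1.length + C.length + k = 2 * l + 1 := by
  obtain ⟨-, hx1, hx2⟩ := hx
  obtain ⟨-, hy1, hy2⟩ := hy
  have hPP := H.hP
  have hQQ := H.hQ
  have hLL := H.hL
  have hP1 := H.hP1
  have hP2 := H.hP2
  obtain ⟨P1Q1, P1L1, Q1L1, P1L2, P1Q2, L2Q2, Q1P2, Q1L2, P2L2, L1P2, L1Q2, P2Q2, -⟩ := h
  simp only [hAB, hCD, Walk.mem_support_append_iff]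
    at hPP hP1 hP2 P1Q1 P1L1 P1L2 P1Q2 Q1P2 P2L2 L1P2 P2Q2
  have hAiB := fun a => hP1.eq_of_mem_append (a := a)
  have hCiD := fun a => hP2.eq_of_mem_append (a := a)
  have e1 := A.start_mem_support
  have e2 := B.end_mem_support
  have e3 := C.start_mem_support
  have e4 := D.end_mem_support
  have e5 := H.L1.start_mem_support
  have e6 := H.L1.end_mem_support
  have hmem : ∀ a, a ∈ ((A.reverse.append H.L1).append C).support ↔
      (a ∈ A.support ∨ a ∈ H.L1.support) ∨ a ∈ C.support := by simp
  have key := hE.eq_of_odd ((A.reverse.append H.L1).append C) ?_ ?_ ?_ ?_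
  · simpa using key
  · refine Walk.IsPath.append_of_inter (Walk.IsPath.append_of_inter hP1.of_append_left.reverse
      H.hL1 ?_) hP2.of_append_left ?_
    · intro a; simp; grind
    · intro a; simp; grind
  · intro a ha
    rw [hmem] at ha
    simp only [verts, hAB, hCD, Set.mem_ofPred_eq, Walk.mem_support_append_iff]
    tauto
  · intro a ha b hb hab
    rw [hmem] at ha hb
    simp only [Walk.edges_append, Walk.edges_reverse, List.mem_append, List.mem_reverse]
    simp only [edges, hAB, hCD, Set.mem_ofPred_eq, Walk.edges_append, List.mem_append] at hab
    rcases hab with (hab | hab) | (hab | hab) | hab | hab | hab | hab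
    case inl.inl => simp [hab]
    case inr.inl.inl => simp [hab]
    case inr.inr.inr.inr.inl => simp [hab]
    all_goals
      exfalso
      have f1 := Walk.fst_mem_support_of_mem_edges _ hab
      have f2 := Walk.snd_mem_support_of_mem_edges _ hab
      have f3 := (Walk.adj_of_mem_edges _ hab).ne
      clear hab
      grind
  · simpa using hodd

theorem not_mem_edges_of_inter {S : List V} {u v a b : V} {W : G.Walk u v} (p q : V)
    (hW : ∀ c ∈ W.support, c ∈ S → c = p ∨ c = q) (hpq : s(p, q) ∉ W.edges) (ha : a ∈ S)
    (hb : b ∈ S) : s(a, b) ∉ W.edges := by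
  intro hc
  have hne := (W.adj_of_mem_edges hc).ne
  rcases hW a (W.fst_mem_support_of_mem_edges hc) ha with rfl | rfl <;>
    rcases hW b (W.snd_mem_support_of_mem_edges hc) hb with rfl | rfl
  · exact hne rfl
  · exact hpq hc
  · exact hpq (Sym2.eq_swap ▸ hc)
  · exact hne rfl

theorem not_mem_edges_of_inter_eq {S : List V} {u v a b : V} {W : G.Walk u v} (p : V)
    (hW : ∀ c ∈ W.support, c ∈ S → c = p) (ha : a ∈ S) (hb : b ∈ S) : s(a, b) ∉ W.edges :=
  not_mem_edges_of_inter p p (fun c hc hS => Or.inl (hW c hc hS))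
    (fun hc => (W.adj_of_mem_edges hc).ne rfl) ha hb

set_option maxHeartbeats 1000000 in
theorem Tight.ear_from_Q1 {H : K4Sub G} (h : H.Tight l) {k : ℕ} {x y : V}
    (hL : 2 ≤ H.L1.length)
    (hy : y ∈ wInterior H.P2) (hE : H.Ear l k x y)
    {A : G.Walk H.u2 x} {B : G.Walk x H.u3} {C : G.Walk H.u3 y} {D : G.Walk y H.u4}
    (hAB : H.Q1 = A.append B) (hCD : H.P2 = C.append D) :
    (Odd (B.length + C.length + k) → B.length + C.length + k = 2 * l + 1) ∧
    (2 ≤ B.length + C.length → Odd (A.length + H.L2.length + D.length + k) →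
      A.length + H.L2.length + D.length + k = 2 * l + 1) ∧
    (2 ≤ B.length → Odd (A.length + H.P1.length + H.L1.length + C.length + k) →
      A.length + H.P1.length + H.L1.length + C.length + k = 2 * l + 1) ∧
    (2 ≤ B.length + C.length → Odd (A.length + H.P1.length + H.Q2.length + D.length + k) →
      A.length + H.P1.length + H.Q2.length + D.length + k = 2 * l + 1) := by
  obtain ⟨-, hy1, hy2⟩ := hy
  have hPP := H.hP
  have hQQ := H.hQ
  have hLL := H.hL
  have hQ1 := H.hQ1
  have hP2 := H.hP2
  have hP1 := H.hP1
  have hL1 := H.hL1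
  have hL2 := H.hL2
  have hQ2 := H.hQ2
  have nL1 : s(H.u1, H.u3) ∉ H.L1.edges := fun hc => by
    have := hL1.length_eq_one_of_mem_edges hc; omega
  have nL2 : s(H.u2, H.u4) ∉ H.L2.edges := fun hc => by
    have := hL2.length_eq_one_of_mem_edges hc
    have := h.lenL
    omega
  obtain ⟨h12, h13, h14, h23, h24, h34⟩ := H.branch_ne
  obtain ⟨P1Q1, P1L1, Q1L1, P1L2, P1Q2, L2Q2, Q1P2, Q1L2, P2L2, L1P2, L1Q2, P2Q2, -⟩ := h
  have e1 := A.start_mem_support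
  have e2 := B.end_mem_support
  have e3 := C.start_mem_support
  have e4 := D.end_mem_support
  have e5 := B.start_mem_support
  have e6 := D.start_mem_support
  have hV : ∀ a, (a ∈ A.support ∨ a ∈ B.support ∨ a ∈ C.support ∨ a ∈ D.support ∨
      a ∈ H.P1.support ∨ a ∈ H.Q2.support ∨ a ∈ H.L1.support ∨ a ∈ H.L2.support) →
      a ∈ H.verts := by
    intro a
    simp only [verts, hAB, hCD, Set.mem_ofPred_eq, Walk.mem_support_append_iff]
    tauto
  have hEd : ∀ a, a ∈ H.edges → (a ∈ A.edges ∨ a ∈ B.edges ∨ a ∈ C.edges ∨ a ∈ D.edges ∨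
      a ∈ H.P1.edges ∨ a ∈ H.Q2.edges ∨ a ∈ H.L1.edges ∨ a ∈ H.L2.edges) := by
    intro a
    simp only [edges, hAB, hCD, Set.mem_ofPred_eq, Walk.edges_append, List.mem_append]
    tauto
  simp only [hAB, hCD, Walk.mem_support_append_iff]
    at hPP hQQ hQ1 hP2 P1Q1 Q1L1 Q1P2 Q1L2 P2L2 L1P2 P2Q2
  have hAiB := fun a => hQ1.eq_of_mem_append (a := a)
  have hCiD := fun a => hP2.eq_of_mem_append (a := a)
  have hA := hQ1.of_append_left
  have hB := hQ1.of_append_right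
  have hC := hP2.of_append_left
  have hD := hP2.of_append_right
  have u1P := H.P1.start_mem_support
  have u2P := H.P1.end_mem_support
  have u1L := H.L1.start_mem_support
  have u3L := H.L1.end_mem_support
  have u2L := H.L2.start_mem_support
  have u4L := H.L2.end_mem_support
  have u1Q := H.Q2.start_mem_support
  have u4Q := H.Q2.end_mem_support
  have nC : 2 ≤ B.length + C.length → H.u3 ∈ A.support → s(H.u3, y) ∉ C.edges := fun hs hc hc' => by
    have := hB.nil_iff_eq.2 (hAiB _ hc e2).symm
    rw [← Walk.length_eq_zero_iff] at this
    have := hC.length_eq_one_of_mem_edges hc'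
    omega
  refine ⟨fun hodd => ?_, fun hs hodd => ?_, fun hs hodd => ?_, fun hs hodd => ?_⟩
  · have hmem : ∀ a, a ∈ (B.append C).support ↔
        a ∈ B.support ∨ a ∈ C.support := by simp
    have key := hE.eq_of_odd (B.append C) ?_ ?_ ?_ ?_
    · simpa using key
    · refine Walk.IsPath.append_of_inter hB hC ?_
      all_goals
        intro a h1 h2
        clear hodd
        grind
    · intro a ha
      rw [hmem] at ha
      exact hV a (by tauto)
    · intro a ha b hb hab
      rcases hEd _ hab with hab | hab | hab | hab | hab | hab | hab | hab
      · refine (not_mem_edges_of_inter_eq x ?_ ha hb hab).elim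
        intro c h1 h2
        rw [hmem] at h2
        clear hodd
        grind
      · simp only [Walk.edges_append, List.mem_append]
        tauto
      · simp only [Walk.edges_append, List.mem_append]
        tauto
      · refine (not_mem_edges_of_inter_eq y ?_ ha hb hab).elim
        intro c h1 h2
        rw [hmem] at h2
        clear hodd
        grind
      · refine (not_mem_edges_of_inter_eq H.u2 ?_ ha hb hab).elim
        intro c h1 h2
        rw [hmem] at h2
        clear hodd
        grind
      · refine (not_mem_edges_of_inter_eq H.u1 ?_ ha hb hab).elim
        intro c h1 h2
        rw [hmem] at h2
        clear hodd
        grind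
      · refine (not_mem_edges_of_inter_eq H.u3 ?_ ha hb hab).elim
        intro c h1 h2
        rw [hmem] at h2
        clear hodd
        grind
      · refine (not_mem_edges_of_inter_eq H.u2 ?_ ha hb hab).elim
        intro c h1 h2
        rw [hmem] at h2
        clear hodd
        grind
    · simpa using hodd
  · have hmem : ∀ a, a ∈ ((A.reverse.append H.L2).append D.reverse).support ↔
        (a ∈ A.support ∨ a ∈ H.L2.support) ∨ a ∈ D.support := by simp
    have key := hE.eq_of_odd ((A.reverse.append H.L2).append D.reverse) ?_ ?_ ?_ ?_
    · simpa using key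
    · refine Walk.IsPath.append_of_inter (Walk.IsPath.append_of_inter hA.reverse hL2 ?_)
          hD.reverse ?_
      all_goals
        intro a h1 h2
        simp only [Walk.mem_support_append_iff, Walk.support_reverse, List.mem_reverse] at h1 h2
        clear hodd
        grind
    · intro a ha
      rw [hmem] at ha
      exact hV a (by tauto)
    · intro a ha b hb hab
      rcases hEd _ hab with hab | hab | hab | hab | hab | hab | hab | hab
      · simp only [Walk.edges_append, Walk.edges_reverse, List.mem_append, List.mem_reverse]
        tauto
      · refine (not_mem_edges_of_inter_eq x ?_ ha hb hab).elim
        intro c h1 h2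
        rw [hmem] at h2
        clear hodd
        grind
      · by_cases hc3 : H.u3 ∈ A.support
        · refine (not_mem_edges_of_inter H.u3 y ?_ (nC hs hc3) ha hb hab).elim
          intro c h1 h2
          rw [hmem] at h2
          clear hodd
          grind
        · refine (not_mem_edges_of_inter_eq y ?_ ha hb hab).elim
          intro c h1 h2
          rw [hmem] at h2
          clear hodd
          grind
      · simp only [Walk.edges_append, Walk.edges_reverse, List.mem_append, List.mem_reverse]
        tauto
      · refine (not_mem_edges_of_inter_eq H.u2 ?_ ha hb hab).elim
        intro c h1 h2
        rw [hmem] at h2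
        clear hodd
        grind
      · refine (not_mem_edges_of_inter_eq H.u4 ?_ ha hb hab).elim
        intro c h1 h2
        rw [hmem] at h2
        clear hodd
        grind
      · refine (not_mem_edges_of_inter_eq H.u3 ?_ ha hb hab).elim
        intro c h1 h2
        rw [hmem] at h2
        clear hodd
        grind
      · simp only [Walk.edges_append, Walk.edges_reverse, List.mem_append, List.mem_reverse]
        tauto
    · simpa using hodd
  · have hmem : ∀ a, a ∈ (((A.reverse.append H.P1.reverse).append H.L1).append C).support ↔
        ((a ∈ A.support ∨ a ∈ H.P1.support) ∨ a ∈ H.L1.support) ∨ a ∈ C.support := by simp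
    have nB : s(x, H.u3) ∉ B.edges := fun hc => by
      have := hB.length_eq_one_of_mem_edges hc; omega
    have hx3 : H.u3 ∉ A.support := fun hc => by
      have := hB.nil_iff_eq.2 (hAiB _ hc e2).symm
      rw [← Walk.length_eq_zero_iff] at this
      omega
    have key := hE.eq_of_odd (((A.reverse.append H.P1.reverse).append H.L1).append C) ?_ ?_ ?_ ?_
    · simpa using key
    · refine Walk.IsPath.append_of_inter (Walk.IsPath.append_of_inter (Walk.IsPath.append_of_inter
        hA.reverse hP1.reverse ?_) hL1 ?_) hC ?_
      all_goals
        intro a h1 h2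
        simp only [Walk.mem_support_append_iff, Walk.support_reverse, List.mem_reverse] at h1 h2
        clear hodd
        grind
    · intro a ha
      rw [hmem] at ha
      exact hV a (by tauto)
    · intro a ha b hb hab
      rcases hEd _ hab with hab | hab | hab | hab | hab | hab | hab | hab
      · simp only [Walk.edges_append, Walk.edges_reverse, List.mem_append, List.mem_reverse]
        tauto
      · refine (not_mem_edges_of_inter x H.u3 ?_ nB ha hb hab).elim
        intro c h1 h2
        rw [hmem] at h2
        clear hodd
        grind
      · simp only [Walk.edges_append, Walk.edges_reverse, List.mem_append, List.mem_reverse]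
        tauto
      · refine (not_mem_edges_of_inter_eq y ?_ ha hb hab).elim
        intro c h1 h2
        rw [hmem] at h2
        clear hodd
        grind
      · simp only [Walk.edges_append, Walk.edges_reverse, List.mem_append, List.mem_reverse]
        tauto
      · refine (not_mem_edges_of_inter_eq H.u1 ?_ ha hb hab).elim
        intro c h1 h2
        rw [hmem] at h2
        clear hodd
        grind
      · simp only [Walk.edges_append, Walk.edges_reverse, List.mem_append, List.mem_reverse]
        tauto
      · refine (not_mem_edges_of_inter_eq H.u2 ?_ ha hb hab).elim
        intro c h1 h2
        rw [hmem] at h2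
        clear hodd
        grind
    · simpa using hodd
  · have hmem : ∀ a, a ∈ (((A.reverse.append H.P1.reverse).append H.Q2).append D.reverse).support ↔
        ((a ∈ A.support ∨ a ∈ H.P1.support) ∨ a ∈ H.Q2.support) ∨ a ∈ D.support := by simp
    have key := hE.eq_of_odd (((A.reverse.append H.P1.reverse).append H.Q2).append D.reverse)
      ?_ ?_ ?_ ?_
    · simpa using key
    · refine Walk.IsPath.append_of_inter (Walk.IsPath.append_of_inter (Walk.IsPath.append_of_inter
        hA.reverse hP1.reverse ?_) hQ2 ?_) hD.reverse ?_
      all_goals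
        intro a h1 h2
        simp only [Walk.mem_support_append_iff, Walk.support_reverse, List.mem_reverse] at h1 h2
        clear hodd
        grind
    · intro a ha
      rw [hmem] at ha
      exact hV a (by tauto)
    · intro a ha b hb hab
      rcases hEd _ hab with hab | hab | hab | hab | hab | hab | hab | hab
      · simp only [Walk.edges_append, Walk.edges_reverse, List.mem_append, List.mem_reverse]
        tauto
      · refine (not_mem_edges_of_inter_eq x ?_ ha hb hab).elim
        intro c h1 h2
        rw [hmem] at h2
        clear hodd
        grind
      · by_cases hc3 : H.u3 ∈ A.support
        · refine (not_mem_edges_of_inter H.u3 y ?_ (nC hs hc3) ha hb hab).elim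
          intro c h1 h2
          rw [hmem] at h2
          clear hodd
          grind
        · refine (not_mem_edges_of_inter_eq y ?_ ha hb hab).elim
          intro c h1 h2
          rw [hmem] at h2
          clear hodd
          grind
      · simp only [Walk.edges_append, Walk.edges_reverse, List.mem_append, List.mem_reverse]
        tauto
      · simp only [Walk.edges_append, Walk.edges_reverse, List.mem_append, List.mem_reverse]
        tauto
      · simp only [Walk.edges_append, Walk.edges_reverse, List.mem_append, List.mem_reverse]
        tauto
      · refine (not_mem_edges_of_inter H.u1 H.u3 ?_ nL1 ha hb hab).elim
        intro c h1 h2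
        rw [hmem] at h2
        clear hodd
        grind
      · refine (not_mem_edges_of_inter H.u2 H.u4 ?_ nL2 ha hb hab).elim
        intro c h1 h2
        rw [hmem] at h2
        clear hodd
        grind
    · simpa using hodd

theorem Tight.eq_u3_of_mem_Q1 (hG : MemGFam G l) {H : K4Sub G} (h : H.Tight l) {k : ℕ} {x y : V}
    (hL : 2 ≤ H.L1.length) (hx : x ∈ H.Q1.support) (hy : y ∈ wInterior H.P2)
    (hE : H.Ear l k x y) : x = H.u3 ∧ G.Adj H.u3 y := by
  obtain ⟨A, B, hAB⟩ := Walk.mem_support_iff_exists_append.1 hx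
  obtain ⟨C, D, hCD⟩ := Walk.mem_support_iff_exists_append.1 hy.1
  obtain ⟨h1, h2, h3, h4⟩ := h.ear_from_Q1 hL hy hE hAB hCD
  have hle := hE.le (B.append C) fun a ha => by
    rw [Walk.mem_support_append_iff] at ha
    simp only [verts, hAB, hCD, Set.mem_ofPred_eq, Walk.mem_support_append_iff]
    tauto
  have hQ := congrArg Walk.length hAB
  have hP := congrArg Walk.length hCD
  rw [Walk.length_append] at hQ hP hle
  have hC : C.length ≠ 0 := fun hc => hy.2.1 (Walk.eq_of_length_eq_zero hc).symm
  have hD : D.length ≠ 0 := fun hc => hy.2.2 (Walk.eq_of_length_eq_zero hc)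
  obtain ⟨-, -, -, -, -, -, -, -, -, -, -, -, lenP, lenQ, lenL, sum⟩ := id h
  have hmax := h.length_le hG
  have hshort : B.length + C.length < 2 := by
    by_contra hlong
    rw [not_lt] at hlong
    rcases Nat.even_or_odd (B.length + C.length + k) with hpar | hpar
    · have e2 := h2 hlong (by rw [Nat.odd_iff]; rw [Nat.even_iff] at hpar; omega)
      by_cases hB : 2 ≤ B.length
      · have e3 := h3 hB (by rw [Nat.odd_iff]; rw [Nat.even_iff] at hpar; omega)
        omega
      · omega
    · have e1 := h1 hpar
      have e4 := h4 hlong (by rw [Nat.odd_iff] at hpar ⊢; omega)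
      omega
  exact ⟨Walk.eq_of_length_eq_zero (p := B) (by omega),
    Walk.adj_of_length_eq_one (p := C) (by omega)⟩

theorem Tight.exists_shorter_of_odd {H : K4Sub G} (h : H.Tight l) {x y : V}
    (hx : x ∈ wInterior H.P1) (hy : y ∈ wInterior H.P2) {R : G.Walk x y} (hR : R.IsPath)
    (hRH : ∀ a ∈ R.support, a ∈ H.verts → a = x ∨ a = y) (hE : H.Ear l R.length x y)
    {A : G.Walk H.u1 x} {B : G.Walk x H.u2} {C : G.Walk H.u3 y} {D : G.Walk y H.u4}
    (hAB : H.P1 = A.append B) (hCD : H.P2 = C.append D)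
    (hodd : Odd (A.length + H.L1.length + C.length + R.length)) :
    ∃ H' : K4Sub G, H'.Tight l ∧ H'.P1.length < H.P1.length := by
  have hP := congrArg Walk.length hAB
  have hP' := congrArg Walk.length hCD
  rw [Walk.length_append] at hP hP'
  have hB : B.length ≠ 0 := fun hc => hx.2.2 (Walk.eq_of_length_eq_zero hc)
  have e1 := h.ear_across_P1 hx hy hE hAB hCD hodd
  have lens : H.P2.length = H.P1.length ∧ H.Q2.length = H.Q1.length ∧
    H.L2.length = H.L1.length ∧ H.P1.length + H.Q1.length + H.L1.length = 2 * l + 1 :=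
    ⟨h.lenP, h.lenQ, h.lenL, h.sum⟩
  obtain ⟨lenP, lenQ, lenL, sum⟩ := lens
  have e2 : B.length + H.L2.length + D.length + R.length = 2 * l + 1 := by
    have := h.swap12.swap34.ear_across_P1 (A := B.reverse) (B := A.reverse) (C := D.reverse)
      (D := C.reverse) (x := x) (y := y) (k := R.length)
      (by simpa [wInterior, K4Sub.swap12, K4Sub.swap34, and_comm, and_left_comm] using hx)
      (by simpa [wInterior, K4Sub.swap12, K4Sub.swap34, and_comm, and_left_comm] using hy)
      hE.swap12.swap34
      (by simp [K4Sub.swap12, K4Sub.swap34, hAB]) (by simp [K4Sub.swap12, K4Sub.swap34, hCD])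
    simp only [Walk.length_reverse, K4Sub.swap12, K4Sub.swap34] at this
    refine this ?_
    rw [Nat.odd_iff] at hodd ⊢
    omega
  obtain ⟨-, hx1, hx2⟩ := hx
  obtain ⟨-, hy1, hy2⟩ := hy
  have hPP := H.hP
  have hQQ := H.hQ
  have hLL := H.hL
  have hP1 := H.hP1
  have hP2 := H.hP2
  obtain ⟨h12, h13, h14, h23, h24, h34⟩ := H.branch_ne
  obtain ⟨P1Q1, P1L1, Q1L1, P1L2, P1Q2, L2Q2, Q1P2, Q1L2, P2L2, L1P2, L1Q2, P2Q2, -⟩ := h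
  have hV : ∀ a ∈ R.support, (a ∈ A.support ∨ a ∈ B.support ∨ a ∈ C.support ∨ a ∈ D.support ∨
      a ∈ H.Q2.support ∨ a ∈ H.L1.support ∨ a ∈ H.L2.support) → a = x ∨ a = y := by
    intro a ha
    have := hRH a ha
    simp only [verts, hAB, hCD, Set.mem_ofPred_eq, Walk.mem_support_append_iff] at this
    tauto
  have b1 := A.start_mem_support
  have b2 := B.end_mem_support
  have b3 := C.start_mem_support
  have b4 := D.end_mem_support
  have b5 := A.end_mem_support
  have b6 := B.start_mem_support
  have b7 := C.end_mem_support
  have b8 := D.start_mem_support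
  simp only [hAB, hCD, Walk.mem_support_append_iff] at hPP hP1 hP2 P1Q1 P1L1 P1L2 P1Q2
  simp only [hCD, Walk.mem_support_append_iff] at Q1P2 P2L2 L1P2 P2Q2
  have hAiB := fun a => hP1.eq_of_mem_append (a := a)
  have hCiD := fun a => hP2.eq_of_mem_append (a := a)
  have u1L := H.L1.start_mem_support
  have u3L := H.L1.end_mem_support
  have u2L := H.L2.start_mem_support
  have u4L := H.L2.end_mem_support
  have u1Q := H.Q2.start_mem_support
  have u4Q := H.Q2.end_mem_support
  clear hodd hRH hE
  refine ⟨⟨x, H.u1, y, H.u4, A.reverse, D, H.L1.append C, B.append H.L2, R, H.Q2, ?_,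
    hP1.of_append_left.reverse, hP2.of_append_right,
    H.hL1.append_of_inter hP2.of_append_left ?_, hP1.of_append_right.append_of_inter H.hL2 ?_,
    hR, H.hQ2, ?_, ?_, ?_⟩, ⟨?_, ?_, ?_, ?_, ?_, ?_, ?_, ?_, ?_, ?_, ?_, ?_, ?_, ?_, ?_, ?_⟩, ?_⟩
  case refine_1 =>
    simp only [List.nodup_cons, List.mem_cons, List.not_mem_nil, List.nodup_nil]
    grind
  all_goals
    try simp only [Walk.mem_support_append_iff, Walk.support_reverse, List.mem_reverse,
      Walk.length_append, Walk.length_reverse]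
    first
    | omega
    | clear e1 e2 lenP lenQ lenL sum hP hP' hB
      intro a ha hb
      grind

theorem Tight.exists_shorter {H : K4Sub G} (h : H.Tight l) {x y : V}
    (hx : x ∈ wInterior H.P1) (hy : y ∈ wInterior H.P2) {R : G.Walk x y} (hR : R.IsPath)
    (hRH : ∀ a ∈ R.support, a ∈ H.verts → a = x ∨ a = y) (hE : H.Ear l R.length x y) :
    ∃ H' : K4Sub G, H'.Tight l ∧ H'.P1.length < H.P1.length := by
  obtain ⟨A, B, hAB⟩ := Walk.mem_support_iff_exists_append.1 hx.1
  obtain ⟨C, D, hCD⟩ := Walk.mem_support_iff_exists_append.1 hy.1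
  rcases Nat.even_or_odd (A.length + H.L1.length + C.length + R.length) with hpar | hpar
  · refine h.swap34.exists_shorter_of_odd (A := A) (B := B) (C := D.reverse) (D := C.reverse)
      hx (H.wInterior_swap34 ▸ hy) hR (H.verts_swap34 ▸ hRH) hE.swap34 hAB
      (by simp [K4Sub.swap34, hCD]) ?_
    have hP := congrArg Walk.length hCD
    have := h.lenP
    have := h.lenQ
    have := h.sum
    simp only [K4Sub.swap34, Walk.length_reverse, Walk.length_append] at hP ⊢
    rw [Nat.even_iff] at hpar
    rw [Nat.odd_iff]
    omega
  · exact h.exists_shorter_of_odd hx hy hR hRH hE hAB hCD hpar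

theorem Tight.getVert_one (hG : MemGFam G l) {H : K4Sub G} (h : H.Tight l) {y : V}
    (hy : y ∈ wInterior H.P2) (hadj : G.Adj H.u3 y) : H.P2.getVert 1 = y := by
  obtain ⟨C, D, hCD⟩ := Walk.mem_support_iff_exists_append.1 hy.1
  have hlen := congrArg Walk.length hCD
  rw [Walk.length_append, h.lenP] at hlen
  have hP2 := H.hP2
  have hC : C.length ≠ 0 := fun hc => hy.2.1 (Walk.eq_of_length_eq_zero hc).symm
  have hD : D.length ≠ 0 := fun hc => hy.2.2 (Walk.eq_of_length_eq_zero hc)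
  have hmax := (h.length_le hG).1
  have hmem : s(H.u3, y) ∈ C.edges := by
    by_contra hc
    have := hG.le_length_add (P := hadj.toWalk) (W := C) (.of_adj hadj)
      (Or.inr ⟨_, by simp, hc⟩)
    simp at this
    omega
  rw [hCD] at hP2 ⊢
  have hone := hP2.of_append_left.length_eq_one_of_mem_edges hmem
  rw [Walk.getVert_append, hone]
  simp

/-- The ends of an induced ear between the rest of `H` and the interior of `P2`. -/
theorem Tight.ear_ends (hG : MemGFam G l) {H : K4Sub G} (h : H.Tight l) (hQ : 2 ≤ H.Q1.length)
    (hL : 2 ≤ H.L1.length)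
    (hmin : ∀ H' : K4Sub G, H'.Tight l → H.P1.length ≤ H'.P1.length) {x y : V}
    (hx : x ∈ H.verts \ wInterior H.P2) (hy : y ∈ wInterior H.P2) {R : G.Walk x y}
    (hR : R.IsPath) (hRH : ∀ a ∈ R.support, a ∈ H.verts → a = x ∨ a = y)
    (hE : H.Ear l R.length x y) :
    (x = H.u3 ∧ G.Adj H.u3 y) ∨ (x = H.u4 ∧ G.Adj H.u4 y) := by
  have hQ1 : x ∈ H.Q1.support → (x = H.u3 ∧ G.Adj H.u3 y) := fun hx =>
    h.eq_u3_of_mem_Q1 hG hL hx hy hE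
  have hL1 : x ∈ H.L1.support → (x = H.u3 ∧ G.Adj H.u3 y) := fun hx =>
    h.swap12.eq_u3_of_mem_Q1 hG hQ hx hy hE.swap12
  have hy' : y ∈ wInterior H.swap34.P2 := H.wInterior_swap34 ▸ hy
  have hL2 : x ∈ H.L2.support → (x = H.u4 ∧ G.Adj H.u4 y) := fun hx =>
    h.swap34.eq_u3_of_mem_Q1 hG (hQ.trans_eq h.lenQ.symm) hx hy' hE.swap34
  have hQ2 : x ∈ H.Q2.support → (x = H.u4 ∧ G.Adj H.u4 y) := fun hx =>
    h.swap34.swap12.eq_u3_of_mem_Q1 hG (hL.trans_eq h.lenL.symm) hx hy' hE.swap34.swap12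
  obtain ⟨hxv, hxP⟩ := hx
  rcases hxv with hx | hx | hx | hx | hx | hx
  · by_cases h1 : x = H.u1
    · exact Or.inl (hL1 (h1 ▸ H.L1.start_mem_support))
    · by_cases h2 : x = H.u2
      · exact Or.inl (hQ1 (h2 ▸ H.Q1.start_mem_support))
      · obtain ⟨H', h', hlt⟩ := h.exists_shorter ⟨hx, h1, h2⟩ hy hR hRH hE
        exact absurd (hmin H' h') (not_le.2 hlt)
  · by_cases h3 : x = H.u3
    · exact Or.inl (hQ1 (h3 ▸ H.Q1.end_mem_support))
    · refine Or.inr (hL2 ?_)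
      have h4 : x = H.u4 := by
        by_contra h4
        exact hxP ⟨hx, h3, h4⟩
      exact h4 ▸ H.L2.end_mem_support
  · exact Or.inl (hQ1 hx)
  · exact Or.inr (hQ2 hx)
  · exact Or.inl (hL1 hx)
  · exact Or.inr (hL2 hx)

theorem exists_tight_minimal {H₀ : K4Sub G} (h₀ : H₀.Tight l) :
    ∃ H : K4Sub G, H.Tight l ∧ ∀ H' : K4Sub G, H'.Tight l → H.P1.length ≤ H'.P1.length := by
  obtain ⟨H, hH, hmin⟩ := WellFounded.has_min
    (InvImage.wf (fun H : K4Sub G => H.P1.length) Nat.lt_wfRel.wf) {H | H.Tight l} ⟨H₀, h₀⟩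
  exact ⟨H, hH, fun H' hH' => not_lt.1 (hmin H' hH')⟩

/-- A direct connection between the rest of `H` and the interior of `P2` starts next to an end
`u` of `P2` and ends next to the neighbour of `u` in the interior of `P2`. -/
theorem Tight.exists_ends (hG : MemGFam G l) (hl : 4 ≤ l) {H : K4Sub G} (h : H.Tight l)
    (hmin : ∀ H' : K4Sub G, H'.Tight l → H.P1.length ≤ H'.P1.length) {v1 v2 : V}
    {P : G.Walk v1 v2}
    (hP : IsDirectConnection G (H.verts \ wInterior H.P2) (wInterior H.P2) P) :
    ∃ y ∈ wInterior H.P2, G.Adj v2 y ∧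
      ((G.Adj v1 H.u3 ∧ G.Adj H.u3 y) ∨ (G.Adj v1 H.u4 ∧ G.Adj H.u4 y)) := by
  obtain ⟨⟨hPp, hPi⟩, hPv, ⟨x, hx, hvx⟩, ⟨y, hy, hvy⟩, hP1, hP2⟩ := hP
  have hyv : y ∈ H.verts := Or.inr (Or.inl hy.1)
  have hout : ∀ a ∈ P.support, a ∉ H.verts := fun a ha hv =>
    (hPv a ha).1 ⟨hv, (hPv a ha).2⟩
  have hxP : x ∉ P.support := fun hc => hout x hc hx.1
  have hyP : y ∉ P.support := fun hc => hout y hc hyv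
  have hxy : x ≠ y := fun hc => hx.2 (hc ▸ hy)
  have hRp : (Walk.cons hvx.symm (P.concat hvy)).IsPath := by
    rw [Walk.cons_isPath_iff, Walk.concat_isPath_iff]
    exact ⟨⟨hPp, hyP⟩, by simp [Walk.support_concat, hxP, hxy]⟩
  have hRs : ∀ a, a ∈ (Walk.cons hvx.symm (P.concat hvy)).support ↔
      a = x ∨ a ∈ P.support ∨ a = y := by
    intro a
    simp [Walk.support_concat]
  have hRH : ∀ a ∈ (Walk.cons hvx.symm (P.concat hvy)).support, a ∈ H.verts → a = x ∨ a = y := by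
    intro a ha hav
    rcases (hRs a).1 ha with ha | ha | ha
    · exact Or.inl ha
    · exact absurd hav (hout a ha)
    · exact Or.inr ha
  have hRR : ∀ a ∈ (Walk.cons hvx.symm (P.concat hvy)).support, a ∉ H.verts →
      ∀ b, b ∈ (Walk.cons hvx.symm (P.concat hvy)).support ∨ b ∈ H.verts → G.Adj a b →
        s(a, b) ∈ (Walk.cons hvx.symm (P.concat hvy)).edges := by
    intro a ha hav b hb hab
    have haP : a ∈ P.support := by
      rcases (hRs a).1 ha with rfl | ha | rfl
      · exact absurd hx.1 hav
      · exact ha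
      · exact absurd hyv hav
    have hbP : b ∈ P.support ∨ b ∈ H.verts := by
      rcases hb with hb | hb
      · rcases (hRs b).1 hb with rfl | hb | rfl
        · exact Or.inr hx.1
        · exact Or.inl hb
        · exact Or.inr hyv
      · exact Or.inr hb
    simp only [Walk.edges_cons, Walk.edges_concat, List.mem_cons, List.mem_append,
      List.concat_eq_append]
    rcases hbP with hb' | hb'
    · simp [hPi a haP b hb' hab]
    · by_cases hbi : b ∈ wInterior H.P2
      · obtain rfl := hP2 a haP ⟨b, hbi, hab⟩
        obtain rfl := h.eq_of_adj hG hl hav hb' hyv hab hvy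
        simp
      · obtain rfl := hP1 a haP ⟨b, ⟨hb', hbi⟩, hab⟩
        obtain rfl := h.eq_of_adj hG hl hav hb' hx.1 hab hvx
        simp [Sym2.eq_swap]
  have hE := h.ear hG hl hRp (by simp) hRH hRR
  have hP2 : 2 ≤ H.P1.length := by
    obtain ⟨C, D, hCD⟩ := Walk.mem_support_iff_exists_append.1 hy.1
    have hlen := congrArg Walk.length hCD
    rw [Walk.length_append, h.lenP] at hlen
    have hC : C.length ≠ 0 := fun hc => hy.2.1 (Walk.eq_of_length_eq_zero hc).symm
    have hD : D.length ≠ 0 := fun hc => hy.2.2 (Walk.eq_of_length_eq_zero hc)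
    omega
  have hL := hmin _ h.rot.rot
  simp only [K4Sub.rot, Walk.length_reverse] at hL
  refine ⟨y, hy, hvy, ?_⟩
  rcases h.ear_ends hG (hP2.trans (hmin _ h.rot)) (hP2.trans hL) hmin hx hy hRp hRH hE with
    ⟨rfl, h3⟩ | ⟨rfl, h4⟩
  · exact Or.inl ⟨hvx, h3⟩
  · exact Or.inr ⟨hvx, h4⟩

theorem Tight.neighbors_eq (hG : MemGFam G l) (hl : 4 ≤ l) {H : K4Sub G} (h : H.Tight l)
    {v w : V} (hv : v ∉ H.verts) (hw : w ∈ H.verts) (hvw : G.Adj v w) :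
    {x | x ∈ H.verts ∧ G.Adj v x} = {w} := by
  ext x
  refine ⟨fun hx => h.eq_of_adj hG hl hv hx.1 hw hx.2 hvw, ?_⟩
  rintro rfl
  exact ⟨hw, hvw⟩

theorem Tight.interior_neighbors_eq (hG : MemGFam G l) {H : K4Sub G} (h : H.Tight l) {y : V}
    (hy : y ∈ wInterior H.P2) (hadj : G.Adj H.u3 y) :
    {x | x ∈ wInterior H.P2 ∧ G.Adj H.u3 x} = {y} := by
  ext x
  refine ⟨fun hx => (h.getVert_one hG hx.1 hx.2).symm.trans (h.getVert_one hG hy hadj), ?_⟩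
  rintro rfl
  exact ⟨hy, hadj⟩

end K4Sub

/-- For `l ≥ 4` and a 4-vertex-critical `G ∈ 𝒢ₗ`: either `G` has no
odd `K4`-subdivision, or it has an odd `K4`-subdivision `H` such that every minimal
direct connection `(v1,v2)`-path linking `H \ P2*` and `P2*` has `N_H(v1) = {u3}` or
`{u4}`, and `N_H(v2)` equal to the set of neighbours of `u3` (resp. `u4`) in `P2*`. -/
theorem odd_K4_direct_connection {V : Type*} [Fintype V]
    (l : ℕ) (hl : 4 ≤ l) (G : SimpleGraph V) (hG : MemGFam G l)
    (hcrit : IsVertexCritical G 4) :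
    (¬ HasOddK4 G) ∨
    ∃ H : K4Sub G, IsOddK4 G H ∧
      ∀ (v1 v2 : V) (P : G.Walk v1 v2),
        IsMinimalDirectConnection G (K4Sub.verts H \ wInterior H.P2) (wInterior H.P2) P →
        (({x | x ∈ K4Sub.verts H ∧ G.Adj v1 x} = {H.u3} ∧
          {x | x ∈ K4Sub.verts H ∧ G.Adj v2 x} = {x | x ∈ wInterior H.P2 ∧ G.Adj H.u3 x}) ∨
         ({x | x ∈ K4Sub.verts H ∧ G.Adj v1 x} = {H.u4} ∧
          {x | x ∈ K4Sub.verts H ∧ G.Adj v2 x} = {x | x ∈ wInterior H.P2 ∧ G.Adj H.u4 x})) := by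
  rw [or_iff_not_imp_left, not_not]
  rintro ⟨H₀, h₀⟩
  obtain ⟨H, h, hmin⟩ := K4Sub.exists_tight_minimal (K4Sub.tight_of_isOddK4 hG h₀)
  refine ⟨H, h.isOddK4 hG (by omega), fun v1 v2 P hP => ?_⟩
  obtain ⟨y, hy, hvy, hends⟩ := h.exists_ends hG hl hmin hP.1
  have hout : ∀ a ∈ P.support, a ∉ H.verts := fun a ha hv =>
    (hP.1.2.1 a ha).1 ⟨hv, (hP.1.2.1 a ha).2⟩
  rw [h.neighbors_eq hG hl (hout v2 P.end_mem_support) (Or.inr (Or.inl hy.1)) hvy]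
  rcases hends with ⟨hv3, h3⟩ | ⟨hv4, h4⟩
  · left
    rw [h.interior_neighbors_eq hG hy h3]
    exact ⟨h.neighbors_eq hG hl (hout v1 P.start_mem_support)
      (Or.inr (Or.inl H.P2.start_mem_support)) hv3, rfl⟩
  · right
    have := h.swap34.interior_neighbors_eq hG (H.wInterior_swap34 ▸ hy) h4
    rw [K4Sub.wInterior_swap34] at this
    exact ⟨h.neighbors_eq hG hl (hout v1 P.start_mem_support)
      (Or.inr (Or.inl H.P2.end_mem_support)) hv4, this.symm⟩
end
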